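/- Under the hypotheses of the previous corollary, with additionally b_n in the interior of the arc c_nd_n converging to b in the interior of cd̅, there exist conformal maps f_n from the upper half-plane ℍ onto G_n with f_n⁻¹(a_n) = 0 and f_n⁻¹(b_n) = ∞, converging uniformly on ℍ̄ to a conformal map f : ℍ → G with f⁻¹(a) = 0, f⁻¹(b) = ∞. -/

import Mathlib

/-- A monotone, endpoint-preserving, continuous reparametrization of `[0,1]`. -/
def IsReparam (φ : unitInterval → unitInterval) : Prop :=
  Continuous φ ∧ Monotone φ ∧ φ 0 = 0 ∧ φ 1 = 1

/-- The uniform distance between curves in `ℂ`, modulo monotone reparametrization. -/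
noncomputable def curveDist (γ₁ γ₂ : C(unitInterval, ℂ)) : ℝ :=
  sInf { r : ℝ | 0 ≤ r ∧ ∃ φ ψ : unitInterval → unitInterval,
    IsReparam φ ∧ IsReparam ψ ∧ ∀ t, dist (γ₁ (φ t)) (γ₂ (ψ t)) ≤ r }

/-- A bounded simply connected domain `G`, admissible with respect to three
counterclockwise boundary points `a, c, d`: the boundary is the union of three
simple arcs `J₁ = d⌢a`, `J₂ = a⌢c`, `J₃ = c⌢d`; `J₃` does not touch the interiors
of `J₁` and `J₂`; and every point of `J₃` can be joined to infinity by a path not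
crossing `∂G`. -/
structure AdmissibleDomain where
  G : Set ℂ
  a : ℂ
  c : ℂ
  d : ℂ
  J1 : C(unitInterval, ℂ)
  J2 : C(unitInterval, ℂ)
  J3 : C(unitInterval, ℂ)
  isOpen : IsOpen G
  bounded : Bornology.IsBounded G
  connected : IsConnected G
  simplyConnected : SimplyConnectedSpace G
  inj1 : Function.Injective J1
  inj2 : Function.Injective J2
  inj3 : Function.Injective J3
  e10 : J1 0 = d
  e11 : J1 1 = a
  e20 : J2 0 = a
  e21 : J2 1 = c
  e30 : J3 0 = c
  e31 : J3 1 = d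
  boundary : Set.range J1 ∪ Set.range J2 ∪ Set.range J3 = frontier G
  noTouch1 : Set.range J3 ∩ (Set.range J1 \ {d, a}) = ∅
  noTouch2 : Set.range J3 ∩ (Set.range J2 \ {a, c}) = ∅
  toInfinity : ∀ p ∈ Set.range J3, ∃ γ : ℝ → ℂ, Continuous γ ∧ γ 0 = p ∧
    Filter.Tendsto (fun t => ‖γ t‖) Filter.atTop Filter.atTop ∧
    ∀ t : ℝ, 0 < t → γ t ∉ frontier G

/-- Convergence of admissible domains: the three boundary arcs converge in the
uniform curve metric and the marked points converge. -/
def AdmConverges (Dn : ℕ → AdmissibleDomain) (D : AdmissibleDomain) : Prop :=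
  Filter.Tendsto (fun n => curveDist (Dn n).J1 D.J1) Filter.atTop (nhds 0) ∧
  Filter.Tendsto (fun n => curveDist (Dn n).J2 D.J2) Filter.atTop (nhds 0) ∧
  Filter.Tendsto (fun n => curveDist (Dn n).J3 D.J3) Filter.atTop (nhds 0) ∧
  Filter.Tendsto (fun n => (Dn n).a) Filter.atTop (nhds D.a) ∧
  Filter.Tendsto (fun n => (Dn n).c) Filter.atTop (nhds D.c) ∧
  Filter.Tendsto (fun n => (Dn n).d) Filter.atTop (nhds D.d)

/-- Uniform local connectedness of a sequence of closed sets. -/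
def UnifLocallyConnected (A : ℕ → Set ℂ) : Prop :=
  ∀ ε : ℝ, 0 < ε → ∃ δ : ℝ, 0 < δ ∧ ∀ n : ℕ, ∀ a ∈ A n, ∀ b ∈ A n,
    dist a b < δ → ∃ B : Set ℂ, B ⊆ A n ∧ a ∈ B ∧ b ∈ B ∧
      IsCompact B ∧ IsConnected B ∧ Metric.diam B < ε

/-- The open upper half-plane. -/
def UpperHalf : Set ℂ := {z | 0 < z.im}

/-- The closed upper half-plane. -/
def UpperHalfCl : Set ℂ := {z | 0 ≤ z.im}


section
open Set Filter Topology Metric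

namespace HP

def HasLog {X : Type*} [TopologicalSpace X] (f : X → ℂ) (K : Set X) : Prop :=
  ∃ h : X → ℂ, ContinuousOn h K ∧ ∀ z ∈ K, Complex.exp (h z) = f z

section
variable {X Y : Type*} [TopologicalSpace X] [TopologicalSpace Y]

theorem HasLog.mono {f : X → ℂ} {K L : Set X} (h : HasLog f L) (hKL : K ⊆ L) : HasLog f K := by
  obtain ⟨u, hu, he⟩ := h
  exact ⟨u, hu.mono hKL, fun z hz => he z (hKL hz)⟩

theorem HasLog.congr {f g : X → ℂ} {K : Set X} (h : HasLog f K) (hfg : ∀ z ∈ K, f z = g z) :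
    HasLog g K := by
  obtain ⟨u, hu, he⟩ := h
  exact ⟨u, hu, fun z hz => (he z hz).trans (hfg z hz)⟩

theorem HasLog.mul {f g : X → ℂ} {K : Set X} (hf : HasLog f K) (hg : HasLog g K) :
    HasLog (fun z => f z * g z) K := by
  obtain ⟨u, hu, he⟩ := hf
  obtain ⟨v, hv, he'⟩ := hg
  exact ⟨fun z => u z + v z, hu.add hv, fun z hz => by rw [Complex.exp_add, he z hz, he' z hz]⟩

theorem HasLog.inv {f : X → ℂ} {K : Set X} (hf : HasLog f K) :
    HasLog (fun z => (f z)⁻¹) K := by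
  obtain ⟨u, hu, he⟩ := hf
  exact ⟨fun z => - u z, hu.neg, fun z hz => by rw [Complex.exp_neg, he z hz]⟩

theorem HasLog.div {f g : X → ℂ} {K : Set X} (hf : HasLog f K) (hg : HasLog g K) :
    HasLog (fun z => f z / g z) K :=
  (hf.mul hg.inv).congr fun z _ => (div_eq_mul_inv _ _).symm

theorem HasLog.comp {f : X → ℂ} {K : Set X} (hf : HasLog f K) {e : Y → X} {L : Set Y}
    (he : ContinuousOn e L) (hm : MapsTo e L K) : HasLog (fun y => f (e y)) L := by
  obtain ⟨u, hu, hx⟩ := hf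
  exact ⟨fun y => u (e y), hu.comp he hm, fun z hz => hx _ (hm hz)⟩

theorem hasLog_of_near_one {f : X → ℂ} {K : Set X} (hf : ContinuousOn f K)
    (h1 : ∀ z ∈ K, ‖f z - 1‖ < 1) : HasLog f K := by
  have hs : ∀ z ∈ K, f z ∈ Complex.slitPlane := by
    intro z hz
    have := Complex.mem_slitPlane_of_norm_lt_one (h1 z hz)
    simpa using this
  refine ⟨fun z => Complex.log (f z), hf.clog hs, fun z hz => ?_⟩
  exact Complex.exp_log (Complex.slitPlane_ne_zero (hs z hz))

theorem exp_eq_sub_mem {u v : ℂ} (h : Complex.exp u = Complex.exp v) :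
    u - v ∈ (AddSubgroup.zmultiples (2 * Real.pi * Complex.I) : Set ℂ) := by
  obtain ⟨n, hn⟩ := Complex.exp_eq_exp_iff_exists_int.1 h
  exact ⟨n, by simp [hn]⟩

theorem log_diff_const {S : Set X} (hS : IsPreconnected S) {h1 h2 : X → ℂ}
    (c1 : ContinuousOn h1 S) (c2 : ContinuousOn h2 S)
    (he : ∀ z ∈ S, Complex.exp (h1 z) = Complex.exp (h2 z)) {x y : X} (hx : x ∈ S) (hy : y ∈ S) :
    h1 x - h2 x = h1 y - h2 y := by
  have : DiscreteTopology (AddSubgroup.zmultiples (2 * Real.pi * Complex.I) : Set ℂ) :=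
    NormedSpace.discreteTopology_zmultiples _
  exact hS.constant_of_mapsTo (f := fun z => h1 z - h2 z) ⟨this⟩ (c1.sub c2)
    (fun z hz => exp_eq_sub_mem (he z hz)) hx hy

theorem hasLog_union_of_eq {f : X → ℂ} {K L : Set X} (hK : IsClosed K) (hL : IsClosed L)
    {u v : X → ℂ} (cu : ContinuousOn u K) (cv : ContinuousOn v L)
    (eu : ∀ z ∈ K, Complex.exp (u z) = f z) (ev : ∀ z ∈ L, Complex.exp (v z) = f z)
    (c : ℂ) (hc : ∀ z ∈ K ∩ L, u z - v z = c) : HasLog f (K ∪ L) := by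
  classical
  by_cases hne : (K ∩ L).Nonempty
  · obtain ⟨x, hx⟩ := hne
    have hc1 : Complex.exp c = 1 := by
      rw [← hc x hx, Complex.exp_sub, eu x hx.1, ev x hx.2, div_self]
      rw [← eu x hx.1]; exact Complex.exp_ne_zero _
    refine ⟨K.piecewise u (fun z => v z + c), ?_, ?_⟩
    · apply ContinuousOn.union_of_isClosed _ _ hK hL
      · exact cu.congr fun z hz => piecewise_eq_of_mem _ _ _ hz
      · refine (cv.add continuousOn_const).congr (f := fun z => v z + c) fun z hz => ?_
        by_cases hzK : z ∈ K
        · rw [piecewise_eq_of_mem _ _ _ hzK, ← hc z ⟨hzK, hz⟩]; ring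
        · rw [piecewise_eq_of_notMem _ _ _ hzK]
    · intro z hz
      by_cases hzK : z ∈ K
      · rw [piecewise_eq_of_mem _ _ _ hzK, eu z hzK]
      · rw [piecewise_eq_of_notMem _ _ _ hzK, Complex.exp_add, hc1, mul_one,
          ev z (hz.resolve_left hzK)]
  · refine ⟨K.piecewise u v, ?_, ?_⟩
    · apply ContinuousOn.union_of_isClosed _ _ hK hL
      · exact cu.congr fun z hz => piecewise_eq_of_mem _ _ _ hz
      · refine cv.congr fun z hz => ?_
        have hzK : z ∉ K := fun h => hne ⟨z, h, hz⟩
        rw [piecewise_eq_of_notMem _ _ _ hzK]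
    · intro z hz
      by_cases hzK : z ∈ K
      · rw [piecewise_eq_of_mem _ _ _ hzK, eu z hzK]
      · rw [piecewise_eq_of_notMem _ _ _ hzK, ev z (hz.resolve_left hzK)]

theorem hasLog_union {f : X → ℂ} {K L : Set X} (hK : IsClosed K) (hL : IsClosed L)
    (hKL : IsPreconnected (K ∩ L)) (fK : HasLog f K) (fL : HasLog f L) : HasLog f (K ∪ L) := by
  obtain ⟨u, cu, eu⟩ := fK
  obtain ⟨v, cv, ev⟩ := fL
  by_cases hne : (K ∩ L).Nonempty
  · obtain ⟨x, hx⟩ := hne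
    refine hasLog_union_of_eq hK hL cu cv eu ev (u x - v x) fun z hz => ?_
    exact log_diff_const hKL (cu.mono inter_subset_left) (cv.mono inter_subset_right)
      (fun w hw => (eu w hw.1).trans (ev w hw.2).symm) hz hx
  · exact hasLog_union_of_eq hK hL cu cv eu ev 0 fun z hz => (hne ⟨z, hz⟩).elim

end

theorem simplyConn_convex {E : Type*} [AddCommGroup E] [Module ℝ E] [TopologicalSpace E]
    [ContinuousAdd E] [ContinuousSMul ℝ E] {s : Set E} (hs : Convex ℝ s) (hne : s.Nonempty) :
    IsSimplyConnected s := by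
  have := hs.contractibleSpace hne
  exact (inferInstance : SimplyConnectedSpace s)

theorem hasLog_complex {f : ℂ → ℂ} (hf : Continuous f) (h0 : ∀ z, f z ≠ 0) : HasLog f univ := by
  have hs : IsSimplyConnected (univ : Set ℂ) := by
    exact simplyConn_convex convex_univ univ_nonempty
  obtain ⟨u, hu, he⟩ := Complex.exists_continuousOn_eqOn_exp_comp hs isOpen_univ hf.continuousOn
    (by rintro ⟨z, -, hz⟩; exact h0 z hz)
  exact ⟨u, hu, fun z hz => he hz⟩

theorem hasLog_ball {f : ℂ → ℂ} {c : ℂ} {r : ℝ} (hr : 0 < r) (hf : ContinuousOn f (ball c r))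
    (h0 : ∀ z ∈ ball c r, f z ≠ 0) : HasLog f (ball c r) := by
  have hs : IsSimplyConnected (ball c r : Set ℂ) := by
    exact simplyConn_convex (convex_ball c r) (nonempty_ball.2 hr)
  obtain ⟨u, hu, he⟩ := Complex.exists_continuousOn_eqOn_exp_comp hs isOpen_ball hf
    (by rintro ⟨z, hz1, hz⟩; exact h0 z hz1 hz)
  exact ⟨u, hu, fun z hz => he hz⟩

theorem hasLog_real {f : ℝ → ℂ} (hf : Continuous f) (h0 : ∀ z, f z ≠ 0) : HasLog f univ := by
  have hs : IsSimplyConnected (univ : Set ℝ) := by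
    exact simplyConn_convex convex_univ univ_nonempty
  obtain ⟨u, hu, he⟩ := Complex.exists_continuousOn_eqOn_exp_comp hs isOpen_univ hf.continuousOn
    (by rintro ⟨z, -, hz⟩; exact h0 z hz)
  exact ⟨u, hu, fun z hz => he hz⟩

theorem hasLog_unitInterval {f : unitInterval → ℂ} (hf : Continuous f) (h0 : ∀ z, f z ≠ 0) :
    ∃ h : unitInterval → ℂ, Continuous h ∧ ∀ t, Complex.exp (h t) = f t := by
  obtain ⟨u, hu, he⟩ := hasLog_real (f := Set.IccExtend zero_le_one f) (hf.Icc_extend' )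
    (fun z => h0 _)
  refine ⟨fun t => u t, (continuousOn_univ.1 hu).comp continuous_subtype_val, fun t => ?_⟩
  rw [he _ (mem_univ _)]
  exact Set.IccExtend_val zero_le_one f t

theorem hasLog_arc {f : ℂ → ℂ} (J : C(unitInterval, ℂ)) (hJ : Function.Injective J)
    (hf : ContinuousOn f (range J)) (h0 : ∀ z ∈ range J, f z ≠ 0) : HasLog f (range J) := by
  obtain ⟨u, hu, he⟩ := hasLog_unitInterval (f := fun t => f (J t))
    (hf.comp_continuous J.continuous fun t => mem_range_self t) (fun t => h0 _ (mem_range_self t))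
  have hemb : IsClosedEmbedding J := J.continuous.isClosedEmbedding hJ
  let e := hemb.isEmbedding.toHomeomorph
  classical
  refine ⟨fun z => if hz : z ∈ range J then u (e.symm ⟨z, hz⟩) else 0, ?_, ?_⟩
  · rw [continuousOn_iff_continuous_domRestrict]
    have : Continuous fun z : range J => u (e.symm z) := hu.comp e.symm.continuous
    convert this using 2 with z
    simp [Set.domRestrict]
  · intro z hz
    simp only [hz, dif_pos]
    rw [he]
    have : J (e.symm ⟨z, hz⟩) = z := by
      have := e.apply_symm_apply ⟨z, hz⟩
      exact congrArg Subtype.val this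
    rw [this]

end HP

end

section
open Set Filter Topology Metric

namespace HP

theorem tietze {X : Type} [TopologicalSpace X] [NormalSpace X] {K : Set X} (hK : IsClosed K)
    {h : X → ℂ} (hc : ContinuousOn h K) :
    ∃ g : X → ℂ, Continuous g ∧ ∀ z ∈ K, g z = h z := by
  obtain ⟨g, hg⟩ := ContinuousMap.exists_restrict_eq hK
    (⟨K.domRestrict h, continuousOn_iff_continuous_domRestrict.1 hc⟩ : C(K, ℂ))
  refine ⟨g, g.continuous, fun z hz => ?_⟩
  exact congrArg (fun F : C(K, ℂ) => F ⟨z, hz⟩) hg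

/-- lifting a function on a parameter interval to the arc. -/
theorem arc_lift {J u : ℝ → ℂ} {s t : ℝ} (hc : ContinuousOn J (Icc s t))
    (hi : InjOn J (Icc s t)) (hu : ContinuousOn u (Icc s t)) :
    ∃ v : ℂ → ℂ, ContinuousOn v (J '' Icc s t) ∧ ∀ x ∈ Icc s t, v (J x) = u x := by
  have : CompactSpace (Icc s t) := isCompact_iff_compactSpace.1 isCompact_Icc
  have hcr : Continuous ((Icc s t).domRestrict J) := continuousOn_iff_continuous_domRestrict.1 hc
  have hemb : IsClosedEmbedding ((Icc s t).domRestrict J) :=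
    hcr.isClosedEmbedding (by
      intro x y hxy
      exact Subtype.ext (hi x.2 y.2 hxy))
  obtain ⟨g, hg⟩ := ContinuousMap.exists_extension' hemb
    (⟨(Icc s t).domRestrict u, continuousOn_iff_continuous_domRestrict.1 hu⟩ : C(Icc s t, ℂ))
  refine ⟨g, g.continuous.continuousOn, fun x hx => ?_⟩
  exact congrFun hg ⟨x, hx⟩

theorem hasLog_Icc {f : ℝ → ℂ} {s t : ℝ} (hst : s ≤ t) (hf : ContinuousOn f (Icc s t))
    (h0 : ∀ x ∈ Icc s t, f x ≠ 0) : HasLog f (Icc s t) := by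
  have hc : Continuous (IccExtend hst ((Icc s t).domRestrict f)) :=
    (continuousOn_iff_continuous_domRestrict.1 hf).Icc_extend'
  obtain ⟨u, hu, he⟩ := hasLog_real hc (fun z => h0 _ (projIcc s t hst z).2)
  refine ⟨u, hu.mono (subset_univ _), fun x hx => ?_⟩
  rw [he x (mem_univ _), IccExtend_of_mem _ _ hx]
  rfl

theorem hasLog_arcR {f : ℂ → ℂ} {J : ℝ → ℂ} {s t : ℝ} (hst : s ≤ t)
    (hc : ContinuousOn J (Icc s t))
    (hi : InjOn J (Icc s t)) (hf : ContinuousOn f (J '' Icc s t))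
    (h0 : ∀ z ∈ J '' Icc s t, f z ≠ 0) : HasLog f (J '' Icc s t) := by
  obtain ⟨u, hu, he⟩ := hasLog_Icc (f := fun x => f (J x)) hst
    (hf.comp hc (mapsTo_image _ _)) (fun x hx => h0 _ (mem_image_of_mem _ hx))
  obtain ⟨v, hv, hvu⟩ := arc_lift hc hi hu
  refine ⟨v, hv, ?_⟩
  rintro _ ⟨x, hx, rfl⟩
  rw [hvu x hx, he x hx]

theorem no_log_circle {p : ℂ} {R : ℝ} (hR : 0 < R) :
    ¬ HasLog (fun z => z - p) (sphere p R) := by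
  rintro ⟨h, hc, he⟩
  have hm : ∀ t : ℝ, p + R * Complex.exp (t * Complex.I) ∈ sphere p R := by
    intro t
    simp [Complex.norm_exp_ofReal_mul_I, abs_of_pos hR]
  have hcont : Continuous fun t : ℝ => h (p + R * Complex.exp (t * Complex.I)) :=
    hc.comp_continuous (by fun_prop) hm
  have := log_diff_const (X := ℝ) (S := univ) isPreconnected_univ hcont.continuousOn
    (h2 := fun t : ℝ => (Real.log R : ℂ) + t * Complex.I) (by fun_prop) (by
      intro t _
      rw [he _ (hm t), Complex.exp_add, ← Complex.ofReal_exp, Real.exp_log hR]; ring)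
    (mem_univ 0) (mem_univ (2 * Real.pi))
  simp at this

/-- near-point logs -/
theorem hasLog_near {K : Set ℂ} {x y : ℂ} (hx : ∀ z ∈ K, ‖x - y‖ < ‖z - x‖) :
    HasLog (fun z => (z - y) / (z - x)) K := by
  have hne : ∀ z ∈ K, z - x ≠ 0 := fun z hz h => by
    have := hx z hz; rw [h, norm_zero] at this; exact absurd this (not_lt.2 (norm_nonneg _))
  apply hasLog_of_near_one
  · exact ContinuousOn.div (by fun_prop) (by fun_prop) hne
  · intro z hz
    have : (z - y) / (z - x) - 1 = (x - y) / (z - x) := by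
      have := hne z hz
      field_simp; ring
    rw [this, norm_div, div_lt_one (norm_pos_iff.2 (hne z hz))]
    exact hx z hz

def Conn (K : Set ℂ) (p q : ℂ) : Prop :=
  ∃ T : Set ℂ, IsPreconnected T ∧ Disjoint T K ∧ p ∈ T ∧ q ∈ T

theorem Conn.symm {K : Set ℂ} {p q : ℂ} (h : Conn K p q) : Conn K q p := by
  obtain ⟨T, h1, h2, h3, h4⟩ := h
  exact ⟨T, h1, h2, h4, h3⟩

theorem Conn.trans {K : Set ℂ} {p q r : ℂ} (h : Conn K p q) (h' : Conn K q r) : Conn K p r := by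
  obtain ⟨T, h1, h2, h3, h4⟩ := h
  obtain ⟨T', h1', h2', h3', h4'⟩ := h'
  exact ⟨T ∪ T', h1.union q h4 h3' h1', disjoint_union_left.2 ⟨h2, h2'⟩, Or.inl h3, Or.inr h4'⟩

theorem Conn.mono {K L : Set ℂ} {p q : ℂ} (h : Conn L p q) (hKL : K ⊆ L) : Conn K p q := by
  obtain ⟨T, h1, h2, h3, h4⟩ := h
  exact ⟨T, h1, h2.mono_right hKL, h3, h4⟩

theorem Conn.left {K : Set ℂ} {p q : ℂ} (h : Conn K p q) : p ∉ K := by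
  obtain ⟨T, h1, h2, h3, h4⟩ := h
  exact disjoint_left.1 h2 h3

theorem Conn.right {K : Set ℂ} {p q : ℂ} (h : Conn K p q) : q ∉ K := h.symm.left

theorem hasLog_of_conn {K : Set ℂ} (hK : IsClosed K) {p q : ℂ} (h : Conn K p q) :
    HasLog (fun z => (z - p) / (z - q)) K := by
  obtain ⟨T, hT, hd, hp, hq⟩ := h
  have hne : ∀ x ∈ T, ∀ z ∈ K, z - x ≠ 0 := fun x hx z hz h => by
    rw [sub_eq_zero] at h; subst h; exact disjoint_left.1 hd hx hz
  refine hT.induction₂' (fun x y => HasLog (fun z => (z - x) / (z - y)) K) ?_ ?_ hp hq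
  · intro x hx
    have : ∀ᶠ y in 𝓝 x, ∀ z ∈ K, ‖x - y‖ < ‖z - x‖ := by
      have hxK : x ∈ Kᶜ := disjoint_left.1 hd hx
      obtain ⟨r, hr, hb⟩ := Metric.isOpen_iff.1 hK.isOpen_compl x hxK
      filter_upwards [Metric.ball_mem_nhds x hr] with y hy z hz
      have h1 : ¬ dist z x < r := fun h => hb h hz
      rw [mem_ball, dist_comm, dist_eq_norm] at hy
      rw [dist_eq_norm] at h1
      linarith
    filter_upwards [mem_nhdsWithin_of_mem_nhds this] with y hy
    have := hasLog_near hy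
    refine ⟨this.inv.congr fun z _ => by rw [inv_div], this⟩
  · intro x y w hx hy hw h1 h2
    refine (h1.mul h2).congr fun z hz => ?_
    have := hne y hy z hz
    have := hne w hw z hz
    field_simp

theorem no_log {V : Set ℂ} (hV : IsOpen V) (hb : Bornology.IsBounded V) {p q : ℂ} (hp : p ∈ V)
    (hq : q ∉ closure V) : ¬ HasLog (fun z => (z - p) / (z - q)) (frontier V) := by
  rintro ⟨h, hc, he⟩
  obtain ⟨g, gc, hg⟩ := tietze isClosed_frontier hc
  classical
  let E : ℂ → ℂ := (closure V).piecewise (fun z => Complex.exp (g z) * (z - q)) (fun z => z - p)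
  have hEc : Continuous E := by
    have h1 : closure V ∪ Vᶜ = univ := by
      rw [eq_univ_iff_forall]; intro z
      by_cases hz : z ∈ V
      · exact Or.inl (subset_closure hz)
      · exact Or.inr hz
    rw [← continuousOn_univ, ← h1]
    apply ContinuousOn.union_of_isClosed _ _ isClosed_closure hV.isClosed_compl
    · have : Continuous (fun z => Complex.exp (g z) * (z - q)) := by fun_prop
      exact this.continuousOn.congr fun z hz => piecewise_eq_of_mem _ _ _ hz
    · have : Continuous (fun z : ℂ => z - p) := by fun_prop
      refine this.continuousOn.congr fun z hz => ?_
      by_cases hzV : z ∈ closure V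
      · have hzf : z ∈ frontier V := by rw [hV.frontier_eq]; exact ⟨hzV, hz⟩
        have : z - q ≠ 0 := fun h => by rw [sub_eq_zero] at h; subst h; exact hq hzV
        simp only [E]
        rw [piecewise_eq_of_mem _ _ _ hzV, hg z hzf, he z hzf, div_mul_cancel₀ _ this]
      · exact piecewise_eq_of_notMem _ _ _ hzV
  have hE0 : ∀ z, E z ≠ 0 := by
    intro z
    by_cases hzV : z ∈ closure V
    · simp only [E]
      rw [piecewise_eq_of_mem _ _ _ hzV]
      refine mul_ne_zero (Complex.exp_ne_zero _) fun h => ?_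
      rw [sub_eq_zero] at h; subst h; exact hq hzV
    · simp only [E]
      rw [piecewise_eq_of_notMem _ _ _ hzV]
      intro h
      rw [sub_eq_zero] at h; subst h; exact hzV (subset_closure hp)
  have hlog := hasLog_complex hEc hE0
  obtain ⟨R, hR⟩ := hb.closure.subset_closedBall p
  refine no_log_circle (p := p) (R := max R 0 + 1) (by positivity) ((hlog.mono (subset_univ _)).congr fun z hz => ?_)
  have hzV : z ∉ closure V := fun h => by
    have h1 := hR h
    rw [mem_closedBall] at h1
    rw [mem_sphere] at hz
    have := le_max_left R 0
    linarith
  exact piecewise_eq_of_notMem _ _ _ hzV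

theorem isPreconnected_compl_closedBall {R : ℝ} (hR : 0 < R) :
    IsPreconnected {z : ℂ | R < ‖z‖} := by
  have : {z : ℂ | R < ‖z‖} = Complex.exp '' {z | Real.log R < z.re} := by
    ext z
    simp only [mem_setOf_eq, mem_image]
    constructor
    · intro h
      have hz : z ≠ 0 := norm_pos_iff.1 (hR.trans h)
      refine ⟨Complex.log z, ?_, Complex.exp_log hz⟩
      rw [Complex.log_re]; exact Real.log_lt_log hR h
    · rintro ⟨w, hw, rfl⟩
      rw [Complex.norm_exp]
      exact (Real.log_lt_iff_lt_exp hR).1 hw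
  rw [this]
  exact ((convex_halfSpace_re_gt _).isPreconnected).image _ Complex.continuous_exp.continuousOn

theorem frontier_comp_subset {K : Set ℂ} (hK : IsClosed K) (p : ℂ) :
    frontier (connectedComponentIn Kᶜ p) ⊆ K := by
  intro z hz
  by_contra hzK
  have hop : IsOpen (connectedComponentIn Kᶜ p) := hK.isOpen_compl.connectedComponentIn
  rw [hop.frontier_eq] at hz
  have hzo : IsOpen (connectedComponentIn Kᶜ z) := hK.isOpen_compl.connectedComponentIn
  obtain ⟨w, hw1, hw2⟩ := mem_closure_iff.1 hz.1 _ hzo (mem_connectedComponentIn hzK)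
  have h1 := connectedComponentIn_eq hw1
  have h2 := connectedComponentIn_eq hw2
  apply hz.2
  rw [h2, ← h1]; exact mem_connectedComponentIn hzK

theorem conn_iff_mem {K : Set ℂ} {p q : ℂ} : Conn K p q ↔ q ∈ connectedComponentIn Kᶜ p ∧ p ∉ K := by
  constructor
  · intro h
    refine ⟨?_, h.left⟩
    obtain ⟨T, h1, h2, h3, h4⟩ := h
    exact h1.subset_connectedComponentIn h3 (subset_compl_iff_disjoint_right.2 h2) h4
  · rintro ⟨h, hp⟩
    exact ⟨connectedComponentIn Kᶜ p, isPreconnected_connectedComponentIn,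
      subset_compl_iff_disjoint_right.1 (connectedComponentIn_subset _ _),
      mem_connectedComponentIn hp, h⟩

theorem conn_of_hasLog {K : Set ℂ} (hK : IsCompact K) {p q : ℂ} (hp : p ∉ K) (hq : q ∉ K)
    (h : HasLog (fun z => (z - p) / (z - q)) K) : Conn K p q := by
  by_contra hcon
  have key : ∀ p q : ℂ, p ∉ K → q ∉ K → HasLog (fun z => (z - p) / (z - q)) K → ¬ Conn K p q →
      Bornology.IsBounded (connectedComponentIn Kᶜ p) → False := by
    intro p q hp hq h hcon hb
    have hop : IsOpen (connectedComponentIn Kᶜ p) := hK.isClosed.isOpen_compl.connectedComponentIn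
    have hqV : q ∉ connectedComponentIn Kᶜ p := fun h => hcon (conn_iff_mem.2 ⟨h, hp⟩)
    refine no_log hop hb (mem_connectedComponentIn hp) ?_
      (h.mono (frontier_comp_subset hK.isClosed p))
    intro hqc
    apply hq
    apply frontier_comp_subset hK.isClosed p
    rw [hop.frontier_eq]; exact ⟨hqc, hqV⟩
  obtain ⟨R, hR0, hR⟩ := hK.isBounded.subset_closedBall_lt 0 0
  have hout : {z : ℂ | R < ‖z‖} ⊆ Kᶜ := by
    intro z hz hzK
    have := hR hzK
    simp at this
    simp at hz; linarith
  have hpre := isPreconnected_compl_closedBall hR0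
  by_cases hbp : connectedComponentIn Kᶜ p ⊆ closedBall 0 R
  · exact key p q hp hq h hcon (isBounded_closedBall.subset hbp)
  by_cases hbq : connectedComponentIn Kᶜ q ⊆ closedBall 0 R
  · refine key q p hq hp (h.inv.congr fun z _ => by rw [inv_div]) (fun h => hcon h.symm)
      (isBounded_closedBall.subset hbq)
  obtain ⟨x, hx, hxR⟩ := not_subset.1 hbp
  obtain ⟨y, hy, hyR⟩ := not_subset.1 hbq
  have hc1 : Conn K p x := conn_iff_mem.2 ⟨hx, hp⟩
  have hc2 : Conn K q y := conn_iff_mem.2 ⟨hy, hq⟩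
  have hc3 : Conn K x y := ⟨_, hpre, subset_compl_iff_disjoint_right.1 hout, by simpa using hxR,
    by simpa using hyR⟩
  exact hcon (hc1.trans (hc3.trans hc2.symm))

theorem janiszewski {K L : Set ℂ} (hK : IsCompact K) (hL : IsCompact L)
    (hKL : IsPreconnected (K ∩ L)) {p q : ℂ} (h1 : Conn K p q) (h2 : Conn L p q) :
    Conn (K ∪ L) p q := by
  refine conn_of_hasLog (hK.union hL) ?_ ?_ (hasLog_union hK.isClosed hL.isClosed hKL
    (hasLog_of_conn hK.isClosed h1) (hasLog_of_conn hL.isClosed h2))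
  · rintro (h | h)
    · exact h1.left h
    · exact h2.left h
  · rintro (h | h)
    · exact h1.right h
    · exact h2.right h

/-- two far-away points are connected -/
theorem conn_far {K : Set ℂ} {R : ℝ} (hR : 0 < R) (hK : K ⊆ closedBall 0 R) {x y : ℂ}
    (hx : R < ‖x‖) (hy : R < ‖y‖) : Conn K x y := by
  refine ⟨{z : ℂ | R < ‖z‖}, isPreconnected_compl_closedBall hR, ?_, hx, hy⟩
  rw [disjoint_left]
  intro z hz hzK
  have := hK hzK
  simp at this hz; linarith

end HP

end

section
open Set Filter Topology Metric

namespace HP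

open Classical in
/-- increment of a continuous logarithm of `f` over `[s,t]`. -/
noncomputable def inc (f : ℝ → ℂ) (s t : ℝ) : ℂ :=
  if h : HasLog f (Icc s t) then h.choose t - h.choose s else 0

theorem inc_eq {f h : ℝ → ℂ} {s t : ℝ} (hst : s ≤ t) (hc : ContinuousOn h (Icc s t))
    (he : ∀ x ∈ Icc s t, Complex.exp (h x) = f x) : inc f s t = h t - h s := by
  have hl : HasLog f (Icc s t) := ⟨h, hc, he⟩
  rw [inc, dif_pos hl]
  have := log_diff_const isPreconnected_Icc hl.choose_spec.1 hc
    (fun x hx => (hl.choose_spec.2 x hx).trans (he x hx).symm)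
    (left_mem_Icc.2 hst) (right_mem_Icc.2 hst)
  linear_combination -this

theorem inc_congr {f g : ℝ → ℂ} {s t : ℝ} (hst : s ≤ t) (hf : HasLog f (Icc s t))
    (h : ∀ x ∈ Icc s t, f x = g x) : inc f s t = inc g s t := by
  obtain ⟨u, cu, eu⟩ := hf
  rw [inc_eq hst cu eu, inc_eq hst cu fun x hx => (eu x hx).trans (h x hx)]

theorem inc_add {f : ℝ → ℂ} {s r t : ℝ} (hsr : s ≤ r) (hrt : r ≤ t) (hf : HasLog f (Icc s t)) :
    inc f s r + inc f r t = inc f s t := by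
  obtain ⟨u, cu, eu⟩ := hf
  rw [inc_eq (hsr.trans hrt) cu eu,
    inc_eq hsr (cu.mono (Icc_subset_Icc_right hrt)) fun x hx => eu x (Icc_subset_Icc_right hrt hx),
    inc_eq hrt (cu.mono (Icc_subset_Icc_left hsr)) fun x hx => eu x (Icc_subset_Icc_left hsr hx)]
  ring

theorem inc_mul {f g : ℝ → ℂ} {s t : ℝ} (hst : s ≤ t) (hf : HasLog f (Icc s t))
    (hg : HasLog g (Icc s t)) : inc (fun x => f x * g x) s t = inc f s t + inc g s t := by
  obtain ⟨u, cu, eu⟩ := hf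
  obtain ⟨v, cv, ev⟩ := hg
  rw [inc_eq hst cu eu, inc_eq hst cv ev, inc_eq (h := fun x => u x + v x) hst (cu.add cv)]
  · ring
  · intro x hx; rw [Complex.exp_add, eu x hx, ev x hx]

theorem inc_div {f g : ℝ → ℂ} {s t : ℝ} (hst : s ≤ t) (hf : HasLog f (Icc s t))
    (hg : HasLog g (Icc s t)) : inc (fun x => f x / g x) s t = inc f s t - inc g s t := by
  obtain ⟨u, cu, eu⟩ := hf
  obtain ⟨v, cv, ev⟩ := hg
  rw [inc_eq hst cu eu, inc_eq hst cv ev, inc_eq (h := fun x => u x - v x) hst (cu.sub cv)]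
  · ring
  · intro x hx; rw [Complex.exp_sub, eu x hx, ev x hx]

theorem exp_inc {f : ℝ → ℂ} {s t : ℝ} (hst : s ≤ t) (hf : HasLog f (Icc s t)) :
    Complex.exp (inc f s t) = f t / f s := by
  obtain ⟨u, cu, eu⟩ := hf
  rw [inc_eq hst cu eu, Complex.exp_sub, eu _ (left_mem_Icc.2 hst), eu _ (right_mem_Icc.2 hst)]

/-- if `f` is `F ∘ J` with a log `h` of `F` on a set containing the arc -/
theorem inc_of_log {F h : ℂ → ℂ} {J : ℝ → ℂ} {K : Set ℂ} {s t : ℝ} (hst : s ≤ t)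
    (hJ : ContinuousOn J (Icc s t)) (hm : MapsTo J (Icc s t) K) (hc : ContinuousOn h K)
    (he : ∀ z ∈ K, Complex.exp (h z) = F z) :
    inc (fun x => F (J x)) s t = h (J t) - h (J s) :=
  inc_eq (h := fun x => h (J x)) hst (hc.comp hJ hm) fun x hx => he _ (hm hx)

theorem inc_near {f : ℝ → ℂ} {s t : ℝ} (hst : s ≤ t) (hc : ContinuousOn f (Icc s t))
    (h1 : ∀ x ∈ Icc s t, ‖f x - 1‖ < 1) :
    inc f s t = Complex.log (f t) - Complex.log (f s) := by
  have hs : ∀ z ∈ Icc s t, f z ∈ Complex.slitPlane := by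
    intro z hz
    have := Complex.mem_slitPlane_of_norm_lt_one (h1 z hz)
    simpa using this
  exact inc_eq (h := fun x => Complex.log (f x)) hst (hc.clog hs)
    fun x hx => Complex.exp_log (Complex.slitPlane_ne_zero (hs x hx))

theorem inc_rescale {f : ℝ → ℂ} {s t : ℝ} (hst : s ≤ t) (hf : HasLog f (Icc s t)) :
    inc f s t = inc (fun x => f (s + (t - s) * x)) 0 1 := by
  obtain ⟨u, cu, eu⟩ := hf
  have hm : MapsTo (fun x : ℝ => s + (t - s) * x) (Icc 0 1) (Icc s t) := by
    intro x hx
    constructor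
    · nlinarith [hx.1, hx.2]
    · nlinarith [hx.1, hx.2]
  rw [inc_eq hst cu eu, inc_eq (h := fun x => u (s + (t - s) * x)) zero_le_one
    (cu.comp (by fun_prop) hm) fun x hx => eu _ (hm hx)]
  simp

theorem tendsto_inc01 {ι : Type*} {l : Filter ι} {F : ι → ℝ → ℂ} {f : ℝ → ℂ}
    (hF : ∀ᶠ i in l, ContinuousOn (F i) (Icc 0 1)) (hf : ContinuousOn f (Icc 0 1))
    (h0 : ∀ x ∈ Icc (0:ℝ) 1, f x ≠ 0) (hu : TendstoUniformlyOn F f l (Icc 0 1)) :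
    Tendsto (fun i => inc (F i) 0 1) l (𝓝 (inc f 0 1)) := by
  obtain ⟨m, hm0, hm⟩ : ∃ m > 0, ∀ x ∈ Icc (0:ℝ) 1, m ≤ ‖f x‖ := by
    obtain ⟨x, hx, hmin⟩ := isCompact_Icc.exists_isMinOn (nonempty_Icc.2 zero_le_one) hf.norm
    exact ⟨‖f x‖, norm_pos_iff.2 (h0 x hx), fun y hy => hmin hy⟩
  have hfl := hasLog_Icc zero_le_one hf h0
  have hev : ∀ᶠ i in l, inc (F i) 0 1 = inc f 0 1 +
      (Complex.log (F i 1 / f 1) - Complex.log (F i 0 / f 0)) := by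
    filter_upwards [hF, Metric.tendstoUniformlyOn_iff.1 hu m hm0] with i hi hi2
    have hc : ContinuousOn (fun x => F i x / f x) (Icc 0 1) := hi.div hf h0
    have hn : ∀ x ∈ Icc (0:ℝ) 1, ‖F i x / f x - 1‖ < 1 := by
      intro x hx
      have h1 : F i x / f x - 1 = (F i x - f x) / f x := by
        have := h0 x hx; field_simp
      rw [h1, norm_div, div_lt_one (norm_pos_iff.2 (h0 x hx)), ← dist_eq_norm, dist_comm]
      exact (hi2 x hx).trans_le (hm x hx)
    rw [← inc_near zero_le_one hc hn, ← inc_mul zero_le_one hfl (hasLog_of_near_one hc hn)]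
    apply (inc_congr zero_le_one _ _).symm
    · exact hfl.mul (hasLog_of_near_one hc hn)
    · intro x hx
      have := h0 x hx
      field_simp
  refine (tendsto_congr' hev).2 ?_
  have hlim : ∀ x ∈ Icc (0:ℝ) 1, Tendsto (fun i => Complex.log (F i x / f x)) l (𝓝 0) := by
    intro x hx
    have h1 : Tendsto (fun i => F i x / f x) l (𝓝 1) := by
      have := (hu.tendsto_at hx).div_const (f x)
      rwa [div_self (h0 x hx)] at this
    have := h1.clog (by simp)
    simpa using this
  have := (tendsto_const_nhds (x := inc f 0 1)).add
    ((hlim 1 (by simp)).sub (hlim 0 (by simp)))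
  simpa using this

/-- joint continuity of increments in the curve, base point and end points. -/
theorem tendsto_inc {ι : Type*} {l : Filter ι} {Γ : ι → ℝ → ℂ} {γ : ℝ → ℂ} {p : ι → ℂ} {q : ℂ}
    {s t : ι → ℝ} {s' t' : ℝ}
    (hΓ : ∀ i, Continuous (Γ i)) (hγ : Continuous γ) (hu : TendstoUniformly Γ γ l)
    (hp : Tendsto p l (𝓝 q)) (hs : Tendsto s l (𝓝 s')) (ht : Tendsto t l (𝓝 t'))
    (hst : ∀ i, s i ≤ t i) (hst' : s' ≤ t') (hq : ∀ x ∈ Icc s' t', γ x ≠ q)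
    (hpn : ∀ᶠ i in l, ∀ x ∈ Icc (s i) (t i), Γ i x ≠ p i) :
    Tendsto (fun i => inc (fun x => Γ i x - p i) (s i) (t i)) l
      (𝓝 (inc (fun x => γ x - q) s' t')) := by
  rw [inc_rescale hst' (hasLog_Icc hst' (by fun_prop) fun x hx => sub_ne_zero.2 (hq x hx))]
  have : ∀ᶠ i in l, inc (fun x => Γ i x - p i) (s i) (t i) =
      inc (fun x => Γ i (s i + (t i - s i) * x) - p i) 0 1 := by
    filter_upwards [hpn] with i hi
    have := hΓ i
    rw [inc_rescale (hst i) (hasLog_Icc (hst i) (by fun_prop)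
      fun x hx => sub_ne_zero.2 (hi x hx))]
  refine (tendsto_congr' this).2 ?_
  apply tendsto_inc01
  · exact Eventually.of_forall fun i => by have := hΓ i; fun_prop
  · fun_prop
  · intro x hx
    refine sub_ne_zero.2 (hq _ ?_)
    constructor
    · nlinarith [hx.1, hx.2]
    · nlinarith [hx.1, hx.2]
  · rw [Metric.tendstoUniformlyOn_iff]
    intro ε hε
    have hcomp : UniformContinuousOn γ (Icc (s' - 2) (t' + 2)) :=
      isCompact_Icc.uniformContinuousOn_of_continuous hγ.continuousOn
    obtain ⟨δ, hδ, hγδ⟩ := Metric.uniformContinuousOn_iff.1 hcomp (ε/3) (by positivity)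
    filter_upwards [Metric.tendsto_nhds.1 hs (min (δ/2) 1) (by positivity),
      Metric.tendsto_nhds.1 ht (min (δ/2) 1) (by positivity),
      Metric.tendsto_nhds.1 hp (ε/3) (by positivity),
      Metric.tendstoUniformly_iff.1 hu (ε/3) (by positivity)] with i h1 h2 h3 h4 x hx
    have h5 := h4 (s i + (t i - s i) * x)
    rw [Real.dist_eq] at h1 h2
    have h1a := abs_lt.1 (h1.trans_le (min_le_left _ _))
    have h1b := abs_lt.1 (h1.trans_le (min_le_right _ _))
    have h2a := abs_lt.1 (h2.trans_le (min_le_left _ _))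
    have h2b := abs_lt.1 (h2.trans_le (min_le_right _ _))
    have h6 := hγδ (s' + (t' - s') * x)
      (by constructor <;> nlinarith [hx.1, hx.2])
      (s i + (t i - s i) * x) (by constructor <;> nlinarith [hx.1, hx.2, hst i])
      (by
        rw [Real.dist_eq]
        have : s' + (t' - s') * x - (s i + (t i - s i) * x)
          = (1 - x) * (s' - s i) + x * (t' - t i) := by ring
        rw [this, abs_lt]
        constructor <;> nlinarith [hx.1, hx.2])
    rw [dist_eq_norm] at *
    have h7 : γ (s' + (t' - s') * x) - q - (Γ i (s i + (t i - s i) * x) - p i)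
      = (γ (s' + (t' - s') * x) - γ (s i + (t i - s i) * x)) +
        (γ (s i + (t i - s i) * x) - Γ i (s i + (t i - s i) * x)) + (p i - q) := by ring
    rw [h7]
    refine (norm_add₃_le).trans_lt ?_
    linarith

end HP

end

section
open Set Filter Topology Metric

namespace HP

theorem hurwitz {ι : Type*} {l : Filter ι} [NeBot l] {F : ι → ℂ → ℂ} {f : ℂ → ℂ} {U : Set ℂ}
    (hU : IsOpen U) (hpre : IsPreconnected U) (hF : ∀ᶠ i in l, DifferentiableOn ℂ (F i) U)
    (hlim : TendstoLocallyUniformlyOn F f l U) (h0 : ∀ᶠ i in l, ∀ z ∈ U, F i z ≠ 0) :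
    (∀ z ∈ U, f z ≠ 0) ∨ (∀ z ∈ U, f z = 0) := by
  have hf : DifferentiableOn ℂ f U := hlim.differentiableOn hF hU
  have hfa : AnalyticOnNhd ℂ f U := hf.analyticOnNhd hU
  by_cases hz : ∀ z ∈ U, f z ≠ 0
  · exact Or.inl hz
  right
  push Not at hz
  obtain ⟨z0, hz0, hfz⟩ := hz
  rcases (hfa z0 hz0).eventually_eq_zero_or_eventually_ne_zero with h | h
  · exact fun z hz => hfa.eqOn_zero_of_preconnected_of_eventuallyEq_zero hpre hz0 h hz
  exfalso
  rw [eventually_nhdsWithin_iff] at h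
  obtain ⟨r, hr, hb⟩ := Metric.eventually_nhds_iff_ball.1 (h.and (hU.mem_nhds hz0))
  have hrU : closedBall z0 (r/2) ⊆ U := fun z hz => (hb z (closedBall_subset_ball (by linarith) hz)).2
  have hsc : sphere z0 (r/2) ⊆ U := sphere_subset_closedBall.trans hrU
  have hsne : (sphere z0 (r/2)).Nonempty := NormedSpace.sphere_nonempty.2 (by linarith)
  obtain ⟨x, hx, hmin⟩ := (isCompact_sphere z0 (r/2)).exists_isMinOn hsne
    (hf.continuousOn.mono hsc).norm
  have hm : 0 < ‖f x‖ := by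
    refine norm_pos_iff.2 ((hb x ?_).1 ?_)
    · rw [mem_sphere] at hx; rw [mem_ball]; linarith
    · rintro rfl; simp at hx; linarith
  have hunif : TendstoUniformlyOn F f l (closedBall z0 (r/2)) :=
    (tendstoLocallyUniformlyOn_iff_forall_isCompact hU).1 hlim _ hrU (isCompact_closedBall _ _)
  obtain ⟨i, hi1, hi2, hi3⟩ := (hF.and (h0.and
    (Metric.tendstoUniformlyOn_iff.1 hunif (‖f x‖/2) (by positivity)))).exists
  have hd : DifferentiableOn ℂ (fun z => (F i z)⁻¹) U := hi1.inv hi2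
  have hcl : closure (ball z0 (r/2)) = closedBall z0 (r/2) := closure_ball _ (by linarith)
  have hz0c : z0 ∈ closedBall z0 (r/2) := mem_closedBall_self (by linarith)
  have := Complex.norm_le_of_forall_mem_frontier_norm_le (U := ball z0 (r/2))
    (f := fun z => (F i z)⁻¹) (C := (‖f x‖/2)⁻¹) isBounded_ball
    ((hd.mono (by rw [hcl]; exact hrU)).diffContOnCl) (by
      intro z hz
      rw [frontier_ball _ (by linarith)] at hz
      rw [norm_inv]
      apply inv_anti₀ (by positivity)
      have h1 := hi3 z (sphere_subset_closedBall hz)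
      rw [dist_eq_norm] at h1
      have h2 : ‖f x‖ ≤ ‖f z‖ := hmin hz
      have h3 := norm_sub_norm_le (f z) (F i z)
      linarith) (by rw [hcl]; exact hz0c)
  rw [norm_inv] at this
  have h1 := hi3 z0 hz0c
  rw [hfz, dist_zero_left] at h1
  exact absurd this (not_le.2 (inv_strictAnti₀ (norm_pos_iff.2 (hi2 z0 hz0)) h1))

theorem hurwitz_inj {ι : Type*} {l : Filter ι} [NeBot l] {F : ι → ℂ → ℂ} {f : ℂ → ℂ} {U : Set ℂ}
    (hU : IsOpen U) (hpre : IsPreconnected U) (hF : ∀ᶠ i in l, DifferentiableOn ℂ (F i) U)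
    (hlim : TendstoLocallyUniformlyOn F f l U) (h0 : ∀ᶠ i in l, InjOn (F i) U)
    {x0 : ℂ} (hx0 : x0 ∈ U) (hd : deriv f x0 ≠ 0) : InjOn f U := by
  intro x hx y hy hxy
  by_contra hne
  have hf : DifferentiableOn ℂ f U := hlim.differentiableOn hF hU
  have hfa : AnalyticOnNhd ℂ f U := hf.analyticOnNhd hU
  obtain ⟨r, hr, hb⟩ := Metric.isOpen_iff.1 (hU.inter (isOpen_compl_singleton (x := x))) y
    ⟨hy, fun h => hne h.symm⟩
  have hpt : Tendsto (fun i => F i x) l (𝓝 (f x)) := hlim.tendsto_at hx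
  have hlim' : TendstoLocallyUniformlyOn (fun i z => F i z - F i x) (fun z => f z - f x) l
      (ball y r) := by
    have h1 := hlim.mono (hb.trans inter_subset_left)
    have h2 : TendstoLocallyUniformlyOn (fun i (_ : ℂ) => F i x) (fun _ => f x) l (ball y r) := by
      apply TendstoUniformlyOn.tendstoLocallyUniformlyOn
      rw [Metric.tendstoUniformlyOn_iff]
      intro ε hε
      filter_upwards [Metric.tendsto_nhds.1 hpt ε hε] with i hi z hz
      rwa [dist_comm]
    exact h1.fun_sub h2
  rcases hurwitz isOpen_ball (convex_ball y r).isPreconnected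
    (hF.mono fun i hi => (hi.mono (hb.trans inter_subset_left)).sub_const _) hlim'
    (h0.mono fun i hi z hz h => by
      have := hi (hb hz).1 hx (sub_eq_zero.1 h)
      exact (hb hz).2 this) with h | h
  · exact h y (mem_ball_self hr) (by rw [hxy, sub_self])
  · have : EqOn f (fun _ => f x) U :=
      hfa.eqOn_of_preconnected_of_eventuallyEq (fun z _ => analyticAt_const) hpre hy (by
        filter_upwards [ball_mem_nhds y hr] with z hz
        exact sub_eq_zero.1 (h z hz))
    apply hd
    have h2 : f =ᶠ[𝓝 x0] fun _ => f x := by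
      filter_upwards [hU.mem_nhds hx0] with z hz using this hz
    rw [h2.deriv_eq, deriv_const]

theorem deriv_ne_zero_of_inj {f : ℂ → ℂ} {U : Set ℂ} (hU : IsOpen U)
    (hf : DifferentiableOn ℂ f U) (hi : InjOn f U) {x : ℂ} (hx : x ∈ U) : deriv f x ≠ 0 := by
  obtain ⟨r, hr, hb⟩ := Metric.isOpen_iff.1 hU x hx
  have hd' : DifferentiableOn ℂ (deriv f) U := hf.deriv hU
  set B := ball x (r/4) with hB
  have hlim : TendstoLocallyUniformlyOn (fun (h : ℂ) z => (f (z + h) - f z) / h) (deriv f)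
      (𝓝[≠] 0) B := by
    apply TendstoUniformlyOn.tendstoLocallyUniformlyOn
    rw [Metric.tendstoUniformlyOn_iff]
    intro ε hε
    have huc : UniformContinuousOn (deriv f) (closedBall x (r/2)) :=
      (isCompact_closedBall _ _).uniformContinuousOn_of_continuous
        (hd'.continuousOn.mono ((closedBall_subset_ball (by linarith)).trans hb))
    obtain ⟨δ, hδ, hu⟩ := Metric.uniformContinuousOn_iff.1 huc (ε/2) (by positivity)
    have : ball (0:ℂ) (min δ (r/4)) ∈ 𝓝[≠] (0:ℂ) :=
      mem_nhdsWithin_of_mem_nhds (ball_mem_nhds _ (by positivity))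
    filter_upwards [this, self_mem_nhdsWithin] with h hh hh0 z hz
    have hh0' : h ≠ 0 := hh0
    have hhn : ‖h‖ < min δ (r/4) := by simpa using hh
    have hzb : dist z x < r/4 := hz
    have hsub : ball z (min δ (r/4)) ⊆ ball x (r/2) := fun w hw => by
      have h1 : dist w z < r/4 := (mem_ball.1 hw).trans_le (min_le_right _ _)
      have := dist_triangle w z x
      rw [mem_ball]; linarith
    have key := (convex_ball z (min δ (r/4))).norm_image_sub_le_of_norm_deriv_le
      (f := fun w => f w - deriv f z * w) (C := ε/2) (x := z) (y := z + h) (by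
        intro w hw
        have : DifferentiableAt ℂ f w := hf.differentiableAt
          (hU.mem_nhds (hb (ball_subset_ball (by linarith) (hsub hw))))
        fun_prop) (by
        intro w hw
        have hdw : DifferentiableAt ℂ f w := hf.differentiableAt
          (hU.mem_nhds (hb (ball_subset_ball (by linarith) (hsub hw))))
        have : deriv (fun w => f w - deriv f z * w) w = deriv f w - deriv f z := by
          rw [deriv_fun_sub hdw (by fun_prop), deriv_const_mul _ (by fun_prop)]; simp
        rw [this, ← dist_eq_norm]
        apply le_of_lt
        apply hu w (ball_subset_closedBall (hsub hw)) z
        · exact (ball_subset_closedBall.trans (closedBall_subset_closedBall (by linarith))) hz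
        · exact (mem_ball.1 hw).trans_le (min_le_left _ _)) (mem_ball_self (by positivity))
        (by simpa using hhn)
    rw [dist_comm, dist_eq_norm]
    have e1 : (f (z + h) - f z) / h - deriv f z =
        ((f (z + h) - deriv f z * (z + h)) - (f z - deriv f z * z)) / h := by
      field_simp; ring
    rw [e1, norm_div, div_lt_iff₀ (norm_pos_iff.2 hh0')]
    have hpos := norm_pos_iff.2 hh0'
    simp only [add_sub_cancel_left] at key
    nlinarith
  have hinB : ∀ᶠ h : ℂ in 𝓝[≠] 0, ∀ z ∈ B, z + h ∈ U ∧ z ∈ U := by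
    have : ball (0:ℂ) (r/4) ∈ 𝓝[≠] (0:ℂ) :=
      mem_nhdsWithin_of_mem_nhds (ball_mem_nhds _ (by positivity))
    filter_upwards [this] with h hh z hz
    have hzb : dist z x < r/4 := hz
    have hhn : ‖h‖ < r/4 := by simpa using hh
    constructor
    · apply hb
      rw [mem_ball, dist_eq_norm] at *
      have := norm_add_le (z - x) h
      rw [show z + h - x = z - x + h by ring]
      linarith
    · apply hb; rw [mem_ball]; linarith
  rcases hurwitz isOpen_ball (convex_ball x (r/4)).isPreconnected (hinB.mono fun h hh => by
      have : DifferentiableOn ℂ (fun z => f (z + h)) B :=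
        hf.comp (by fun_prop) fun z hz => (hh z hz).1
      exact (this.sub (hf.mono fun z hz => (hh z hz).2)).div_const h) hlim (by
      filter_upwards [hinB, self_mem_nhdsWithin] with h hh hh0 z hz h1
      have hh0' : h ≠ 0 := hh0
      rw [div_eq_zero_iff, or_iff_left hh0', sub_eq_zero] at h1
      have := hi (hh z hz).1 (hh z hz).2 h1
      simp at this; exact hh0' this) with h | h
  · exact h x (mem_ball_self (by positivity))
  · exfalso
    have hxB : x ∈ B := mem_ball_self (by positivity)
    have hyB : x + (r/8 : ℝ) ∈ B := by
      rw [hB, mem_ball, dist_eq_norm, add_sub_cancel_left, Complex.norm_real, Real.norm_eq_abs,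
        abs_of_pos (by positivity)]; linarith
    have hBU : B ⊆ U := (ball_subset_ball (by linarith)).trans hb
    have key := (convex_ball x (r/4)).norm_image_sub_le_of_norm_deriv_le
      (f := f) (C := 0) (x := x) (y := x + (r/8 : ℝ)) (fun w hw =>
        hf.differentiableAt (hU.mem_nhds (hBU hw))) (fun w hw => by rw [h w hw, norm_zero]) hxB hyB
    rw [zero_mul, norm_le_zero_iff, sub_eq_zero] at key
    have := hi (hBU hyB) (hBU hxB) key
    simp at this
    linarith

theorem lipschitz_of_bound {f : ℂ → ℂ} {z : ℂ} {r C : ℝ} (hr : 0 < r) (hC : 0 < C)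
    (hf : DifferentiableOn ℂ f (ball z r)) (hb : ∀ w ∈ ball z r, ‖f w‖ ≤ C) {w : ℂ}
    (hw : w ∈ ball z r) : dist (f w) (f z) ≤ 3 * C / r * dist w z := by
  apply Complex.dist_le_div_mul_dist_of_mapsTo_ball hf _ hw
  intro x hx
  rw [mem_closedBall, dist_eq_norm]
  have := norm_sub_le (f x) (f z)
  have := hb x hx
  have := hb z (mem_ball_self hr)
  linarith

theorem montel {ι : Type*} (l : Ultrafilter ι) {F : ι → ℂ → ℂ} {U : Set ℂ} {C : ℝ}
    (hU : IsOpen U) (hF : ∀ᶠ i in (l : Filter ι), DifferentiableOn ℂ (F i) U)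
    (hC : ∀ᶠ i in (l : Filter ι), ∀ z ∈ U, ‖F i z‖ ≤ C) :
    ∃ f : ℂ → ℂ, TendstoLocallyUniformlyOn F f (l : Filter ι) U := by
  have hpt : ∀ z, ∃ y, z ∈ U → Tendsto (fun i => F i z) (l : Filter ι) (𝓝 y) := by
    intro z
    by_cases hz : z ∈ U
    · have hc : IsCompact (closedBall (0:ℂ) C) := isCompact_closedBall _ _
      obtain ⟨y, -, hy⟩ := hc.ultrafilter_le_nhds (l.map fun i => F i z) (by
        rw [le_principal_iff, Ultrafilter.mem_coe, Ultrafilter.mem_map]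
        filter_upwards [hC] with i hi
        simpa using hi z hz)
      exact ⟨y, fun _ => hy⟩
    · exact ⟨0, fun h => (hz h).elim⟩
  choose f hf using hpt
  refine ⟨f, ?_⟩
  rw [Metric.tendstoLocallyUniformlyOn_iff]
  intro ε hε z hz
  obtain ⟨r, hr, hb⟩ := Metric.isOpen_iff.1 hU z hz
  set C' := max C 1
  have hC' : 0 < C' := by positivity
  have hlip : ∀ᶠ i in (l : Filter ι), ∀ w ∈ ball z r, dist (F i w) (F i z) ≤ 3 * C' / r * dist w z := by
    filter_upwards [hF, hC] with i hi hi2 w hw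
    exact lipschitz_of_bound hr hC' (hi.mono hb) (fun x hx => (hi2 x (hb hx)).trans (le_max_left _ _)) hw
  have hlipf : ∀ w ∈ ball z r, dist (f w) (f z) ≤ 3 * C' / r * dist w z := by
    intro w hw
    exact le_of_tendsto ((hf w (hb hw)).dist (hf z hz)) (hlip.mono fun i hi => hi w hw)
  set δ := min r (ε / 3 / (3 * C' / r))
  have hδ : 0 < δ := by positivity
  refine ⟨ball z δ, mem_nhdsWithin_of_mem_nhds (ball_mem_nhds z hδ), ?_⟩
  filter_upwards [hlip, Metric.tendsto_nhds.1 (hf z hz) (ε/3) (by positivity)] with i h1 h2 w hw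
  have hwr : w ∈ ball z r := ball_subset_ball (min_le_left _ _) hw
  have hsm : 3 * C' / r * dist w z < ε / 3 := by
    have : dist w z < ε / 3 / (3 * C' / r) := (mem_ball.1 hw).trans_le (min_le_right _ _)
    rw [lt_div_iff₀ (by positivity)] at this
    linarith
  have a1 := h1 w hwr
  have a2 := hlipf w hwr
  have a3 := dist_triangle4 (f w) (f z) (F i z) (F i w)
  rw [dist_comm (F i z) (F i w), dist_comm (f z) (F i z)] at a3
  linarith

end HP

end

section
open Set Filter Topology Metric ComplexConjugate

namespace HP

theorem map_nhds_of_inj {f : ℂ → ℂ} {U : Set ℂ} (hU : IsOpen U)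
    (hf : DifferentiableOn ℂ f U) (hi : InjOn f U) {x : ℂ} (hx : x ∈ U) :
    map f (𝓝 x) = 𝓝 (f x) := by
  have ha : AnalyticAt ℂ f x := hf.analyticAt (hU.mem_nhds hx)
  exact ha.hasStrictDerivAt.map_nhds_eq (deriv_ne_zero_of_inj hU hf hi hx)

theorem isOpen_image_of_inj {f : ℂ → ℂ} {U V : Set ℂ} (hU : IsOpen U)
    (hf : DifferentiableOn ℂ f U) (hi : InjOn f U) (hV : IsOpen V) (hVU : V ⊆ U) :
    IsOpen (f '' V) := by
  rw [isOpen_iff_mem_nhds]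
  rintro _ ⟨x, hx, rfl⟩
  rw [← map_nhds_of_inj hU hf hi (hVU hx)]
  exact image_mem_map (hV.mem_nhds hx)

theorem inv_holo {f : ℂ → ℂ} {U : Set ℂ} (hU : IsOpen U)
    (hf : DifferentiableOn ℂ f U) (hi : InjOn f U) :
    ∃ g : ℂ → ℂ, (∀ y ∈ f '' U, HasDerivAt g (deriv f (g y))⁻¹ y) ∧ (∀ x ∈ U, g (f x) = x) := by
  have hg : ∀ x ∈ U, Function.invFunOn f U (f x) = x := fun x hx => hi.leftInvOn_invFunOn hx
  refine ⟨Function.invFunOn f U, ?_, hg⟩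
  rintro _ ⟨x, hx, rfl⟩
  rw [hg x hx]
  have hopen := isOpen_image_of_inj hU hf hi hU subset_rfl
  apply HasDerivAt.of_local_left_inverse (f := f)
  · rw [ContinuousAt, hg x hx, ← map_nhds_of_inj hU hf hi hx, tendsto_map'_iff]
    have : (Function.invFunOn f U ∘ f) =ᶠ[𝓝 x] id := by
      filter_upwards [hU.mem_nhds hx] with y hy using hg y hy
    rw [tendsto_congr' this]; exact tendsto_id
  · rw [hg x hx]; exact (hf.differentiableAt (hU.mem_nhds hx)).hasDerivAt
  · exact deriv_ne_zero_of_inj hU hf hi hx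
  · filter_upwards [hopen.mem_nhds (mem_image_of_mem f hx)] with y hy
    exact Function.invFunOn_eq hy

theorem holo_of_cont_log {f g : ℂ → ℂ} {U : Set ℂ} (hU : IsOpen U) (hg : DifferentiableOn ℂ g U)
    (hf : ContinuousOn f U) (he : ∀ z ∈ U, Complex.exp (f z) = g z) : DifferentiableOn ℂ f U := by
  intro x hx
  apply DifferentiableAt.differentiableWithinAt
  have hgx : DifferentiableAt ℂ g x := hg.differentiableAt (hU.mem_nhds hx)
  have hgx0 : g x ≠ 0 := by rw [← he x hx]; exact Complex.exp_ne_zero _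
  have hfx : ContinuousAt f x := hf.continuousAt (hU.mem_nhds hx)
  have : f =ᶠ[𝓝 x] fun z => f x + Complex.log (g z / g x) := by
    have h1 : Tendsto (fun z => (f z - f x).im) (𝓝 x) (𝓝 0) := by
      have : ContinuousAt (fun z => (f z - f x).im) x := by
        have := hfx.sub (continuousAt_const (y := f x))
        exact Complex.continuous_im.continuousAt.comp this
      simpa [ContinuousAt] using this
    filter_upwards [hU.mem_nhds hx, h1.eventually (Ioo_mem_nhds (neg_lt_zero.2 Real.pi_pos) Real.pi_pos)]
      with z hz hz2
    rw [← he z hz, ← he x hx, ← Complex.exp_sub, Complex.log_exp hz2.1 hz2.2.le]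
    ring
  rw [this.differentiableAt_iff]
  have hs : g x / g x ∈ Complex.slitPlane := by rw [div_self hgx0]; simp
  fun_prop (disch := assumption)

theorem holo_log {g : ℂ → ℂ} {U : Set ℂ} (hU : IsOpen U) (hs : IsSimplyConnected U)
    (hg : DifferentiableOn ℂ g U) (h0 : ∀ z ∈ U, g z ≠ 0) :
    ∃ f, DifferentiableOn ℂ f U ∧ ∀ z ∈ U, Complex.exp (f z) = g z := by
  obtain ⟨f, hf, he⟩ := Complex.exists_continuousOn_eqOn_exp_comp hs hU hg.continuousOn
    (by rintro ⟨z, hz1, hz⟩; exact h0 z hz1 hz)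
  exact ⟨f, holo_of_cont_log hU hg hf fun z hz => he hz, fun z hz => he hz⟩

/-- disc automorphism -/
noncomputable def mob (w z : ℂ) : ℂ := (z - w) / (1 - conj w * z)

theorem mob_norm_aux (w z : ℂ) : ‖1 - conj w * z‖ ^ 2 - ‖z - w‖ ^ 2 = (1 - ‖w‖ ^ 2) * (1 - ‖z‖ ^ 2) := by
  simp only [← Complex.normSq_eq_norm_sq, Complex.normSq_apply]
  simp
  ring

theorem mob_den {w z : ℂ} (hw : ‖w‖ < 1) (hz : ‖z‖ ≤ 1) : 1 - conj w * z ≠ 0 := by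
  intro h
  have h1 : conj w * z = 1 := (sub_eq_zero.1 h).symm
  have h2 : ‖conj w * z‖ = 1 := by rw [h1, norm_one]
  rw [norm_mul, Complex.norm_conj] at h2
  nlinarith [norm_nonneg w, norm_nonneg z]

theorem mob_lt {w z : ℂ} (hw : ‖w‖ < 1) (hz : ‖z‖ < 1) : ‖mob w z‖ < 1 := by
  rw [mob, norm_div, div_lt_one (norm_pos_iff.2 (mob_den hw hz.le))]
  have := mob_norm_aux w z
  have h1 : 0 < (1 - ‖w‖ ^ 2) * (1 - ‖z‖ ^ 2) := by
    apply mul_pos <;> nlinarith [norm_nonneg w, norm_nonneg z]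
  exact lt_of_pow_lt_pow_left₀ 2 (norm_nonneg _) (by linarith)

theorem mob_inj {w x y : ℂ} (hw : ‖w‖ < 1) (hx : ‖x‖ < 1) (hy : ‖y‖ < 1) (h : mob w x = mob w y) :
    x = y := by
  have hx' := mob_den hw hx.le
  have hy' := mob_den hw hy.le
  rw [mob, mob, div_eq_div_iff hx' hy'] at h
  have h2 : (x - y) * (1 - conj w * w) = 0 := by linear_combination h
  exact sub_eq_zero.1 ((mul_eq_zero.1 h2).resolve_right (mob_den hw hw.le))

theorem mob_self (w : ℂ) : mob w w = 0 := by simp [mob]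

theorem mob_hasDerivAt {w z : ℂ} (hw : ‖w‖ < 1) (hz : ‖z‖ ≤ 1) :
    HasDerivAt (mob w) ((1 - conj w * w) / (1 - conj w * z) ^ 2) z := by
  have h1 : HasDerivAt (fun z => z - w) 1 z := (hasDerivAt_id z).sub_const w
  have h2 : HasDerivAt (fun z => 1 - conj w * z) (- (conj w * 1)) z :=
    ((hasDerivAt_id z).const_mul (conj w)).const_sub 1
  have h3 := h1.div h2 (mob_den hw hz)
  have e : (1 * (1 - conj w * z) - (z - w) * -(conj w * 1)) = 1 - conj w * w := by ring
  rw [e] at h3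
  exact h3

structure Cand (G : Set ℂ) (z0 : ℂ) (f : ℂ → ℂ) : Prop where
  d : DifferentiableOn ℂ f G
  i : InjOn f G
  m : MapsTo f G (ball 0 1)
  z : f z0 = 0

theorem cand_improve {G : Set ℂ} (hG : IsOpen G) (hs : IsSimplyConnected G) {z0 : ℂ} (hz0 : z0 ∈ G)
    {f : ℂ → ℂ} (hf : Cand G z0 f) {w : ℂ} (hw : w ∈ ball (0:ℂ) 1) (hwf : w ∉ f '' G) :
    ∃ h, Cand G z0 h ∧ ‖deriv f z0‖ < ‖deriv h z0‖ := by
  have hw1 : ‖w‖ < 1 := by simpa using hw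
  have hf1 : ∀ z ∈ G, ‖f z‖ < 1 := fun z hz => by simpa using hf.m hz
  have hfd : HasDerivAt f (deriv f z0) z0 := (hf.d.differentiableAt (hG.mem_nhds hz0)).hasDerivAt
  have hfd0 := deriv_ne_zero_of_inj hG hf.d hf.i hz0
  have hk : DifferentiableOn ℂ (fun z => mob w (f z)) G := fun z hz =>
    ((mob_hasDerivAt hw1 (hf1 z hz).le).differentiableAt.comp_differentiableWithinAt z (hf.d z hz))
  obtain ⟨L, hL, hLe⟩ := holo_log hG hs hk (by
    intro z hz h
    apply hwf
    refine ⟨z, hz, mob_inj hw1 (hf1 z hz) hw1 ?_⟩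
    rw [mob_self, h])
  let g : ℂ → ℂ := fun z => Complex.exp (L z / 2)
  have hg2 : ∀ z ∈ G, g z * g z = mob w (f z) := by
    intro z hz
    rw [← hLe z hz, ← Complex.exp_add]; congr 1; ring
  have hgd : DifferentiableOn ℂ g G := (hL.div_const 2).cexp
  have hg1 : ∀ z ∈ G, ‖g z‖ < 1 := by
    intro z hz
    have h1 := mob_lt hw1 (hf1 z hz)
    rw [← hg2 z hz, norm_mul] at h1
    nlinarith [norm_nonneg (g z)]
  have hg0 : g z0 ≠ 0 := Complex.exp_ne_zero _
  refine ⟨fun z => mob (g z0) (g z), ⟨?_, ?_, ?_, mob_self _⟩, ?_⟩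
  · exact fun z hz => ((mob_hasDerivAt (hg1 z0 hz0) (hg1 z hz).le).differentiableAt.comp_differentiableWithinAt z (hgd z hz))
  · intro x hx y hy hxy
    have h1 := mob_inj (hg1 z0 hz0) (hg1 x hx) (hg1 y hy) hxy
    have h2 : mob w (f x) = mob w (f y) := by rw [← hg2 x hx, ← hg2 y hy, h1]
    exact hf.i hx hy (mob_inj hw1 (hf1 x hx) (hf1 y hy) h2)
  · intro z hz
    simpa using mob_lt (hg1 z0 hz0) (hg1 z hz)
  · have hgdz : HasDerivAt g (deriv g z0) z0 := (hgd.differentiableAt (hG.mem_nhds hz0)).hasDerivAt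
    have h1 : HasDerivAt (fun z => mob (g z0) (g z)) _ z0 :=
      (mob_hasDerivAt (hg1 z0 hz0) (hg1 z0 hz0).le).comp z0 hgdz
    rw [h1.deriv]
    have h2 : HasDerivAt (fun z => mob w (f z)) _ z0 :=
      HasDerivAt.comp z0 (mob_hasDerivAt (z := f z0) hw1 (hf1 z0 hz0).le) hfd
    have h3 : HasDerivAt (fun z => g z * g z) _ z0 := hgdz.mul hgdz
    have h4 : (fun z => g z * g z) =ᶠ[𝓝 z0] (fun z => mob w (f z)) := by
      filter_upwards [hG.mem_nhds hz0] with z hz using hg2 z hz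
    have h5 := (h3.congr_of_eventuallyEq h4.symm).unique h2
    rw [hf.z] at h5
    have hgw : g z0 * g z0 = - w := by rw [hg2 z0 hz0, hf.z]; simp [mob]
    have hn : ‖g z0‖ ^ 2 = ‖w‖ := by rw [pow_two, ← norm_mul, hgw, norm_neg]
    set t := ‖g z0‖ with ht
    have ht0 : 0 < t := norm_pos_iff.2 hg0
    have ht1 : t < 1 := hg1 z0 hz0
    have e1 : ∀ u : ℂ, 1 - conj u * u = ((1 - ‖u‖ ^ 2 : ℝ) : ℂ) := by
      intro u; rw [mul_comm, Complex.mul_conj, Complex.normSq_eq_norm_sq]; push_cast; ring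
    rw [e1] at h5 ⊢
    have h6 : 2 * t * ‖deriv g z0‖ = (1 - ‖w‖ ^ 2) * ‖deriv f z0‖ := by
      have : ‖deriv g z0 * g z0 + g z0 * deriv g z0‖ = 2 * t * ‖deriv g z0‖ := by
        rw [show deriv g z0 * g z0 + g z0 * deriv g z0 = 2 * g z0 * deriv g z0 by ring, norm_mul,
          norm_mul]; simp [ht]
      rw [← this, h5, norm_mul]
      have : 0 ≤ 1 - ‖w‖ ^ 2 := by nlinarith [norm_nonneg w]
      simp only [mul_zero, sub_zero, one_pow, div_one, Complex.norm_real, Real.norm_eq_abs,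
        abs_of_nonneg this]
    rw [← hn] at h6
    have h7 : 0 < 1 - t ^ 2 := by nlinarith
    rw [norm_mul, norm_div, norm_pow, Complex.norm_real, Real.norm_eq_abs, ← ht, abs_of_pos h7]
    have h8 : ‖deriv g z0‖ = (1 - (t ^ 2) ^ 2) * ‖deriv f z0‖ / (2 * t) := by
      field_simp; linarith
    rw [h8]
    have hfp : 0 < ‖deriv f z0‖ := norm_pos_iff.2 hfd0
    have : (1 - t ^ 2) / (1 - t ^ 2) ^ 2 * ((1 - (t ^ 2) ^ 2) * ‖deriv f z0‖ / (2 * t))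
      = ‖deriv f z0‖ * ((1 + t ^ 2) / (2 * t)) := by
      field_simp; ring
    rw [this]
    have h9 : 1 < (1 + t ^ 2) / (2 * t) := by
      rw [lt_div_iff₀ (by positivity)]
      nlinarith [mul_pos (sub_pos.2 ht1) (sub_pos.2 ht1)]
    nlinarith

structure IsRM (φ : ℂ → ℂ) (G : Set ℂ) : Prop where
  d : DifferentiableOn ℂ φ (ball 0 1)
  b : BijOn φ (ball 0 1) G

theorem exists_surj_cand {G : Set ℂ} (hG : IsOpen G) (hb : Bornology.IsBounded G)
    (hs : IsSimplyConnected G) {z0 : ℂ} (hz0 : z0 ∈ G) :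
    ∃ f, Cand G z0 f ∧ f '' G = ball 0 1 := by
  obtain ⟨R, hR0, hR⟩ := hb.subset_ball_lt 0 z0
  have hc0 : Cand G z0 (fun z => (z - z0) / R) := by
    have hRc : (R : ℂ) ≠ 0 := by exact_mod_cast hR0.ne'
    refine ⟨by fun_prop, ?_, ?_, by simp⟩
    · intro x _ y _ h
      have h' : (x - z0) / R = (y - z0) / R := h
      field_simp at h'
      simpa using h'
    · intro z hz
      have := hR hz
      rw [mem_ball, dist_eq_norm] at this
      simp [abs_of_pos hR0, div_lt_one hR0, this]
  let S : Set ℝ := {r | ∃ f, Cand G z0 f ∧ r = ‖deriv f z0‖}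
  have hSne : S.Nonempty := ⟨_, _, hc0, rfl⟩
  obtain ⟨ρ, hρ, hρG⟩ := Metric.isOpen_iff.1 hG z0 hz0
  have hSb : BddAbove S := by
    refine ⟨1 / ρ, ?_⟩
    rintro _ ⟨f, hf, rfl⟩
    apply Complex.norm_deriv_le_div_of_mapsTo_ball (hf.d.mono hρG) _ hρ
    rw [hf.z]
    exact fun z hz => ball_subset_closedBall (hf.m (hρG hz))
  obtain ⟨u, hu1, hu2, hu3⟩ := exists_seq_tendsto_sSup hSne hSb
  choose F hF hFu using hu3
  obtain ⟨f, hlim⟩ := montel (hyperfilter ℕ) (F := F) (U := G) (C := 1) hG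
    (Eventually.of_forall fun n => (hF n).d)
    (Eventually.of_forall fun n z hz => by
      have := (hF n).m hz
      simp at this; exact this.le)
  have hFd : ∀ᶠ n in (hyperfilter ℕ : Filter ℕ), DifferentiableOn ℂ (F n) G :=
    Eventually.of_forall fun n => (hF n).d
  have hfd := hlim.differentiableOn hFd hG
  have hderiv : Tendsto (fun n => ‖deriv (F n) z0‖) (hyperfilter ℕ : Filter ℕ) (𝓝 ‖deriv f z0‖) :=
    ((hlim.deriv hFd hG).tendsto_at hz0).norm
  have hsup : ‖deriv f z0‖ = sSup S := by
    refine tendsto_nhds_unique hderiv ?_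
    have := hu2.mono_left (Nat.hyperfilter_le_atTop)
    exact this.congr fun n => hFu n
  have hpos : 0 < sSup S := by
    refine lt_of_lt_of_le ?_ (le_csSup hSb ⟨_, hc0, rfl⟩)
    exact norm_pos_iff.2 (deriv_ne_zero_of_inj hG hc0.d hc0.i hz0)
  have hinj : InjOn f G := hurwitz_inj hG (hs.isPathConnected.isConnected.isPreconnected) hFd hlim
    (Eventually.of_forall fun n => (hF n).i) hz0 (norm_pos_iff.1 (hsup ▸ hpos))
  have hle : ∀ z ∈ G, ‖f z‖ ≤ 1 := fun z hz =>
    le_of_tendsto (hlim.tendsto_at hz).norm (Eventually.of_forall fun n => by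
      have := (hF n).m hz
      simp at this; exact this.le)
  have hmaps : MapsTo f G (ball 0 1) := by
    have h1 : f '' G ⊆ closedBall 0 1 := by
      rintro _ ⟨z, hz, rfl⟩; simpa using hle z hz
    have h2 := interior_maximal h1 (isOpen_image_of_inj hG hfd hinj hG subset_rfl)
    rw [interior_closedBall _ one_ne_zero] at h2
    exact fun z hz => h2 (mem_image_of_mem f hz)
  have hfz : f z0 = 0 := by
    refine tendsto_nhds_unique (hlim.tendsto_at hz0) ?_
    simp only [fun n => (hF n).z]; exact tendsto_const_nhds
  have hcand : Cand G z0 f := ⟨hfd, hinj, hmaps, hfz⟩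
  refine ⟨f, hcand, Subset.antisymm hmaps.image_subset fun w hw => ?_⟩
  by_contra hwf
  obtain ⟨h, hh, hlt⟩ := cand_improve hG hs hz0 hcand hw hwf
  have := le_csSup hSb ⟨h, hh, rfl⟩
  linarith

theorem riemann_mapping {G : Set ℂ} (hG : IsOpen G) (hb : Bornology.IsBounded G)
    (hs : IsSimplyConnected G) {z0 : ℂ} (hz0 : z0 ∈ G) :
    ∃ φ, IsRM φ G ∧ φ 0 = z0 ∧ ∃ r : ℝ, 0 < r ∧ deriv φ 0 = r := by
  obtain ⟨f, hf, hfG⟩ := exists_surj_cand hG hb hs hz0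
  obtain ⟨g, hg1, hg2⟩ := inv_holo hG hf.d hf.i
  rw [hfG] at hg1
  have hd0 := deriv_ne_zero_of_inj hG hf.d hf.i hz0
  set D := deriv f z0 with hD
  let κ : ℂ := D / ‖D‖
  have hnD : (‖D‖ : ℂ) ≠ 0 := by exact_mod_cast (norm_pos_iff.2 hd0).ne'
  have hκ : ‖κ‖ = 1 := by simp [κ, div_self (norm_pos_iff.2 hd0).ne']
  have hκ0 : κ ≠ 0 := norm_pos_iff.1 (by rw [hκ]; exact one_pos)
  have hmaps : ∀ z ∈ ball (0:ℂ) 1, κ * z ∈ ball (0:ℂ) 1 := by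
    intro z hz; simpa [hκ] using hz
  refine ⟨fun z => g (κ * z), ⟨?_, ?_, ?_, ?_⟩, ?_, ?_⟩
  · intro z hz
    have := (hg1 _ (hmaps z hz)).differentiableAt
    exact (this.comp z (by fun_prop : DifferentiableAt ℂ (fun z => κ * z) z)).differentiableWithinAt
  · intro z hz
    have := hmaps z hz
    rw [← hfG] at this
    obtain ⟨x, hx, hxe⟩ := this
    simp only
    rw [← hxe, hg2 x hx]; exact hx
  · intro x hx y hy h
    have h1 := hmaps x hx
    have h2 := hmaps y hy
    rw [← hfG] at h1 h2
    obtain ⟨x', hx', hxe⟩ := h1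
    obtain ⟨y', hy', hye⟩ := h2
    simp only at h
    rw [← hxe, ← hye, hg2 _ hx', hg2 _ hy'] at h
    rw [h, hye] at hxe
    exact (mul_left_cancel₀ hκ0 hxe).symm
  · intro z hz
    have h1 : f z ∈ ball (0:ℂ) 1 := hf.m hz
    refine ⟨κ⁻¹ * f z, ?_, ?_⟩
    · simpa [hκ] using h1
    · simp only
      rw [mul_inv_cancel_left₀ hκ0, hg2 z hz]
  · simp only [mul_zero]
    rw [← hf.z, hg2 z0 hz0]
  · refine ⟨‖D‖⁻¹, inv_pos.2 (norm_pos_iff.2 hd0), ?_⟩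
    have hg0 : g 0 = z0 := by rw [← hf.z, hg2 z0 hz0]
    have h1 : HasDerivAt g D⁻¹ (κ * 0) := by
      have := hg1 0 (by simp)
      rw [hg0] at this
      rwa [mul_zero]
    have h2 : HasDerivAt (fun z => κ * z) κ 0 := by
      simpa using (hasDerivAt_id (0:ℂ)).const_mul κ
    have h3 : HasDerivAt (fun z => g (κ * z)) _ 0 := h1.comp (0:ℂ) h2
    rw [h3.deriv]
    simp only [κ]
    push_cast
    field_simp

end HP

end

section
open Set Filter Topology Metric

namespace HP

theorem subset_of_disj_frontier {G T : Set ℂ} (hG : IsOpen G) (hT : IsPreconnected T)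
    (hd : Disjoint T (frontier G)) {g : ℂ} (hg : g ∈ G) (hgT : g ∈ T) : T ⊆ G := by
  have h1 : T ⊆ G ∪ (closure G)ᶜ := by
    intro x hx
    by_cases h : x ∈ G
    · exact Or.inl h
    · right
      intro hc
      exact disjoint_left.1 hd hx ⟨hc, fun hi => h (interior_subset hi)⟩
  exact hT.subset_left_of_subset_union hG isClosed_closure.isOpen_compl
    (disjoint_compl_right.mono_left subset_closure) h1 ⟨g, hgT, hg⟩

theorem conn_mem {G : Set ℂ} (hG : IsOpen G) {g v : ℂ} (hg : g ∈ G) (h : Conn (frontier G) g v) :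
    v ∈ G := by
  obtain ⟨T, hT, hd, h1, h2⟩ := h
  exact subset_of_disj_frontier hG hT hd hg h1 h2

theorem conn_through {R V W : Set ℂ} (hR : IsClosed R) {q v w : ℂ} (hq : q ∉ R)
    (hV : IsPreconnected V) (hVR : Disjoint V R) (hv : v ∈ V) (hqV : q ∈ closure V)
    (hW : IsPreconnected W) (hWR : Disjoint W R) (hw : w ∈ W) (hqW : q ∈ closure W) :
    Conn R v w := by
  obtain ⟨e, he, hb⟩ := Metric.isOpen_iff.1 hR.isOpen_compl q hq
  have hbR : Disjoint (ball q e) R := disjoint_left.2 fun x hx => hb hx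
  have hbc : IsPreconnected (ball q e) := (convex_ball q e).isPreconnected
  obtain ⟨x, hx, hx'⟩ := mem_closure_iff.1 hqV (ball q e) isOpen_ball (mem_ball_self he)
  obtain ⟨y, hy, hy'⟩ := mem_closure_iff.1 hqW (ball q e) isOpen_ball (mem_ball_self he)
  have c1 : Conn R v x := ⟨V, hV, hVR, hv, hx'⟩
  have c2 : Conn R x y := ⟨_, hbc, hbR, hx, hy⟩
  have c3 : Conn R y w := ⟨W, hW, hWR, hy', hw⟩
  exact (c1.trans c2).trans c3

theorem IsRM.inj {φ : ℂ → ℂ} {G : Set ℂ} (h : IsRM φ G) : InjOn φ (ball 0 1) := h.b.injOn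

theorem IsRM.mem {φ : ℂ → ℂ} {G : Set ℂ} (h : IsRM φ G) {z : ℂ} (hz : z ∈ ball (0:ℂ) 1) : φ z ∈ G :=
  h.b.mapsTo hz

theorem IsRM.isOpen {φ : ℂ → ℂ} {G : Set ℂ} (h : IsRM φ G) : IsOpen G := by
  rw [← h.b.image_eq]
  exact isOpen_image_of_inj isOpen_ball h.d h.inj isOpen_ball subset_rfl

theorem IsRM.preconn {φ : ℂ → ℂ} {G : Set ℂ} (h : IsRM φ G) : IsPreconnected G := by
  rw [← h.b.image_eq]
  exact (convex_ball _ _).isPreconnected.image _ h.d.continuousOn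

/-- compact subsets of `G` lie in the image of a smaller disc -/
theorem IsRM.exhaust {φ : ℂ → ℂ} {G : Set ℂ} (h : IsRM φ G) {Q : Set ℂ} (hQ : IsCompact Q)
    (hQG : Q ⊆ G) : ∃ ρ : ℝ, 0 < ρ ∧ ρ < 1 ∧ Q ⊆ φ '' ball 0 ρ := by
  haveI : Nonempty (Ioo (0:ℝ) 1) := ⟨⟨1/2, by norm_num, by norm_num⟩⟩
  obtain ⟨ρ, hρ⟩ := hQ.elim_directed_cover (fun ρ : Ioo (0:ℝ) 1 => φ '' ball 0 (ρ:ℝ))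
    (fun ρ => isOpen_image_of_inj isOpen_ball h.d h.inj isOpen_ball
      (ball_subset_ball ρ.2.2.le)) (by
    intro z hz
    obtain ⟨x, hx, rfl⟩ := h.b.surjOn (hQG hz)
    have hx1 : ‖x‖ < 1 := by simpa using hx
    refine mem_iUnion.2 ⟨⟨(‖x‖ + 1) / 2, ⟨by positivity, by linarith⟩⟩, x, ?_, rfl⟩
    simp only [mem_ball, dist_zero_right]; linarith) (by
    intro a b
    refine ⟨⟨max a b, ⟨lt_max_of_lt_left a.2.1, max_lt a.2.2 b.2.2⟩⟩, ?_, ?_⟩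
    · exact image_mono (ball_subset_ball (le_max_left _ _))
    · exact image_mono (ball_subset_ball (le_max_right _ _)))
  exact ⟨ρ, ρ.2.1, ρ.2.2, hρ⟩

/-- boundary winding of a Riemann map -/
theorem IsRM.circle_inc {φ : ℂ → ℂ} {G : Set ℂ} (h : IsRM φ G) {ρ : ℝ} (hρ : 0 < ρ) (hρ1 : ρ < 1)
    {v : ℂ} (hv : v ∉ G) :
    inc (fun θ : ℝ => (φ (ρ * Complex.exp (θ * Complex.I)) - v) /
      (φ (ρ * Complex.exp (θ * Complex.I)) - φ 0)) 0 (2 * Real.pi) = - (2 * Real.pi * Complex.I) := by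
  have hm0 : (0:ℂ) ∈ ball (0:ℂ) 1 := mem_ball_self one_pos
  obtain ⟨L, cL, eL⟩ := hasLog_ball (f := fun z => φ z - v) (c := 0) one_pos
    (h.d.continuousOn.sub continuousOn_const) (fun z hz h0 => hv (by
      rw [← sub_eq_zero.1 h0]; exact h.mem hz))
  have hds : DifferentiableOn ℂ (dslope φ 0) (ball 0 1) :=
    (Complex.differentiableOn_dslope (isOpen_ball.mem_nhds hm0)).2 h.d
  obtain ⟨M, cM, eM⟩ := hasLog_ball (f := dslope φ 0) (c := 0) one_pos hds.continuousOn (by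
    intro z hz h0
    by_cases hz0 : z = 0
    · rw [hz0, dslope_same] at h0
      exact deriv_ne_zero_of_inj isOpen_ball h.d h.inj hm0 h0
    · rw [dslope_of_ne _ hz0, slope_def_field, div_eq_zero_iff] at h0
      rcases h0 with h0 | h0
      · exact hz0 (h.inj hz hm0 (sub_eq_zero.1 h0))
      · exact hz0 (by simpa using h0))
  have hcirc : Continuous fun θ : ℝ => (ρ * Complex.exp (θ * Complex.I) : ℂ) := by fun_prop
  have hmem : ∀ θ : ℝ, (ρ * Complex.exp (θ * Complex.I) : ℂ) ∈ ball (0:ℂ) 1 := by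
    intro θ
    simp [Complex.norm_exp_ofReal_mul_I, abs_of_pos hρ, hρ1]
  have hρ' : (ρ:ℂ) ≠ 0 := by exact_mod_cast hρ.ne'
  rw [inc_eq (h := fun θ : ℝ => L (ρ * Complex.exp (θ * Complex.I)) -
    (Complex.log ρ + θ * Complex.I + M (ρ * Complex.exp (θ * Complex.I)))) (by positivity)]
  · have e1 : Complex.exp (((2 * Real.pi : ℝ) : ℂ) * Complex.I) = 1 := by
      push_cast; exact Complex.exp_two_pi_mul_I
    have e2 : Complex.exp (((0 : ℝ) : ℂ) * Complex.I) = 1 := by simp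
    simp only [e1, e2]
    push_cast; ring
  · refine ContinuousOn.sub (cL.comp hcirc.continuousOn fun θ _ => hmem θ) (ContinuousOn.add
      (by fun_prop) (cM.comp hcirc.continuousOn fun θ _ => hmem θ))
  · intro θ _
    rw [Complex.exp_sub, eL _ (hmem θ), Complex.exp_add, eM _ (hmem θ), Complex.exp_add,
      Complex.exp_log hρ']
    congr 1
    have hne : (ρ * Complex.exp (θ * Complex.I) : ℂ) ≠ 0 := mul_ne_zero hρ' (Complex.exp_ne_zero _)
    rw [dslope_of_ne _ hne, slope_def_field, sub_zero]
    field_simp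

theorem root_lemma {φ : ℂ → ℂ} {G R : Set ℂ} (h : IsRM φ G) (hGb : Bornology.IsBounded G)
    (hR : IsClosed R) {A : ℝ → ℂ} {s t : ℝ} (hst : s ≤ t) (hA : Continuous A)
    (hAi : InjOn A (Icc s t)) (hfr : frontier G = R ∪ A '' Icc s t) {v : ℂ} (hvG : v ∉ G)
    (hvK : v ∉ frontier G) (hsR : A s ∈ R) (htR : A t ∈ R)
    (hRA : ∀ x ∈ Icc s t, A x ∈ R → x = s ∨ x = t)
    {H : ℂ → ℂ} (cH : ContinuousOn H R)
    (eH : ∀ z ∈ R, Complex.exp (H z) = (z - v) / (z - φ 0)) :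
    ∃ l : ℤ, (l = 1 ∨ l = -1) ∧ inc (fun x => (A x - v) / (A x - φ 0)) s t =
      H (A t) - H (A s) + l * (2 * Real.pi * Complex.I) := by
  have hgG : φ 0 ∈ G := h.mem (mem_ball_self one_pos)
  have hgK : φ 0 ∉ frontier G := by
    rw [h.isOpen.frontier_eq]; exact fun hh => hh.2 hgG
  have hAcl : IsClosed (A '' Icc s t) := (isCompact_Icc.image hA).isClosed
  have hAK : ∀ x ∈ Icc s t, A x ∈ frontier G := fun x hx => by
    rw [hfr]; exact Or.inr (mem_image_of_mem _ hx)
  have hKc : IsCompact (frontier G) :=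
    Metric.isCompact_of_isClosed_isBounded isClosed_frontier (hGb.closure.subset frontier_subset_closure)
  have hKv : ∀ z ∈ frontier G, z - v ≠ 0 := fun z hz h0 => hvK (sub_eq_zero.1 h0 ▸ hz)
  have hKg : ∀ z ∈ frontier G, z - φ 0 ≠ 0 := fun z hz h0 => hgK (sub_eq_zero.1 h0 ▸ hz)
  obtain ⟨B, cB, eB⟩ := hasLog_arcR (f := fun z => (z - v) / (z - φ 0)) hst hA.continuousOn hAi
    (ContinuousOn.div (by fun_prop) (by fun_prop) (by
      rintro _ ⟨x, hx, rfl⟩; exact hKg _ (hAK x hx)))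
    (by rintro _ ⟨x, hx, rfl⟩; exact div_ne_zero (hKv _ (hAK x hx)) (hKg _ (hAK x hx)))
  have hsm : s ∈ Icc s t := left_mem_Icc.2 hst
  have htm : t ∈ Icc s t := right_mem_Icc.2 hst
  have hinc : inc (fun x => (A x - v) / (A x - φ 0)) s t = B (A t) - B (A s) :=
    inc_of_log (F := fun z => (z - v) / (z - φ 0)) hst hA.continuousOn (mapsTo_image A _) cB eB
  have hex : Complex.exp (B (A t) - B (A s)) = Complex.exp (H (A t) - H (A s)) := by
    rw [Complex.exp_sub, Complex.exp_sub, eB _ (mem_image_of_mem _ htm),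
      eB _ (mem_image_of_mem _ hsm), eH _ htR, eH _ hsR]
  obtain ⟨l, hl⟩ := Complex.exp_eq_exp_iff_exists_int.1 hex
  refine ⟨l, ?_, by rw [hinc, hl]⟩
  by_cases hl0 : l = 0
  · exfalso
    have : HasLog (fun z => (z - v) / (z - φ 0)) (R ∪ A '' Icc s t) := by
      refine hasLog_union_of_eq hR hAcl cH cB eH eB (H (A s) - B (A s)) ?_
      rintro _ ⟨hzR, x, hx, rfl⟩
      rcases hRA x hx hzR with rfl | rfl
      · rfl
      · rw [hl0] at hl; push_cast at hl; linear_combination -hl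
    rw [← hfr] at this
    exact hvG (conn_mem h.isOpen hgG (conn_of_hasLog hKc hvK hgK this).symm)
  have hlc : (l : ℂ) ≠ 0 := by exact_mod_cast hl0
  -- the root
  classical
  let r : ℂ → ℂ := fun z => if z ∈ R then Complex.exp (H z / l)
    else Complex.exp ((B z + (H (A s) - B (A s))) / l)
  have r1 : ∀ z ∈ R, r z = Complex.exp (H z / l) := fun z hz => if_pos hz
  have r2 : ∀ z ∈ A '' Icc s t, r z = Complex.exp ((B z + (H (A s) - B (A s))) / l) := by
    rintro _ ⟨x, hx, rfl⟩
    by_cases hz : A x ∈ R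
    · rw [r1 _ hz]
      rcases hRA x hx hz with rfl | rfl
      · congr 2; ring
      · rw [Complex.exp_eq_exp_iff_exists_int]
        refine ⟨-1, ?_⟩
        field_simp
        push_cast
        linear_combination -hl
    · exact if_neg hz
  have cr : ContinuousOn r (frontier G) := by
    rw [hfr]
    refine ContinuousOn.union_of_isClosed ?_ ?_ hR hAcl
    · refine ContinuousOn.congr (f := fun z => Complex.exp (H z / l)) ?_ r1
      exact Complex.continuous_exp.comp_continuousOn (cH.div_const _)
    · refine ContinuousOn.congr (f := fun z => Complex.exp ((B z + (H (A s) - B (A s))) / l)) ?_ r2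
      exact Complex.continuous_exp.comp_continuousOn ((cB.add continuousOn_const).div_const _)
  have r0 : ∀ z, r z ≠ 0 := by
    intro z; simp only [r]; split_ifs <;> exact Complex.exp_ne_zero _
  have rl : ∀ z ∈ frontier G, r z ^ l = (z - v) / (z - φ 0) := by
    intro z hz
    rw [hfr] at hz
    rcases hz with hz | hz
    · rw [r1 z hz, ← Complex.exp_int_mul, mul_div_cancel₀ _ hlc, eH z hz]
    · rw [r2 z hz, ← Complex.exp_int_mul, mul_div_cancel₀ _ hlc, Complex.exp_add, eB z hz,
        Complex.exp_sub, eH _ hsR, eB _ (mem_image_of_mem _ hsm), div_self, mul_one]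
      exact div_ne_zero (hKv _ (hAK s hsm)) (hKg _ (hAK s hsm))
  obtain ⟨ρf, cρ, eρ⟩ := tietze isClosed_frontier cr
  let N : Set ℂ := {z | ρf z ≠ 0 ∧ z - φ 0 ≠ 0} ∩
    {z | ‖(z - v) / (z - φ 0) / ρf z ^ l - 1‖ < 1}
  have hN1 : IsOpen {z | ρf z ≠ 0 ∧ z - φ 0 ≠ 0} :=
    (isOpen_ne_fun cρ continuous_const).inter (isOpen_ne_fun (by fun_prop) continuous_const)
  have hcq : ContinuousOn (fun z => (z - v) / (z - φ 0) / ρf z ^ l) {z | ρf z ≠ 0 ∧ z - φ 0 ≠ 0} := by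
    refine ContinuousOn.div (ContinuousOn.div (by fun_prop) (by fun_prop) fun z hz => hz.2) ?_
      fun z hz => zpow_ne_zero _ hz.1
    exact ContinuousOn.zpow₀ cρ.continuousOn l fun z hz => Or.inl hz.1
  have hN : IsOpen N := by
    have : ContinuousOn (fun z => ‖(z - v) / (z - φ 0) / ρf z ^ l - 1‖)
      {z | ρf z ≠ 0 ∧ z - φ 0 ≠ 0} := (hcq.sub continuousOn_const).norm
    exact this.isOpen_inter_preimage hN1 isOpen_Iio
  have hKN : frontier G ⊆ N := by
    intro z hz
    refine ⟨⟨by rw [eρ z hz]; exact r0 z, hKg z hz⟩, ?_⟩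
    change ‖_‖ < _
    rw [eρ z hz, rl z hz, div_self (div_ne_zero (hKv z hz) (hKg z hz))]
    simp
  obtain ⟨ρ, hρ0, hρ1, hρ⟩ := h.exhaust (Q := closure G \ N)
    ((Metric.isCompact_of_isClosed_isBounded isClosed_closure hGb.closure).diff hN) (by
      intro z hz
      by_contra hzG
      exact hz.2 (hKN (by rw [h.isOpen.frontier_eq]; exact ⟨hz.1, hzG⟩)))
  let c : ℝ → ℂ := fun θ => ρ * Complex.exp (θ * Complex.I)
  have cc : Continuous c := by fun_prop
  have hcn : ∀ θ, ‖c θ‖ = ρ := by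
    intro θ
    simp [c, Complex.norm_exp_ofReal_mul_I, abs_of_pos hρ0]
  have hcm : ∀ θ, c θ ∈ ball (0:ℂ) 1 := fun θ => by simp [hcn θ, hρ1]
  have cφ : Continuous fun θ => φ (c θ) :=
    h.d.continuousOn.comp_continuous cc hcm
  have hcN : ∀ θ, φ (c θ) ∈ N := by
    intro θ
    by_contra hh
    obtain ⟨x, hx, hxe⟩ := hρ ⟨subset_closure (h.mem (hcm θ)), hh⟩
    have := h.inj (ball_subset_ball hρ1.le hx) (hcm θ) hxe
    rw [this] at hx
    simp [hcn θ] at hx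
  have hloop : c (2 * Real.pi) = c 0 := by
    simp only [c]
    congr 1
    push_cast
    rw [Complex.exp_two_pi_mul_I]; simp
  obtain ⟨P, cP, eP⟩ := hasLog_Icc (f := fun θ => ρf (φ (c θ))) (s := 0) (t := 2 * Real.pi)
    (by positivity) (cρ.comp cφ).continuousOn (fun θ _ => (hcN θ).1.1)
  have h2pi : (0:ℝ) ≤ 2 * Real.pi := by positivity
  have hPe : Complex.exp (P (2 * Real.pi)) = Complex.exp (P 0) := by
    rw [eP _ (right_mem_Icc.2 h2pi), eP _ (left_mem_Icc.2 h2pi)]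
    simp only [hloop]
  obtain ⟨k, hk⟩ := Complex.exp_eq_exp_iff_exists_int.1 hPe
  have key := h.circle_inc hρ0 hρ1 hvG
  rw [inc_eq (h := fun θ => l * P θ + Complex.log ((φ (c θ) - v) / (φ (c θ) - φ 0) /
    ρf (φ (c θ)) ^ l)) h2pi] at key
  · simp only [hloop, hk] at key
    have e : (2 * Real.pi * Complex.I) * ((l:ℂ) * k + 1) = 0 := by
      linear_combination key
    rcases mul_eq_zero.1 e with e | e
    · exact absurd e Complex.two_pi_I_ne_zero
    · have e' : l * k = -1 := by
        have : (l:ℂ) * k = -1 := by linear_combination e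
        exact_mod_cast this
      exact Int.isUnit_iff.1 (IsUnit.of_mul_eq_one (-k) (by linarith))
  · refine ContinuousOn.add (continuousOn_const.mul cP) ?_
    refine ContinuousOn.clog ?_ ?_
    · exact hcq.comp cφ.continuousOn fun θ _ => (hcN θ).1
    · intro θ _
      have := Complex.mem_slitPlane_of_norm_lt_one (hcN θ).2
      simpa using this
  · intro θ hθ
    have hne : (φ (c θ) - v) / (φ (c θ) - φ 0) / ρf (φ (c θ)) ^ l ≠ 0 := by
      intro h0
      have := (hcN θ).2
      rw [mem_ofPred_eq, h0] at this
      simp at this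
    rw [Complex.exp_add, Complex.exp_log hne, Complex.exp_int_mul, eP θ hθ]
    rw [mul_div_cancel₀ _ (zpow_ne_zero _ (hcN θ).1.1)]

end HP

end

section
open Set Filter Topology Metric

namespace HP

structure Cyc (A B C : ℝ → ℂ) : Prop where
  cA : Continuous A
  cB : Continuous B
  cC : Continuous C
  iA : InjOn A (Icc 0 1)
  iB : InjOn B (Icc 0 1)
  iC : InjOn C (Icc 0 1)
  AB : A 1 = B 0
  BC : B 1 = C 0
  CA : C 1 = A 0

theorem Cyc.rot {A B C : ℝ → ℂ} (h : Cyc A B C) : Cyc B C A :=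
  ⟨h.cB, h.cC, h.cA, h.iB, h.iC, h.iA, h.BC, h.CA, h.AB⟩

def KK (A B C : ℝ → ℂ) : Set ℂ := A '' Icc 0 1 ∪ B '' Icc 0 1 ∪ C '' Icc 0 1

theorem KK_rot (A B C : ℝ → ℂ) : KK B C A = KK A B C := by
  simp only [KK]; rw [union_comm, union_assoc]

noncomputable def Wd (A B C : ℝ → ℂ) (z : ℂ) : ℂ :=
  inc (fun x => A x - z) 0 1 + inc (fun x => B x - z) 0 1 + inc (fun x => C x - z) 0 1

theorem Wd_rot (A B C : ℝ → ℂ) (z : ℂ) : Wd B C A z = Wd A B C z := by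
  simp only [Wd]; ring

theorem isCompact_arc {A : ℝ → ℂ} (hA : Continuous A) (s t : ℝ) : IsCompact (A '' Icc s t) :=
  isCompact_Icc.image hA

theorem Cyc.compact {A B C : ℝ → ℂ} (h : Cyc A B C) : IsCompact (KK A B C) :=
  ((isCompact_arc h.cA 0 1).union (isCompact_arc h.cB 0 1)).union (isCompact_arc h.cC 0 1)

theorem hasLog_sub {A : ℝ → ℂ} (hA : Continuous A) {v : ℂ} {s t : ℝ} (hst : s ≤ t)
    (hv : v ∉ A '' Icc s t) : HasLog (fun x => A x - v) (Icc s t) :=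
  hasLog_Icc hst (by fun_prop) fun x hx h0 => hv ⟨x, hx, sub_eq_zero.1 h0⟩

theorem mem_KK1 {A B C : ℝ → ℂ} {x : ℝ} (hx : x ∈ Icc (0:ℝ) 1) : A x ∈ KK A B C :=
  Or.inl (Or.inl ⟨x, hx, rfl⟩)
theorem mem_KK2 {A B C : ℝ → ℂ} {x : ℝ} (hx : x ∈ Icc (0:ℝ) 1) : B x ∈ KK A B C :=
  Or.inl (Or.inr ⟨x, hx, rfl⟩)
theorem mem_KK3 {A B C : ℝ → ℂ} {x : ℝ} (hx : x ∈ Icc (0:ℝ) 1) : C x ∈ KK A B C :=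
  Or.inr ⟨x, hx, rfl⟩

theorem sub_KK1 {A B C : ℝ → ℂ} : A '' Icc (0:ℝ) 1 ⊆ KK A B C := fun _ h => Or.inl (Or.inl h)
theorem sub_KK2 {A B C : ℝ → ℂ} : B '' Icc (0:ℝ) 1 ⊆ KK A B C := fun _ h => Or.inl (Or.inr h)
theorem sub_KK3 {A B C : ℝ → ℂ} : C '' Icc (0:ℝ) 1 ⊆ KK A B C := fun _ h => Or.inr h

theorem inc_self {f : ℝ → ℂ} {s : ℝ} : inc f s s = 0 := by
  by_cases h : HasLog f (Icc s s)
  · obtain ⟨h, c, e⟩ := h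
    rw [inc_eq le_rfl c e, sub_self]
  · rw [inc, dif_neg h]

theorem telescope {A B C : ℝ → ℂ} (h : Cyc A B C) {v g : ℂ} (hv : v ∉ KK A B C) (hg : g ∉ KK A B C)
    {s t : ℝ} (hs : 0 ≤ s) (hst : s ≤ t) (ht : t ≤ 1) {R : Set ℂ} {H : ℂ → ℂ}
    (cH : ContinuousOn H R) (eH : ∀ z ∈ R, Complex.exp (H z) = (z - v) / (z - g))
    (h1 : A '' Icc 0 s ⊆ R) (h2 : A '' Icc t 1 ⊆ R) (h3 : B '' Icc 0 1 ⊆ R) (h4 : C '' Icc 0 1 ⊆ R) :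
    Wd A B C v - Wd A B C g =
      inc (fun x => (A x - v) / (A x - g)) s t - (H (A t) - H (A s)) := by
  have lA := hasLog_sub h.cA zero_le_one fun hh => hv (sub_KK1 hh)
  have lA' := hasLog_sub h.cA zero_le_one fun hh => hg (sub_KK1 hh)
  have lB := hasLog_sub h.cB zero_le_one fun hh => hv (sub_KK2 hh)
  have lB' := hasLog_sub h.cB zero_le_one fun hh => hg (sub_KK2 hh)
  have lC := hasLog_sub h.cC zero_le_one fun hh => hv (sub_KK3 hh)
  have lC' := hasLog_sub h.cC zero_le_one fun hh => hg (sub_KK3 hh)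
  have eA := inc_div zero_le_one lA lA'
  have eB := inc_div zero_le_one lB lB'
  have eC := inc_div zero_le_one lC lC'
  have lAA := lA.div lA'
  have e1 := inc_add hs (hst.trans ht) lAA
  have e2 := inc_add hst ht (lAA.mono (Icc_subset_Icc_left hs))
  have i1 : inc (fun x => (A x - v) / (A x - g)) 0 s = _ :=
    inc_of_log (F := fun z => (z - v) / (z - g)) hs h.cA.continuousOn
    (fun x hx => h1 ⟨x, hx, rfl⟩) cH eH
  have i2 : inc (fun x => (A x - v) / (A x - g)) t 1 = _ :=
    inc_of_log (F := fun z => (z - v) / (z - g)) ht h.cA.continuousOn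
    (fun x hx => h2 ⟨x, hx, rfl⟩) cH eH
  have i3 : inc (fun x => (B x - v) / (B x - g)) 0 1 = _ :=
    inc_of_log (F := fun z => (z - v) / (z - g)) zero_le_one h.cB.continuousOn
    (fun x hx => h3 ⟨x, hx, rfl⟩) cH eH
  have i4 : inc (fun x => (C x - v) / (C x - g)) 0 1 = _ :=
    inc_of_log (F := fun z => (z - v) / (z - g)) zero_le_one h.cC.continuousOn
    (fun x hx => h4 ⟨x, hx, rfl⟩) cH eH
  rw [h.CA, ← h.BC] at i4
  rw [← h.AB] at i3
  simp only [Wd]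
  linear_combination -eA - eB - eC - e1 - e2 + i1 + i2 + i3 + i4

theorem Wd_eq_of_hasLog {A B C : ℝ → ℂ} (h : Cyc A B C) {v g : ℂ} (hv : v ∉ KK A B C)
    (hg : g ∉ KK A B C) (hl : HasLog (fun z => (z - v) / (z - g)) (KK A B C)) :
    Wd A B C v = Wd A B C g := by
  obtain ⟨H, cH, eH⟩ := hl
  have := telescope h hv hg zero_le_one le_rfl le_rfl cH eH sub_KK1
    ((image_mono (Icc_subset_Icc_left zero_le_one)).trans sub_KK1) sub_KK2 sub_KK3
  rw [inc_self] at this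
  linear_combination this

theorem Wd_eq_of_conn {A B C : ℝ → ℂ} (h : Cyc A B C) {v g : ℂ} (hc : Conn (KK A B C) v g) :
    Wd A B C v = Wd A B C g :=
  Wd_eq_of_hasLog h hc.left hc.right (hasLog_of_conn h.compact.isClosed hc)

theorem Wd_far {A B C : ℝ → ℂ} (h : Cyc A B C) {u : ℂ} {R : ℝ} (hR : 0 < R)
    (hK : KK A B C ⊆ ball 0 R) (hu : R ≤ ‖u‖) : Wd A B C u = 0 := by
  obtain ⟨H, cH, eH⟩ := hasLog_ball (f := fun z => z - u) (c := 0) hR (by fun_prop) (by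
    intro z hz h0
    rw [sub_eq_zero.1 h0] at hz
    simp at hz
    linarith)
  have i1 : inc (fun x => A x - u) 0 1 = _ :=
    inc_of_log (F := fun z => z - u) zero_le_one h.cA.continuousOn
    (fun x hx => hK (mem_KK1 hx)) cH eH
  have i2 : inc (fun x => B x - u) 0 1 = _ :=
    inc_of_log (F := fun z => z - u) zero_le_one h.cB.continuousOn
    (fun x hx => hK (mem_KK2 hx)) cH eH
  have i3 : inc (fun x => C x - u) 0 1 = _ :=
    inc_of_log (F := fun z => z - u) zero_le_one h.cC.continuousOn
    (fun x hx => hK (mem_KK3 hx)) cH eH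
  rw [Wd, i1, i2, i3, h.AB, h.BC, h.CA]
  ring

/-- The closed set with an open subarc removed. -/
def RR (A B C : ℝ → ℂ) (s t : ℝ) : Set ℂ :=
  A '' Icc 0 s ∪ A '' Icc t 1 ∪ (B '' Icc 0 1 ∪ C '' Icc 0 1)

theorem RR_closed {A B C : ℝ → ℂ} (h : Cyc A B C) (s t : ℝ) : IsClosed (RR A B C s t) :=
  (((isCompact_arc h.cA _ _).union (isCompact_arc h.cA _ _)).union
    ((isCompact_arc h.cB _ _).union (isCompact_arc h.cC _ _))).isClosed

theorem RR_union (A B C : ℝ → ℂ) {s t : ℝ} (hs : 0 ≤ s) (hst : s ≤ t) (ht : t ≤ 1) :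
    KK A B C = RR A B C s t ∪ A '' Icc s t := by
  have : Icc (0:ℝ) 1 = Icc 0 s ∪ Icc t 1 ∪ Icc s t := by
    ext x; simp only [mem_union, mem_Icc]
    constructor
    · rintro ⟨h1, h2⟩
      rcases le_total x s with h | h
      · exact Or.inl (Or.inl ⟨h1, h⟩)
      · rcases le_total x t with h' | h'
        · exact Or.inr ⟨h, h'⟩
        · exact Or.inl (Or.inr ⟨h', h2⟩)
    · rintro ((h | h) | h) <;> constructor <;> linarith [h.1, h.2]
  have h2 : A '' Icc 0 1 = A '' Icc 0 s ∪ A '' Icc t 1 ∪ A '' Icc s t := by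
    rw [this, image_union, image_union]
  ext z
  simp only [KK, RR, h2, mem_union]
  tauto

theorem RR_sub (A B C : ℝ → ℂ) {s t : ℝ} (hs : 0 ≤ s) (hst : s ≤ t) (ht : t ≤ 1) :
    RR A B C s t ⊆ KK A B C := by
  rw [RR_union A B C hs hst ht]; exact subset_union_left

theorem RR_notMem {A B C : ℝ → ℂ} (h : Cyc A B C) {s t x : ℝ} (hs : 0 ≤ s) (ht : t ≤ 1)
    (hx : x ∈ Icc s t)
    (hBC : A x ∉ B '' Icc 0 1 ∪ C '' Icc 0 1) (hR : A x ∈ RR A B C s t) : x = s ∨ x = t := by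
  rcases hR with (⟨y, hy, e⟩ | ⟨y, hy, e⟩) | hR
  · left
    have hx' := hx.1; have hx2 := hx.2
    have := h.iA ⟨hy.1, by linarith [hy.2]⟩ ⟨by linarith, by linarith⟩ e
    linarith [hy.2]
  · right
    have hx' := hx.1; have hx2 := hx.2
    have := h.iA ⟨by linarith [hy.1], hy.2⟩ ⟨by linarith, by linarith⟩ e
    linarith [hy.1]
  · exact absurd hR hBC

theorem exists_window {A B C : ℝ → ℂ} (h : Cyc A B C) {τ : ℝ} (hτ : τ ∈ Ioo (0:ℝ) 1)
    (hBC : A τ ∉ B '' Icc 0 1 ∪ C '' Icc 0 1) (l u : ℝ) (hl : l < τ) (hu : τ < u) :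
    ∃ s t, 0 < s ∧ l < s ∧ s < τ ∧ τ < t ∧ t < u ∧ t < 1 ∧
      ∀ x ∈ Icc s t, A x ∉ B '' Icc 0 1 ∪ C '' Icc 0 1 := by
  have hcl : IsClosed (B '' Icc 0 1 ∪ C '' Icc 0 1) :=
    ((isCompact_arc h.cB 0 1).union (isCompact_arc h.cC 0 1)).isClosed
  have ho : ∀ᶠ x in 𝓝 τ, A x ∉ B '' Icc 0 1 ∪ C '' Icc 0 1 :=
    h.cA.continuousAt.eventually (hcl.isOpen_compl.mem_nhds hBC)
  obtain ⟨e, he, hb⟩ := Metric.eventually_nhds_iff_ball.1 ho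
  obtain ⟨s, hs1, hs2⟩ := exists_between (max_lt (max_lt hτ.1 hl) (sub_lt_self τ he))
  obtain ⟨t, ht1, ht2⟩ := exists_between (lt_min (lt_min hτ.2 hu) (lt_add_of_pos_right τ he))
  simp only [max_lt_iff, lt_min_iff] at hs1 ht2
  refine ⟨s, t, hs1.1.1, hs1.1.2, hs2, ht1, ht2.1.2, ht2.1.1, fun x hx => hb x ?_⟩
  rw [mem_ball, Real.dist_eq, abs_lt]
  constructor <;> linarith [hx.1, hx.2]

theorem parity1 {A B C : ℝ → ℂ} (h : Cyc A B C) {φ : ℂ → ℂ} {G : Set ℂ} (hφ : IsRM φ G)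
    (hGb : Bornology.IsBounded G) (hfr : frontier G = KK A B C) {v : ℂ} (hvG : v ∉ G) {V : Set ℂ}
    (hV : IsPreconnected V) (hVK : Disjoint V (KK A B C)) (hv : v ∈ V)
    {τ : ℝ} (hτ : τ ∈ Ioo (0:ℝ) 1) (hτV : A τ ∈ closure V)
    (hBC : A τ ∉ B '' Icc 0 1 ∪ C '' Icc 0 1) :
    ∃ l : ℤ, (l = 1 ∨ l = -1) ∧ Wd A B C v - Wd A B C (φ 0) = l * (2 * Real.pi * Complex.I) := by
  obtain ⟨s, t, hs, -, hsτ, hτt, -, ht, hw⟩ := exists_window h hτ hBC 0 1 hτ.1 hτ.2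
  have hst : s ≤ t := by linarith
  have hu := RR_union A B C hs.le hst ht.le
  have hRK := RR_sub A B C hs.le hst ht.le
  have hτR : A τ ∉ RR A B C s t := fun hh => by
    rcases RR_notMem h hs.le ht.le ⟨hsτ.le, hτt.le⟩ (hw τ ⟨hsτ.le, hτt.le⟩) hh with e | e <;> linarith
  have hGK : Disjoint G (KK A B C) := by
    rw [← hfr, hφ.isOpen.frontier_eq]; exact disjoint_sdiff_right
  have hg : φ 0 ∈ G := hφ.mem (mem_ball_self one_pos)
  have hτG : A τ ∈ closure G := frontier_subset_closure (by
    rw [hfr]; exact mem_KK1 ⟨hτ.1.le, hτ.2.le⟩)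
  have hconn : Conn (RR A B C s t) v (φ 0) :=
    conn_through (RR_closed h s t) hτR hV (hVK.mono_right hRK) hv hτV hφ.preconn
      (hGK.mono_right hRK) hg hτG
  obtain ⟨H, cH, eH⟩ := hasLog_of_conn (RR_closed h s t) hconn
  have hvK : v ∉ KK A B C := disjoint_left.1 hVK hv
  have hgK : φ 0 ∉ KK A B C := disjoint_left.1 hGK hg
  have tel := telescope h hvK hgK hs.le hst ht.le cH eH
    (fun _ h => Or.inl (Or.inl h)) (fun _ h => Or.inl (Or.inr h)) (fun _ h => Or.inr (Or.inl h))
    (fun _ h => Or.inr (Or.inr h))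
  obtain ⟨l, hl, e⟩ := root_lemma hφ hGb (RR_closed h s t) hst h.cA
    (h.iA.mono (Icc_subset_Icc hs.le ht.le)) (hfr.trans hu) hvG (hfr ▸ hvK)
    (Or.inl (Or.inl ⟨s, ⟨hs.le, le_rfl⟩, rfl⟩)) (Or.inl (Or.inr ⟨t, ⟨le_rfl, ht.le⟩, rfl⟩))
    (fun x hx hR => RR_notMem h hs.le ht.le hx (hw x hx) hR) cH eH
  refine ⟨l, hl, ?_⟩
  rw [tel, e]; ring

structure Adm (G : Set ℂ) (J1 J2 J3 : ℝ → ℂ) : Prop where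
  op : IsOpen G
  bd : Bornology.IsBounded G
  sc : IsSimplyConnected G
  cyc : Cyc J1 J2 J3
  fr : frontier G = KK J1 J2 J3
  nt1 : ∀ s ∈ Icc (0:ℝ) 1, ∀ t ∈ Icc (0:ℝ) 1, J3 s = J1 t → t = 0 ∨ t = 1
  nt2 : ∀ s ∈ Icc (0:ℝ) 1, ∀ t ∈ Icc (0:ℝ) 1, J3 s = J2 t → t = 0 ∨ t = 1
  inf : ∀ s ∈ Icc (0:ℝ) 1, ∃ γ : ℝ → ℂ, Continuous γ ∧ γ 0 = J3 s ∧
    Tendsto (fun t => ‖γ t‖) atTop atTop ∧ ∀ t : ℝ, 0 < t → γ t ∉ frontier G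

theorem zero_mem_I : (0:ℝ) ∈ Icc (0:ℝ) 1 := ⟨le_rfl, zero_le_one⟩
theorem one_mem_I : (1:ℝ) ∈ Icc (0:ℝ) 1 := ⟨zero_le_one, le_rfl⟩

section
variable {G : Set ℂ} {J1 J2 J3 : ℝ → ℂ}

theorem Adm.disj (h : Adm G J1 J2 J3) : Disjoint G (KK J1 J2 J3) := by
  rw [← h.fr, h.op.frontier_eq]; exact disjoint_sdiff_right

theorem Adm.d_notMem (h : Adm G J1 J2 J3) : J1 0 ∉ J2 '' Icc 0 1 := by
  rintro ⟨t, ht, e⟩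
  rcases h.nt2 1 one_mem_I t ht (by rw [h.cyc.CA, e]) with rfl | rfl
  · rw [← h.cyc.AB] at e
    exact one_ne_zero (h.cyc.iA one_mem_I zero_mem_I e)
  · rw [h.cyc.BC, ← h.cyc.CA] at e
    exact zero_ne_one (h.cyc.iC zero_mem_I one_mem_I e)

theorem Adm.c_notMem (h : Adm G J1 J2 J3) : J2 1 ∉ J1 '' Icc 0 1 := by
  rintro ⟨t, ht, e⟩
  rcases h.nt1 0 zero_mem_I t ht (by rw [← h.cyc.BC, e]) with rfl | rfl
  · rw [h.cyc.BC, ← h.cyc.CA] at e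
    exact one_ne_zero (h.cyc.iC one_mem_I zero_mem_I e)
  · rw [h.cyc.AB] at e
    exact zero_ne_one (h.cyc.iB zero_mem_I one_mem_I e)

theorem Adm.parity (h : Adm G J1 J2 J3) {φ : ℂ → ℂ} (hφ : IsRM φ G) {v : ℂ} (hvG : v ∉ G)
    (hvK : v ∉ KK J1 J2 J3) :
    ∃ l : ℤ, (l = 1 ∨ l = -1) ∧
      Wd J1 J2 J3 v - Wd J1 J2 J3 (φ 0) = l * (2 * Real.pi * Complex.I) := by
  set K := KK J1 J2 J3 with hK
  have hKcl : IsClosed K := h.cyc.compact.isClosed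
  set V := connectedComponentIn Kᶜ v with hV
  have hg : φ 0 ∈ G := hφ.mem (mem_ball_self one_pos)
  have hgK : φ 0 ∉ K := disjoint_left.1 h.disj hg
  have hVo : IsOpen V := hKcl.isOpen_compl.connectedComponentIn
  have hvV : v ∈ V := mem_connectedComponentIn hvK
  have hVK : Disjoint V K := disjoint_left.2 fun x hx => connectedComponentIn_subset _ _ hx
  have hVp : IsPreconnected V := isPreconnected_connectedComponentIn
  have hfrV := frontier_comp_subset hKcl v
  have hex : ∃ j ∈ frontier V, j ∉ J2 '' Icc 0 1 ∪ {J1 0} := by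
    by_contra hcon
    push Not at hcon
    have hlog : HasLog (fun z => (z - v) / (z - φ 0)) (J2 '' Icc 0 1 ∪ {J1 0}) := by
      refine hasLog_union (isCompact_arc h.cyc.cB 0 1).isClosed isClosed_singleton ?_ ?_ ?_
      · rw [inter_singleton_eq_empty.2 h.d_notMem]; exact isPreconnected_empty
      · refine hasLog_arcR zero_le_one h.cyc.cB.continuousOn h.cyc.iB ?_ ?_
        · refine ContinuousOn.div (by fun_prop) (by fun_prop) ?_
          intro z hz h0
          exact hgK (sub_eq_zero.1 h0 ▸ sub_KK2 hz)
        · intro z hz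
          exact div_ne_zero (fun h0 => hvK (sub_eq_zero.1 h0 ▸ sub_KK2 hz))
            (fun h0 => hgK (sub_eq_zero.1 h0 ▸ sub_KK2 hz))
      · refine ⟨fun _ => Complex.log ((J1 0 - v) / (J1 0 - φ 0)), continuousOn_const, ?_⟩
        rintro z rfl
        exact Complex.exp_log (div_ne_zero (fun h0 => hvK (sub_eq_zero.1 h0 ▸ mem_KK1 zero_mem_I))
            (fun h0 => hgK (sub_eq_zero.1 h0 ▸ mem_KK1 zero_mem_I)))
    have hcV : Conn (frontier V) v (φ 0) := conn_of_hasLog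
      (h.cyc.compact.of_isClosed_subset isClosed_frontier hfrV)
      (fun hh => hvK (hfrV hh)) (fun hh => hgK (hfrV hh)) (hlog.mono hcon)
    have hgV := conn_mem hVo hvV hcV
    have : Conn (frontier G) (φ 0) v := ⟨V, hVp, by rw [h.fr]; exact hVK, hgV, hvV⟩
    exact hvG (conn_mem h.op hg this)
  obtain ⟨j, hjV, hj⟩ := hex
  have hjK := hfrV hjV
  have hjc := frontier_subset_closure hjV
  simp only [mem_union, mem_singleton_iff, not_or] at hj
  rcases hjK with (⟨t, ht, rfl⟩ | hj2) | ⟨t, ht, rfl⟩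
  · have t0 : t ≠ 0 := by rintro rfl; exact hj.2 rfl
    have t1 : t ≠ 1 := by rintro rfl; exact hj.1 ⟨0, zero_mem_I, h.cyc.AB.symm⟩
    refine parity1 h.cyc hφ h.bd h.fr hvG hVp hVK hvV
      ⟨lt_of_le_of_ne ht.1 t0.symm, lt_of_le_of_ne ht.2 t1⟩ hjc ?_
    rintro (hh | ⟨s, hs, e⟩)
    · exact hj.1 hh
    · rcases h.nt1 s hs t ht e with e | e
      exacts [t0 e, t1 e]
  · exact absurd hj2 hj.1
  · have t0 : t ≠ 0 := by rintro rfl; exact hj.1 ⟨1, one_mem_I, h.cyc.BC⟩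
    have t1 : t ≠ 1 := by rintro rfl; exact hj.2 h.cyc.CA
    rw [← Wd_rot, ← Wd_rot, ← Wd_rot J1, ← Wd_rot J2]
    refine parity1 h.cyc.rot.rot hφ h.bd (h.fr.trans ?_) hvG hVp ?_ hvV
      ⟨lt_of_le_of_ne ht.1 t0.symm, lt_of_le_of_ne ht.2 t1⟩ hjc ?_
    · rw [KK_rot, KK_rot]
    · rw [KK_rot, KK_rot]; exact hVK
    rintro (⟨s, hs, e⟩ | hh)
    · rcases h.nt1 t ht s hs e.symm with rfl | rfl
      · exact hj.2 e.symm
      · exact hj.1 ⟨0, zero_mem_I, by rw [← h.cyc.AB, e]⟩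
    · exact hj.1 hh

theorem Adm.exists_rm (h : Adm G J1 J2 J3) {z0 : ℂ} (hz0 : z0 ∈ G) : ∃ φ, IsRM φ G ∧ φ 0 = z0 ∧
    ∃ r : ℝ, 0 < r ∧ deriv φ 0 = r := riemann_mapping h.op h.bd h.sc hz0

theorem Adm.preconn (h : Adm G J1 J2 J3) : IsPreconnected G :=
  h.sc.isPathConnected.isConnected.isPreconnected

theorem Adm.nonempty (h : Adm G J1 J2 J3) : G.Nonempty :=
  h.sc.isPathConnected.isConnected.nonempty

theorem Adm.conn (h : Adm G J1 J2 J3) {x y : ℂ} (hx : x ∈ G) (hy : y ∈ G) :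
    Conn (KK J1 J2 J3) x y := ⟨G, h.preconn, h.disj, hx, hy⟩

theorem Adm.exists_far (h : Adm G J1 J2 J3) : ∃ R : ℝ, 0 < R ∧ closure G ⊆ ball 0 R := by
  obtain ⟨R, hR⟩ := h.bd.closure.subset_ball 0
  exact ⟨max R 1, by positivity, hR.trans (ball_subset_ball (le_max_left _ _))⟩

theorem Adm.Wd_mem (h : Adm G J1 J2 J3) {z : ℂ} (hz : z ∈ G) : ∃ l : ℤ, (l = 1 ∨ l = -1) ∧
    Wd J1 J2 J3 z = l * (2 * Real.pi * Complex.I) := by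
  obtain ⟨R, hR, hGR⟩ := h.exists_far
  obtain ⟨φ, hφ, e, -⟩ := h.exists_rm hz
  have hKR : KK J1 J2 J3 ⊆ ball 0 R := h.fr ▸ frontier_subset_closure.trans hGR
  have hRn : ‖(R:ℂ)‖ = R := by simp [abs_of_pos hR]
  have hn : (R:ℂ) ∉ ball (0:ℂ) R := by simp [abs_of_pos hR]
  obtain ⟨l, hl, e'⟩ := h.parity hφ (v := R) (fun hh => hn (hGR (subset_closure hh)))
    (fun hh => hn (hKR hh))
  rw [Wd_far h.cyc hR hKR hRn.ge, e] at e'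
  refine ⟨-l, by rcases hl with rfl | rfl <;> simp, ?_⟩
  push_cast
  linear_combination -e'

theorem Adm.mem_iff (h : Adm G J1 J2 J3) {z : ℂ} (hz : z ∉ KK J1 J2 J3) : z ∈ G ↔
    ∃ l : ℤ, Odd l ∧ Wd J1 J2 J3 z = l * (2 * Real.pi * Complex.I) := by
  constructor
  · intro hz
    obtain ⟨l, hl, e⟩ := h.Wd_mem hz
    exact ⟨l, by rcases hl with rfl | rfl <;> decide, e⟩
  · rintro ⟨l, hl, e⟩
    by_contra hzG
    obtain ⟨g, hg⟩ := h.nonempty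
    obtain ⟨φ, hφ, eφ, -⟩ := h.exists_rm hg
    obtain ⟨m, hm, e'⟩ := h.parity hφ hzG hz
    obtain ⟨k, hk, e''⟩ := h.Wd_mem hg
    rw [eφ, e, e''] at e'
    have : ((l - k - m : ℤ) : ℂ) * (2 * Real.pi * Complex.I) = 0 := by
      push_cast; linear_combination e'
    rcases mul_eq_zero.1 this with h0 | h0
    · have h0 : l - k - m = 0 := by exact_mod_cast h0
      obtain ⟨j, rfl⟩ := hl
      rcases hm with rfl | rfl <;> rcases hk with rfl | rfl <;> omega
    · exact Complex.two_pi_I_ne_zero h0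

end

end HP

end

section
open Set Filter Topology Metric

namespace HP

section
variable {G : Set ℂ} {J1 J2 J3 : ℝ → ℂ}

theorem Adm.access (h : Adm G J1 J2 J3) {s τ t R : ℝ} (hs : 0 ≤ s) (hsτ : s < τ) (hτt : τ < t)
    (ht : t ≤ 1) (hw : ∀ x ∈ Icc s t, J3 x ∉ J1 '' Icc 0 1 ∪ J2 '' Icc 0 1)
    (hR : 0 < R) (hKR : KK J1 J2 J3 ⊆ closedBall 0 R) {u g : ℂ} (hu : R < ‖u‖) (hg : g ∈ G) :
    Conn (RR J3 J1 J2 s t) u g := by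
  have hRK : RR J3 J1 J2 s t ⊆ KK J1 J2 J3 := by
    have := RR_sub J3 J1 J2 hs (hsτ.trans hτt).le ht
    rwa [KK_rot, KK_rot] at this
  have hτI : τ ∈ Icc (0:ℝ) 1 := ⟨hs.trans hsτ.le, hτt.le.trans ht⟩
  have hτR : J3 τ ∉ RR J3 J1 J2 s t := fun hh => by
    rcases RR_notMem h.cyc.rot.rot hs ht ⟨hsτ.le, hτt.le⟩ (hw τ ⟨hsτ.le, hτt.le⟩) hh with e | e <;>
      linarith
  obtain ⟨γ, cγ, γ0, γi, γf⟩ := h.inf τ hτI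
  obtain ⟨T, hT, hT0⟩ := ((γi.eventually_gt_atTop R).and (eventually_gt_atTop 0)).exists
  have c1 : Conn (RR J3 J1 J2 s t) u (γ T) := (conn_far hR hKR hu hT).mono hRK
  refine c1.trans (conn_through (RR_closed h.cyc.rot.rot s t) hτR (V := γ '' Ioi 0)
    (isPreconnected_Ioi.image _ cγ.continuousOn) ?_ ⟨T, hT0, rfl⟩ ?_ h.preconn
    (h.disj.mono_right hRK) hg ?_)
  · refine disjoint_left.2 ?_
    rintro _ ⟨x, hx, rfl⟩ hh
    exact γf x hx (by rw [h.fr]; exact hRK hh)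
  · rw [← γ0]
    have h0 : (0:ℝ) ∈ closure (Ioi (0:ℝ)) := by rw [closure_Ioi]; exact self_mem_Ici
    exact image_closure_subset_closure_image cγ ⟨0, h0, rfl⟩
  · exact frontier_subset_closure (by rw [h.fr]; exact mem_KK3 hτI)

theorem Adm.a_notMem (h : Adm G J1 J2 J3) : J1 1 ∉ J3 '' Icc 0 1 := by
  rintro ⟨ta, hta, ea⟩
  have ta0 : ta ≠ 0 := by
    rintro rfl
    rw [← h.cyc.BC, h.cyc.AB] at ea
    exact one_ne_zero (h.cyc.iB one_mem_I zero_mem_I ea)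
  have ta1 : ta ≠ 1 := by
    rintro rfl
    rw [h.cyc.CA] at ea
    exact zero_ne_one (h.cyc.iA zero_mem_I one_mem_I ea)
  have h0a : 0 < ta := lt_of_le_of_ne hta.1 ta0.symm
  have ha1 : ta < 1 := lt_of_le_of_ne hta.2 ta1
  have hfree : ∀ τ, τ ∈ Ioo (0:ℝ) 1 → τ ≠ ta → J3 τ ∉ J1 '' Icc 0 1 ∪ J2 '' Icc 0 1 := by
    intro τ hτ hne hh
    have hτI : τ ∈ Icc (0:ℝ) 1 := Ioo_subset_Icc_self hτ
    rcases hh with ⟨t, ht, e⟩ | ⟨t, ht, e⟩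
    · rcases h.nt1 τ hτI t ht e.symm with rfl | rfl
      · rw [← h.cyc.CA] at e
        exact hτ.2.ne (h.cyc.iC one_mem_I hτI e).symm
      · exact hne (h.cyc.iC hta hτI (ea.trans e)).symm
    · rcases h.nt2 τ hτI t ht e.symm with rfl | rfl
      · rw [← h.cyc.AB] at e
        exact hne (h.cyc.iC hta hτI (ea.trans e)).symm
      · rw [h.cyc.BC] at e
        exact hτ.1.ne (h.cyc.iC zero_mem_I hτI e)
  obtain ⟨τ1, a1, b1⟩ := exists_between ha1
  obtain ⟨τ2, a2, b2⟩ := exists_between h0a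
  obtain ⟨s1, t1, s1p, s1l, s1τ, τt1, -, t1u, hw1⟩ := exists_window h.cyc.rot.rot
    ⟨h0a.trans a1, b1⟩ (hfree τ1 ⟨h0a.trans a1, b1⟩ a1.ne') ta 1 a1 b1
  obtain ⟨s2, t2, s2p, -, s2τ, τt2, t2l, t2u, hw2⟩ := exists_window h.cyc.rot.rot
    ⟨a2, b2.trans ha1⟩ (hfree τ2 ⟨a2, b2.trans ha1⟩ b2.ne) 0 ta a2 b2
  obtain ⟨R, hR, hGR⟩ := h.exists_far
  have hKR : KK J1 J2 J3 ⊆ ball 0 R := h.fr ▸ frontier_subset_closure.trans hGR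
  obtain ⟨g, hg⟩ := h.nonempty
  set u : ℂ := ((R + 1 : ℝ) : ℂ) with hu
  have hun : R < ‖u‖ := by rw [hu, Complex.norm_real, Real.norm_eq_abs, abs_of_pos] <;> linarith
  have huG : u ∉ closure G := fun hh => by
    have := hGR hh
    simp only [mem_ball, dist_zero_right] at this
    linarith
  have huK : u ∉ KK J1 J2 J3 := fun hh => huG (frontier_subset_closure (h.fr ▸ hh))
  have hgK : g ∉ KK J1 J2 J3 := disjoint_left.1 h.disj hg
  have c1 := h.access s1p.le s1τ τt1 t1u.le hw1 hR (hKR.trans ball_subset_closedBall) hun hg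
  have c2 := h.access s2p.le s2τ τt2 t2u.le hw2 hR (hKR.trans ball_subset_closedBall) hun hg
  obtain ⟨H1, cH1, eH1⟩ := hasLog_of_conn (RR_closed h.cyc.rot.rot s1 t1) c1
  obtain ⟨H2, cH2, eH2⟩ := hasLog_of_conn (RR_closed h.cyc.rot.rot s2 t2) c2
  have l3 : HasLog (fun x => (J3 x - u) / (J3 x - g)) (Icc 0 1) :=
    (hasLog_sub h.cyc.cC zero_le_one fun hh => huK (sub_KK3 hh)).div
    (hasLog_sub h.cyc.cC zero_le_one fun hh => hgK (sub_KK3 hh))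
  -- loop in `R2`
  have i1 : inc (fun x => (J1 x - u) / (J1 x - g)) 0 1 = _ :=
    inc_of_log (F := fun z => (z - u) / (z - g)) zero_le_one h.cyc.cA.continuousOn
    (fun x hx => Or.inr (Or.inl ⟨x, hx, rfl⟩)) cH2 eH2
  have i2 : inc (fun x => (J3 x - u) / (J3 x - g)) ta 1 = _ :=
    inc_of_log (F := fun z => (z - u) / (z - g)) ha1.le h.cyc.cC.continuousOn
    (fun x hx => Or.inl (Or.inr ⟨x, ⟨t2l.le.trans hx.1, hx.2⟩, rfl⟩)) cH2 eH2
  have k1 : inc (fun x => (J1 x - u) / (J1 x - g)) 0 1 = _ :=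
    inc_of_log (F := fun z => (z - u) / (z - g)) zero_le_one h.cyc.cA.continuousOn
    (fun x hx => Or.inr (Or.inl ⟨x, hx, rfl⟩)) cH1 eH1
  have k2 : inc (fun x => (J3 x - u) / (J3 x - g)) ta s1 = _ :=
    inc_of_log (F := fun z => (z - u) / (z - g)) s1l.le h.cyc.cC.continuousOn
    (fun x hx => Or.inl (Or.inl ⟨x, ⟨h0a.le.trans hx.1, hx.2⟩, rfl⟩)) cH1 eH1
  have k3 : inc (fun x => (J3 x - u) / (J3 x - g)) t1 1 = _ :=
    inc_of_log (F := fun z => (z - u) / (z - g)) t1u.le h.cyc.cC.continuousOn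
    (fun x hx => Or.inl (Or.inr ⟨x, hx, rfl⟩)) cH1 eH1
  have s1t1 : s1 ≤ t1 := (s1τ.trans τt1).le
  have j1 := inc_add s1l.le (s1t1.trans t1u.le) (l3.mono (Icc_subset_Icc_left h0a.le))
  have j2 := inc_add s1t1 t1u.le (l3.mono (Icc_subset_Icc_left s1p.le))
  rw [ea, h.cyc.CA] at i2
  rw [ea] at k2
  rw [h.cyc.CA] at k3
  have hinc : inc (fun x => (J3 x - u) / (J3 x - g)) s1 t1 = H1 (J3 t1) - H1 (J3 s1) := by
    linear_combination j1 + j2 - k2 - k3 + i2 + i1 - k1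
  -- glue
  obtain ⟨B, cB, eB⟩ := hasLog_arcR (f := fun z => (z - u) / (z - g)) s1t1 h.cyc.cC.continuousOn
    (h.cyc.iC.mono (Icc_subset_Icc s1p.le t1u.le))
    (ContinuousOn.div (by fun_prop) (by fun_prop) (by
      rintro _ ⟨x, hx, rfl⟩ h0
      exact hgK (sub_eq_zero.1 h0 ▸ mem_KK3 (Icc_subset_Icc s1p.le t1u.le hx))))
    (by
      rintro _ ⟨x, hx, rfl⟩
      exact div_ne_zero
        (fun h0 => huK (sub_eq_zero.1 h0 ▸ mem_KK3 (Icc_subset_Icc s1p.le t1u.le hx)))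
        (fun h0 => hgK (sub_eq_zero.1 h0 ▸ mem_KK3 (Icc_subset_Icc s1p.le t1u.le hx))))
  have hincB : inc (fun x => (J3 x - u) / (J3 x - g)) s1 t1 = B (J3 t1) - B (J3 s1) :=
    inc_of_log (F := fun z => (z - u) / (z - g)) s1t1 h.cyc.cC.continuousOn
      (mapsTo_image J3 _) cB eB
  have hl : HasLog (fun z => (z - u) / (z - g)) (RR J3 J1 J2 s1 t1 ∪ J3 '' Icc s1 t1) := by
    refine hasLog_union_of_eq (RR_closed h.cyc.rot.rot s1 t1) (isCompact_arc h.cyc.cC _ _).isClosed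
      cH1 cB eH1 eB (H1 (J3 s1) - B (J3 s1)) ?_
    rintro _ ⟨hzR, x, hx, rfl⟩
    rcases RR_notMem h.cyc.rot.rot s1p.le t1u.le hx (hw1 x hx) hzR with rfl | rfl
    · rfl
    · rw [hinc] at hincB; linear_combination hincB
  rw [← RR_union J3 J1 J2 s1p.le s1t1 t1u.le, KK_rot, KK_rot] at hl
  have := conn_of_hasLog h.cyc.compact huK hgK hl
  rw [← h.fr] at this
  exact huG (subset_closure (conn_mem h.op hg this.symm))

/-- interior points of `J3` lie on no other arc -/
theorem Adm.free3 (h : Adm G J1 J2 J3) {τ : ℝ} (hτ : τ ∈ Ioo (0:ℝ) 1) :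
    J3 τ ∉ J1 '' Icc 0 1 ∪ J2 '' Icc 0 1 := by
  have hτI : τ ∈ Icc (0:ℝ) 1 := Ioo_subset_Icc_self hτ
  rintro (⟨t, ht, e⟩ | ⟨t, ht, e⟩)
  · rcases h.nt1 τ hτI t ht e.symm with rfl | rfl
    · rw [← h.cyc.CA] at e
      exact hτ.2.ne (h.cyc.iC one_mem_I hτI e).symm
    · exact h.a_notMem ⟨τ, hτI, e.symm⟩
  · rcases h.nt2 τ hτI t ht e.symm with rfl | rfl
    · exact h.a_notMem ⟨τ, hτI, e.symm.trans h.cyc.AB.symm⟩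
    · rw [h.cyc.BC] at e
      exact hτ.1.ne (h.cyc.iC zero_mem_I hτI e)

/-- `J1` meets `J3` only at `J1 0` -/
theorem Adm.int13 (h : Adm G J1 J2 J3) {s t : ℝ} (hs : s ∈ Icc (0:ℝ) 1) (ht : t ∈ Icc (0:ℝ) 1)
    (e : J1 s = J3 t) : s = 0 ∧ t = 1 := by
  rcases h.nt1 t ht s hs e.symm with rfl | rfl
  · rw [← h.cyc.CA] at e
    exact ⟨rfl, h.cyc.iC ht one_mem_I e.symm⟩
  · exact absurd ⟨t, ht, e.symm⟩ h.a_notMem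

theorem Adm.int23 (h : Adm G J1 J2 J3) {s t : ℝ} (hs : s ∈ Icc (0:ℝ) 1) (ht : t ∈ Icc (0:ℝ) 1)
    (e : J2 s = J3 t) : s = 1 ∧ t = 0 := by
  rcases h.nt2 t ht s hs e.symm with rfl | rfl
  · exact absurd ⟨t, ht, e.symm.trans h.cyc.AB.symm⟩ h.a_notMem
  · rw [h.cyc.BC] at e
    exact ⟨rfl, h.cyc.iC ht zero_mem_I e.symm⟩

end

end HP

end

section
open Set Filter Topology Metric

namespace HP

theorem continuousAt_inc {A : ℝ → ℂ} (hA : Continuous A) {s t : ℝ} (hst : s ≤ t) {q : ℂ}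
    (hq : q ∉ A '' Icc s t) : ContinuousAt (fun p => inc (fun x => A x - p) s t) q := by
  refine tendsto_inc (ι := ℂ) (l := 𝓝 q) (Γ := fun _ => A) (p := fun i => i) (s := fun _ => s)
    (t := fun _ => t) (fun _ => hA) hA ?_ tendsto_id tendsto_const_nhds tendsto_const_nhds
    (fun _ => hst) hst (fun x hx e => hq ⟨x, hx, e⟩) ?_
  · intro u hu
    exact Eventually.of_forall fun _ x => refl_mem_uniformity hu
  · have : ∀ᶠ p in 𝓝 q, p ∈ (A '' Icc s t)ᶜ :=
      (isCompact_arc hA s t).isClosed.isOpen_compl.mem_nhds hq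
    filter_upwards [this] with p hp x hx e
    exact hp ⟨x, hx, e⟩

theorem jump {A : ℝ → ℂ} (hA : Continuous A) {s τ t : ℝ} (hsτ : s < τ) (hτt : τ < t)
    (hi : InjOn A (Icc s t)) (hint : interior (A '' Icc s t) = ∅) {e : ℝ} (he : 0 < e) {F : ℂ → ℂ}
    (cF : ContinuousOn F (ball (A τ) e))
    (hF : ∀ p ∈ ball (A τ) e, p ∉ A '' Icc s t → inc (fun x => A x - p) s t = F p) : False := by
  have hst : s ≤ t := (hsτ.trans hτt).le
  have hsm : s ∈ Icc s t := left_mem_Icc.2 hst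
  have htm : t ∈ Icc s t := right_mem_Icc.2 hst
  have hne : A s ≠ A τ := fun h => hsτ.ne (hi hsm ⟨hsτ.le, hτt.le⟩ h)
  -- shrink the ball
  obtain ⟨e', he', hee, hes⟩ : ∃ e', 0 < e' ∧ e' ≤ e ∧ A s ∉ ball (A τ) e' := by
    refine ⟨min e (dist (A s) (A τ)), lt_min he (dist_pos.2 hne), min_le_left _ _, ?_⟩
    rw [mem_ball, not_lt]; exact min_le_right _ _
  set Δ := ball (A τ) e' with hΔ
  have cF' : ContinuousOn F Δ := cF.mono (ball_subset_ball hee)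
  have hF' : ∀ p ∈ Δ, p ∉ A '' Icc s t → inc (fun x => A x - p) s t = F p :=
    fun p hp => hF p (ball_subset_ball hee hp)
  have hAc : IsClosed (A '' Icc s t) := (isCompact_arc hA s t).isClosed
  have hexp : ∀ p, p ∉ A '' Icc s t → Complex.exp (inc (fun x => A x - p) s t) =
      (p - A t) / (p - A s) := by
    intro p hp
    rw [exp_inc hst (hasLog_sub hA hst hp), ← neg_sub, ← neg_sub p (A s), neg_div_neg_eq]
  have hdense : Dense (A '' Icc s t)ᶜ := interior_eq_empty_iff_dense_compl.1 hint
  have hFe : ∀ p ∈ Δ, Complex.exp (F p) = (p - A t) / (p - A s) := by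
    intro p hp
    have hnb : (𝓝[(A '' Icc s t)ᶜ] p).NeBot := mem_closure_iff_nhdsWithin_neBot.1 (hdense p)
    have c1 : Tendsto (fun p => Complex.exp (F p)) (𝓝[(A '' Icc s t)ᶜ] p) (𝓝 (Complex.exp (F p))) :=
      (Complex.continuous_exp.continuousAt.comp
        (cF'.continuousAt (isOpen_ball.mem_nhds hp))).mono_left nhdsWithin_le_nhds
    have c2 : Tendsto (fun p => (p - A t) / (p - A s)) (𝓝[(A '' Icc s t)ᶜ] p)
        (𝓝 ((p - A t) / (p - A s))) := by
      refine Tendsto.mono_left ?_ nhdsWithin_le_nhds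
      refine ContinuousAt.div (by fun_prop) (by fun_prop) ?_
      intro h0
      exact hes (sub_eq_zero.1 h0 ▸ hp)
    refine tendsto_nhds_unique (c1.congr' ?_) c2
    filter_upwards [self_mem_nhdsWithin, mem_nhdsWithin_of_mem_nhds (isOpen_ball.mem_nhds hp)]
      with x hx hx'
    rw [← hF' x hx' hx, hexp x hx]
  -- subarcs
  obtain ⟨δ, hδ, hδb⟩ := Metric.continuousAt_iff.1 (hA.continuousAt (x := τ)) e' he'
  obtain ⟨s1, hs1, hs1'⟩ := exists_between (max_lt hsτ (sub_lt_self τ hδ))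
  obtain ⟨t1, ht1, ht1'⟩ := exists_between (lt_min hτt (lt_add_of_pos_right τ hδ))
  simp only [max_lt_iff, lt_min_iff] at hs1 ht1'
  have hmid : ∀ x ∈ Icc s1 t1, A x ∈ Δ := fun x hx => hδb (by
    rw [Real.dist_eq, abs_lt]; constructor <;> linarith [hx.1, hx.2])
  have hcov : ∀ x ∈ Icc s t, A x ∉ Δ → A x ∈ A '' Icc s s1 ∪ A '' Icc t1 t := by
    intro x hx hn
    by_cases h1 : x ≤ s1
    · exact Or.inl ⟨x, ⟨hx.1, h1⟩, rfl⟩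
    by_cases h2 : t1 ≤ x
    · exact Or.inr ⟨x, ⟨h2, hx.2⟩, rfl⟩
    push Not at h1 h2
    exact absurd (hmid x ⟨h1.le, h2.le⟩) hn
  have hdisj : Disjoint (A '' Icc t1 t) (A '' Icc s s1) := by
    refine disjoint_left.2 ?_
    rintro _ ⟨x, hx, rfl⟩ ⟨y, hy, e⟩
    have := hi ⟨hy.1, by linarith [hy.2]⟩ ⟨by linarith [hx.1], hx.2⟩ e
    linarith [hx.1, hy.2]
  obtain ⟨r, hr, hrd⟩ := hdisj.exists_thickenings (isCompact_arc hA t1 t)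
    (isCompact_arc hA s s1).isClosed
  set V := thickening r (A '' Icc t1 t) with hV
  have hVo : IsOpen V := isOpen_thickening
  have hq1 : A t ∈ V := self_subset_thickening hr _ ⟨t, ⟨by linarith, le_rfl⟩, rfl⟩
  have hclV : ∀ z ∈ A '' Icc s s1, z ∉ closure V := by
    intro z hz hc
    obtain ⟨y, hy, hy'⟩ := mem_closure_iff.1 hc _ isOpen_thickening
      (self_subset_thickening hr _ hz)
    exact disjoint_left.1 hrd hy' hy
  refine no_log hVo ((isCompact_arc hA t1 t).isBounded.thickening) hq1
    (hclV _ ⟨s, ⟨le_rfl, by linarith⟩, rfl⟩) ?_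
  classical
  refine ⟨fun z => if z ∈ Δ then F z else inc (fun x => A x - z) s t, ?_, ?_⟩
  · intro z hz
    refine ContinuousAt.continuousWithinAt ?_
    by_cases hzΔ : z ∈ Δ
    · refine (cF'.continuousAt (isOpen_ball.mem_nhds hzΔ)).congr ?_
      filter_upwards [isOpen_ball.mem_nhds hzΔ] with x hx
      rw [if_pos hx]
    · have hzA : z ∉ A '' Icc s t := by
        rintro ⟨x, hx, rfl⟩
        rcases hcov x hx hzΔ with h1 | h1
        · exact hclV _ h1 (frontier_subset_closure hz)
        · exact hz.2 (hVo.interior_eq.symm ▸ self_subset_thickening hr _ h1)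
      refine (continuousAt_inc hA hst hzA).congr ?_
      filter_upwards [hAc.isOpen_compl.mem_nhds hzA] with x hx
      split_ifs with hxΔ
      · exact hF' x hxΔ hx
      · rfl
  · intro z hz
    by_cases hzΔ : z ∈ Δ
    · simp only [if_pos hzΔ]; exact hFe z hzΔ
    · simp only [if_neg hzΔ]
      refine hexp z ?_
      rintro ⟨x, hx, rfl⟩
      rcases hcov x hx hzΔ with h1 | h1
      · exact hclV _ h1 (frontier_subset_closure hz)
      · exact hz.2 (hVo.interior_eq.symm ▸ self_subset_thickening hr _ h1)

theorem inc_reparam {J A : ℝ → ℂ} (hJ : Continuous J) {υ : ℝ → ℝ} {s t : ℝ} (hst : s ≤ t)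
    (hυ : ContinuousOn υ (Icc s t)) (hm : MonotoneOn υ (Icc s t))
    (he : ∀ x ∈ Icc s t, A x = J (υ x)) {p : ℂ} (hp : p ∉ J '' Icc (υ s) (υ t)) :
    inc (fun x => A x - p) s t = inc (fun x => J x - p) (υ s) (υ t) := by
  have hsm : s ∈ Icc s t := left_mem_Icc.2 hst
  have htm : t ∈ Icc s t := right_mem_Icc.2 hst
  have hmap : MapsTo υ (Icc s t) (Icc (υ s) (υ t)) :=
    fun x hx => ⟨hm hsm hx hx.1, hm hx htm hx.2⟩
  obtain ⟨h, c, e⟩ := hasLog_sub hJ (hm hsm htm hst) hp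
  rw [inc_eq (hm hsm htm hst) c e, inc_eq (h := fun x => h (υ x)) hst (c.comp hυ hmap)]
  intro x hx
  rw [e _ (hmap hx), he x hx]

theorem inc_split_ratio {A : ℝ → ℂ} (hA : Continuous A) {v g : ℂ} (hv : v ∉ A '' Icc 0 1)
    (hg : g ∉ A '' Icc 0 1) {s t : ℝ} (hs : 0 ≤ s) (hst : s ≤ t) (ht : t ≤ 1) {R : Set ℂ}
    {H : ℂ → ℂ} (cH : ContinuousOn H R) (eH : ∀ z ∈ R, Complex.exp (H z) = (z - v) / (z - g))
    (h1 : A '' Icc 0 s ⊆ R) (h2 : A '' Icc t 1 ⊆ R) :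
    inc (fun x => A x - v) 0 1 - inc (fun x => A x - g) 0 1 =
      (inc (fun x => A x - v) s t - inc (fun x => A x - g) s t) - (H (A t) - H (A s))
        + (H (A 1) - H (A 0)) := by
  have lA := hasLog_sub hA zero_le_one hv
  have lA' := hasLog_sub hA zero_le_one hg
  have eA := inc_div zero_le_one lA lA'
  have lAA := lA.div lA'
  have e1 := inc_add hs (hst.trans ht) lAA
  have e2 := inc_add hst ht (lAA.mono (Icc_subset_Icc_left hs))
  have e3 := inc_div hst (lA.mono (Icc_subset_Icc hs ht)) (lA'.mono (Icc_subset_Icc hs ht))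
  have i1 : inc (fun x => (A x - v) / (A x - g)) 0 s = _ :=
    inc_of_log (F := fun z => (z - v) / (z - g)) hs hA.continuousOn
    (fun x hx => h1 ⟨x, hx, rfl⟩) cH eH
  have i2 : inc (fun x => (A x - v) / (A x - g)) t 1 = _ :=
    inc_of_log (F := fun z => (z - v) / (z - g)) ht hA.continuousOn
    (fun x hx => h2 ⟨x, hx, rfl⟩) cH eH
  linear_combination -eA - e1 - e2 + i1 + i2 + e3

theorem Adm.lemmaS {G : Set ℂ} {J1 J2 J3 : ℝ → ℂ} (h : Adm G J1 J2 J3) {t1 t2 : ℝ} (h0 : 0 ≤ t1)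
    (h12 : t1 < t2) (h1 : t2 ≤ 1) {υ : ℝ → ℝ} (cυ : ContinuousOn υ (Icc t1 t2))
    (mυ : StrictMonoOn υ (Icc t1 t2)) (hυ : MapsTo υ (Icc t1 t2) (Icc 0 1))
    (he : ∀ x ∈ Icc t1 t2, J1 x = J2 (υ x)) : False := by
  set τ := (t1 + t2) / 2 with hτ
  have hτ1 : t1 < τ := by rw [hτ]; linarith
  have hτ2 : τ < t2 := by rw [hτ]; linarith
  set K := KK J1 J2 J3 with hK
  have m1 : t1 ∈ Icc t1 t2 := left_mem_Icc.2 h12.le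
  have m2 : t2 ∈ Icc t1 t2 := right_mem_Icc.2 h12.le
  have mτ : τ ∈ Icc t1 t2 := ⟨hτ1.le, hτ2.le⟩
  have hI : Icc t1 t2 ⊆ Icc 0 1 := Icc_subset_Icc h0 h1
  set R : Set ℂ := (J1 '' Icc 0 t1 ∪ J1 '' Icc t2 1) ∪ (J2 '' Icc 0 (υ t1) ∪ J2 '' Icc (υ t2) 1) ∪
    J3 '' Icc 0 1 with hR
  have hRc : IsClosed R := ((((isCompact_arc h.cyc.cA _ _).union (isCompact_arc h.cyc.cA _ _)).union
    ((isCompact_arc h.cyc.cB _ _).union (isCompact_arc h.cyc.cB _ _))).union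
    (isCompact_arc h.cyc.cC _ _)).isClosed
  have hυ1 : υ t1 < υ τ := mυ m1 mτ hτ1
  have hυ2 : υ τ < υ t2 := mυ mτ m2 hτ2
  have hqR : J1 τ ∉ R := by
    rintro (((⟨x, hx, e⟩ | ⟨x, hx, e⟩) | (⟨x, hx, e⟩ | ⟨x, hx, e⟩)) | ⟨x, hx, e⟩)
    · have := h.cyc.iA ⟨hx.1, by linarith [hx.2]⟩ (hI mτ) e
      linarith [hx.2]
    · have := h.cyc.iA ⟨by linarith [hx.1], hx.2⟩ (hI mτ) e
      linarith [hx.1]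
    · rw [he τ mτ] at e
      have := h.cyc.iB ⟨hx.1, by linarith [hx.2, (hυ m1).2]⟩ (hυ mτ) e
      linarith [hx.2]
    · rw [he τ mτ] at e
      have := h.cyc.iB ⟨by linarith [hx.1, (hυ m2).1], hx.2⟩ (hυ mτ) e
      linarith [hx.1]
    · have := (h.int13 (hI mτ) hx e.symm).1
      linarith
  obtain ⟨e, hepos, hball⟩ := Metric.isOpen_iff.1 hRc.isOpen_compl _ hqR
  have hKint : interior K = ∅ := by rw [hK, ← h.fr, ← frontier_compl, interior_frontier h.op.isClosed_compl]
  have hAint : interior (J1 '' Icc t1 t2) = ∅ := by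
    rw [← subset_empty_iff, ← hKint]
    exact interior_mono ((image_mono hI).trans sub_KK1)
  have hqc : J1 τ ∈ closure G := frontier_subset_closure (by rw [h.fr]; exact mem_KK1 (hI mτ))
  obtain ⟨g, hgΔ, hg⟩ := mem_closure_iff.1 hqc (ball (J1 τ) (e / 4)) isOpen_ball
    (mem_ball_self (by linarith))
  have hgK : g ∉ K := disjoint_left.1 h.disj hg
  have hnear : ∀ p ∈ ball (J1 τ) (e / 4), ∀ z ∈ R, ‖p - g‖ < ‖z - g‖ := by
    intro p hp z hz
    have h3 : e ≤ dist z (J1 τ) := by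
      by_contra hh
      exact hball (mem_ball.2 (not_le.1 hh)) hz
    rw [mem_ball] at hp hgΔ
    have h4 := dist_triangle_right p g (J1 τ)
    have h5 := dist_triangle z g (J1 τ)
    rw [← dist_eq_norm, ← dist_eq_norm]
    linarith
  have hn1 : ∀ p ∈ ball (J1 τ) (e / 4), ∀ z ∈ R, ‖(z - p) / (z - g) - 1‖ < 1 := by
    intro p hp z hz
    have h3 := hnear p hp z hz
    have h4 : 0 < ‖z - g‖ := (norm_nonneg _).trans_lt h3
    have h5 : z - g ≠ 0 := norm_pos_iff.1 h4
    have : (z - p) / (z - g) - 1 = - (p - g) / (z - g) := by field_simp; ring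
    rw [this, norm_div, norm_neg, div_lt_one h4]
    exact h3
  have hslit : ∀ p ∈ ball (J1 τ) (e / 4), ∀ z ∈ R, (z - p) / (z - g) ∈ Complex.slitPlane := by
    intro p hp z hz
    have := Complex.mem_slitPlane_of_norm_lt_one (hn1 p hp z hz)
    simpa using this
  have hgR : ∀ z ∈ R, z - g ≠ 0 := fun z hz => norm_pos_iff.1
    ((norm_nonneg _).trans_lt (hnear g hgΔ z hz))
  have hRt1 : J1 t1 ∈ R := Or.inl (Or.inl (Or.inl ⟨t1, ⟨h0, le_rfl⟩, rfl⟩))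
  have hRt2 : J1 t2 ∈ R := Or.inl (Or.inl (Or.inr ⟨t2, ⟨le_rfl, h1⟩, rfl⟩))
  refine jump h.cyc.cA hτ1 hτ2 (h.cyc.iA.mono hI) hAint (e := e / 4) (by linarith)
    (F := fun p => inc (fun x => J1 x - g) t1 t2 + (Complex.log ((J1 t2 - p) / (J1 t2 - g)) -
      Complex.log ((J1 t1 - p) / (J1 t1 - g)))) ?_ ?_
  · refine continuousOn_const.add (ContinuousOn.sub ?_ ?_)
    · exact ContinuousOn.clog (by fun_prop) fun p hp => hslit p hp _ hRt2
    · exact ContinuousOn.clog (by fun_prop) fun p hp => hslit p hp _ hRt1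
  · intro p hp hpA
    have hpR : p ∉ R := fun hh => hball (ball_subset_ball (by linarith) hp) hh
    have hJ2A : J2 '' Icc (υ t1) (υ t2) ⊆ J1 '' Icc t1 t2 := by
      rintro _ ⟨y, hy, rfl⟩
      obtain ⟨x, hx, rfl⟩ := intermediate_value_Icc h12.le cυ hy
      exact ⟨x, hx, he x hx⟩
    have hpK : p ∉ K := by
      rintro ((⟨x, hx, rfl⟩ | ⟨x, hx, rfl⟩) | hx)
      · rcases le_total x t1 with h' | h'
        · exact hpR (Or.inl (Or.inl (Or.inl ⟨x, ⟨hx.1, h'⟩, rfl⟩)))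
        · rcases le_total x t2 with h'' | h''
          · exact hpA ⟨x, ⟨h', h''⟩, rfl⟩
          · exact hpR (Or.inl (Or.inl (Or.inr ⟨x, ⟨h'', hx.2⟩, rfl⟩)))
      · rcases le_total x (υ t1) with h' | h'
        · exact hpR (Or.inl (Or.inr (Or.inl ⟨x, ⟨hx.1, h'⟩, rfl⟩)))
        · rcases le_total x (υ t2) with h'' | h''
          · exact hpA (hJ2A ⟨x, ⟨h', h''⟩, rfl⟩)
          · exact hpR (Or.inl (Or.inr (Or.inr ⟨x, ⟨h'', hx.2⟩, rfl⟩)))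
      · exact hpR (Or.inr hx)
    set H : ℂ → ℂ := fun z => Complex.log ((z - p) / (z - g)) with hH
    have cH : ContinuousOn H R := ContinuousOn.clog
      (ContinuousOn.div (by fun_prop) (by fun_prop) hgR) fun z hz => hslit p hp z hz
    have eH : ∀ z ∈ R, Complex.exp (H z) = (z - p) / (z - g) := fun z hz =>
      Complex.exp_log (Complex.slitPlane_ne_zero (hslit p hp z hz))
    have hp1 : p ∉ J1 '' Icc 0 1 := fun hh => hpK (sub_KK1 hh)
    have hp2 : p ∉ J2 '' Icc 0 1 := fun hh => hpK (sub_KK2 hh)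
    have hp3 : p ∉ J3 '' Icc 0 1 := fun hh => hpK (sub_KK3 hh)
    have hg1 : g ∉ J1 '' Icc 0 1 := fun hh => hgK (sub_KK1 hh)
    have hg2 : g ∉ J2 '' Icc 0 1 := fun hh => hgK (sub_KK2 hh)
    have hg3 : g ∉ J3 '' Icc 0 1 := fun hh => hgK (sub_KK3 hh)
    have q1 := inc_split_ratio h.cyc.cA hp1 hg1 h0 h12.le h1 cH eH
      (fun _ hh => Or.inl (Or.inl (Or.inl hh))) (fun _ hh => Or.inl (Or.inl (Or.inr hh)))
    have hυ12 : υ t1 ≤ υ t2 := (hυ1.trans hυ2).le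
    have q2 := inc_split_ratio h.cyc.cB hp2 hg2 (hυ m1).1 hυ12 (hυ m2).2 cH eH
      (fun _ hh => Or.inl (Or.inr (Or.inl hh))) (fun _ hh => Or.inl (Or.inr (Or.inr hh)))
    have q3 := inc_split_ratio h.cyc.cC hp3 hg3 le_rfl zero_le_one le_rfl cH eH
      (fun _ hh => Or.inr (image_mono (Icc_subset_Icc_right zero_le_one) hh))
      (fun _ hh => Or.inr (image_mono (Icc_subset_Icc_left zero_le_one) hh))
    have i3 := inc_div zero_le_one (hasLog_sub h.cyc.cC zero_le_one hp3)
      (hasLog_sub h.cyc.cC zero_le_one hg3)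
    have k3 : inc (fun x => (J3 x - p) / (J3 x - g)) 0 1 = _ :=
      inc_of_log (F := fun z => (z - p) / (z - g)) zero_le_one h.cyc.cC.continuousOn
        (fun x hx => Or.inr ⟨x, hx, rfl⟩) cH eH
    have hsub2 : Icc (υ t1) (υ t2) ⊆ Icc 0 1 := Icc_subset_Icc (hυ m1).1 (hυ m2).2
    have r1 := inc_reparam h.cyc.cB h12.le cυ mυ.monotoneOn he
      (p := p) (fun hh => hp2 (image_mono hsub2 hh))
    have r2 := inc_reparam h.cyc.cB h12.le cυ mυ.monotoneOn he
      (p := g) (fun hh => hg2 (image_mono hsub2 hh))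
    rw [← r1, ← r2, ← he t1 m1, ← he t2 m2, h.cyc.BC, ← h.cyc.AB] at q2
    rw [h.cyc.CA] at k3
    have hW : Wd J1 J2 J3 p - Wd J1 J2 J3 g = 2 * ((inc (fun x => J1 x - p) t1 t2 -
        inc (fun x => J1 x - g) t1 t2) - (H (J1 t2) - H (J1 t1))) := by
      simp only [Wd]
      linear_combination q1 + q2 - i3 + k3
    have lp := hasLog_sub h.cyc.cA h12.le fun hh => hp1 (image_mono hI hh)
    have lg := hasLog_sub h.cyc.cA h12.le fun hh => hg1 (image_mono hI hh)
    have hex : Complex.exp (inc (fun x => J1 x - p) t1 t2 - inc (fun x => J1 x - g) t1 t2) =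
        Complex.exp (H (J1 t2) - H (J1 t1)) := by
      rw [Complex.exp_sub, Complex.exp_sub, exp_inc h12.le lp, exp_inc h12.le lg, eH _ hRt1,
        eH _ hRt2]
      have a1 : J1 t1 - p ≠ 0 := fun h0 => hp1 ⟨t1, hI m1, sub_eq_zero.1 h0⟩
      have a2 := hgR _ hRt1
      have a3 := hgR _ hRt2
      field_simp
    obtain ⟨l, hl⟩ := Complex.exp_eq_exp_iff_exists_int.1 hex
    obtain ⟨k, hk, hk'⟩ := h.Wd_mem hg
    have hpG : p ∈ G := by
      rw [h.mem_iff hpK]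
      refine ⟨k + 2 * l, ?_, ?_⟩
      · rcases hk with rfl | rfl
        · exact ⟨l, by ring⟩
        · exact ⟨l - 1, by ring⟩
      · push_cast
        linear_combination hW + hk' + 2 * hl
    have hWW := Wd_eq_of_conn h.cyc (h.conn hpG hg)
    rw [hWW] at hW
    simp only [hH] at hW ⊢
    linear_combination -hW / 2

end HP

end

section
open Set Filter Topology Metric

namespace HP

theorem ulim {ι X : Type*} [TopologicalSpace X] (l : Ultrafilter ι) {S : Set X} (hS : IsCompact S)
    {x : ι → X} (hx : ∀ᶠ i in (l : Filter ι), x i ∈ S) :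
    ∃ a ∈ S, Tendsto x (l : Filter ι) (𝓝 a) := by
  obtain ⟨a, ha, h⟩ := hS.ultrafilter_le_nhds (l.map x) (by
    rw [le_principal_iff]; exact hx)
  exact ⟨a, ha, h⟩

structure Conv {ι : Type*} (l : Filter ι) (Gn : ι → Set ℂ) (J1n J2n J3n : ι → ℝ → ℂ)
    (G : Set ℂ) (J1 J2 J3 : ℝ → ℂ) : Prop where
  an : ∀ i, Adm (Gn i) (J1n i) (J2n i) (J3n i)
  a : Adm G J1 J2 J3
  u1 : TendstoUniformly J1n J1 l
  u2 : TendstoUniformly J2n J2 l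
  u3 : TendstoUniformly J3n J3 l

theorem ulim_arc {ι : Type*} (l : Ultrafilter ι) {Γ : ι → ℝ → ℂ} {γ : ℝ → ℂ} (hγ : Continuous γ)
    (hu : TendstoUniformly Γ γ l) {p : ι → ℂ} {q : ℂ} (hp : Tendsto p l (𝓝 q)) {s t : ι → ℝ}
    {s' t' : ℝ} (hs : Tendsto s l (𝓝 s')) (ht : Tendsto t l (𝓝 t'))
    (h : ∀ᶠ i in (l : Filter ι), ∃ x ∈ Icc (s i) (t i), Γ i x = p i) : q ∈ γ '' Icc s' t' := by
  obtain ⟨x, hx⟩ : ∃ x : ι → ℝ, ∀ᶠ i in (l : Filter ι), x i ∈ Icc (s i) (t i) ∧ Γ i (x i) = p i := by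
    classical
    refine ⟨fun i => if h : ∃ x ∈ Icc (s i) (t i), Γ i x = p i then h.choose else 0, ?_⟩
    filter_upwards [h] with i hi
    rw [dif_pos hi]
    exact hi.choose_spec
  have hb : ∀ᶠ i in (l : Filter ι), x i ∈ Icc (s' - 1) (t' + 1) := by
    filter_upwards [hx, hs.eventually (lt_mem_nhds (sub_one_lt s')),
      ht.eventually (gt_mem_nhds (lt_add_one t'))] with i h1 h2 h3
    exact ⟨h2.le.trans h1.1.1, h1.1.2.trans h3.le⟩
  obtain ⟨a, -, ha⟩ := ulim l isCompact_Icc hb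
  refine ⟨a, ⟨le_of_tendsto_of_tendsto hs ha (hx.mono fun i h => h.1.1),
    le_of_tendsto_of_tendsto ha ht (hx.mono fun i h => h.1.2)⟩, ?_⟩
  have h1 := hu.tendsto_comp hγ.continuousAt ha
  exact tendsto_nhds_unique (h1.congr' (hx.mono fun i h => h.2)) hp

theorem ev_avoid {ι : Type*} (l : Ultrafilter ι) {Γ : ι → ℝ → ℂ} {γ : ℝ → ℂ} (hγ : Continuous γ)
    (hu : TendstoUniformly Γ γ l) {p : ι → ℂ} {q : ℂ} (hp : Tendsto p l (𝓝 q)) {s t : ι → ℝ}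
    {s' t' : ℝ} (hs : Tendsto s l (𝓝 s')) (ht : Tendsto t l (𝓝 t')) (hq : q ∉ γ '' Icc s' t') :
    ∀ᶠ i in (l : Filter ι), ∀ x ∈ Icc (s i) (t i), Γ i x ≠ p i := by
  by_contra hcon
  rw [Filter.not_eventually, Ultrafilter.frequently_iff_eventually] at hcon
  refine hq (ulim_arc l hγ hu hp hs ht (hcon.mono fun i hi => ?_))
  push Not at hi
  exact hi

theorem utend_inc {ι : Type*} (l : Ultrafilter ι) {Γ : ι → ℝ → ℂ} {γ : ℝ → ℂ}
    (hΓ : ∀ i, Continuous (Γ i)) (hγ : Continuous γ)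
    (hu : TendstoUniformly Γ γ l) {p : ι → ℂ} {q : ℂ} (hp : Tendsto p l (𝓝 q)) {s t : ι → ℝ}
    {s' t' : ℝ} (hs : Tendsto s l (𝓝 s')) (ht : Tendsto t l (𝓝 t')) (hst : ∀ i, s i ≤ t i)
    (hq : q ∉ γ '' Icc s' t') :
    Tendsto (fun i => inc (fun x => Γ i x - p i) (s i) (t i)) l
      (𝓝 (inc (fun x => γ x - q) s' t')) :=
  tendsto_inc hΓ hγ hu hp hs ht hst
    (le_of_tendsto_of_tendsto hs ht (Eventually.of_forall hst)) (fun x hx e => hq ⟨x, hx, e⟩)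
    (ev_avoid l hγ hu hp hs ht hq)

theorem Wd_int {A B C : ℝ → ℂ} (h : Cyc A B C) {z : ℂ} (hz : z ∉ KK A B C) :
    ∃ l : ℤ, Wd A B C z = l * (2 * Real.pi * Complex.I) := by
  have : Complex.exp (Wd A B C z) = 1 := by
    rw [Wd, Complex.exp_add, Complex.exp_add,
      exp_inc zero_le_one (hasLog_sub h.cA zero_le_one fun hh => hz (sub_KK1 hh)),
      exp_inc zero_le_one (hasLog_sub h.cB zero_le_one fun hh => hz (sub_KK2 hh)),
      exp_inc zero_le_one (hasLog_sub h.cC zero_le_one fun hh => hz (sub_KK3 hh)), h.AB, h.BC, h.CA]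
    have a1 : A 0 - z ≠ 0 := fun h0 => hz (sub_eq_zero.1 h0 ▸ mem_KK1 zero_mem_I)
    have a2 : B 0 - z ≠ 0 := fun h0 => hz (sub_eq_zero.1 h0 ▸ mem_KK2 zero_mem_I)
    have a3 : C 0 - z ≠ 0 := fun h0 => hz (sub_eq_zero.1 h0 ▸ mem_KK3 zero_mem_I)
    field_simp
  exact Complex.exp_eq_one_iff.1 this

section
variable {ι : Type*} {l : Ultrafilter ι} {Gn : ι → Set ℂ} {J1n J2n J3n : ι → ℝ → ℂ}
  {G : Set ℂ} {J1 J2 J3 : ℝ → ℂ}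

theorem Conv.ev_notMem (h : Conv l Gn J1n J2n J3n G J1 J2 J3) {p : ι → ℂ} {q : ℂ}
    (hp : Tendsto p l (𝓝 q)) (hq : q ∉ KK J1 J2 J3) :
    ∀ᶠ i in (l : Filter ι), p i ∉ KK (J1n i) (J2n i) (J3n i) := by
  filter_upwards [ev_avoid l h.a.cyc.cA h.u1 hp tendsto_const_nhds tendsto_const_nhds
      (fun hh => hq (sub_KK1 hh)), ev_avoid l h.a.cyc.cB h.u2 hp tendsto_const_nhds tendsto_const_nhds
      (fun hh => hq (sub_KK2 hh)), ev_avoid l h.a.cyc.cC h.u3 hp tendsto_const_nhds tendsto_const_nhds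
      (fun hh => hq (sub_KK3 hh))] with i h1 h2 h3
  rintro ((⟨x, hx, e⟩ | ⟨x, hx, e⟩) | ⟨x, hx, e⟩)
  exacts [h1 x hx e, h2 x hx e, h3 x hx e]

theorem Conv.lim_KK (h : Conv l Gn J1n J2n J3n G J1 J2 J3) {p : ι → ℂ} {q : ℂ}
    (hp : Tendsto p l (𝓝 q)) (hK : ∀ᶠ i in (l : Filter ι), p i ∈ KK (J1n i) (J2n i) (J3n i)) :
    q ∈ KK J1 J2 J3 := by
  by_contra hq
  obtain ⟨i, h1, h2⟩ := ((h.ev_notMem hp hq).and hK).exists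
  exact h1 h2

theorem Conv.ev_mem_iff (h : Conv l Gn J1n J2n J3n G J1 J2 J3) {p : ι → ℂ} {q : ℂ}
    (hp : Tendsto p l (𝓝 q)) (hq : q ∉ KK J1 J2 J3) :
    ∀ᶠ i in (l : Filter ι), (p i ∈ Gn i ↔ q ∈ G) := by
  have hW : Tendsto (fun i => Wd (J1n i) (J2n i) (J3n i) (p i)) l (𝓝 (Wd J1 J2 J3 q)) := by
    refine (Tendsto.add (Tendsto.add ?_ ?_) ?_)
    · exact utend_inc l (fun i => (h.an i).cyc.cA) h.a.cyc.cA h.u1 hp tendsto_const_nhds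
        tendsto_const_nhds (fun _ => zero_le_one) (fun hh => hq (sub_KK1 hh))
    · exact utend_inc l (fun i => (h.an i).cyc.cB) h.a.cyc.cB h.u2 hp tendsto_const_nhds
        tendsto_const_nhds (fun _ => zero_le_one) (fun hh => hq (sub_KK2 hh))
    · exact utend_inc l (fun i => (h.an i).cyc.cC) h.a.cyc.cC h.u3 hp tendsto_const_nhds
        tendsto_const_nhds (fun _ => zero_le_one) (fun hh => hq (sub_KK3 hh))
  filter_upwards [h.ev_notMem hp hq, hW.eventually (Metric.ball_mem_nhds _ zero_lt_one)] with i hi hd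
  have : Wd (J1n i) (J2n i) (J3n i) (p i) = Wd J1 J2 J3 q := by
    obtain ⟨m, hm⟩ := Wd_int (h.an i).cyc hi
    obtain ⟨k, hk⟩ := Wd_int h.a.cyc hq
    rw [dist_eq_norm, hm, hk, ← sub_mul] at hd
    by_cases hmk : m = k
    · rw [hm, hk, hmk]
    exfalso
    have h1 : (1:ℝ) ≤ ‖(m:ℂ) - k‖ := by
      have : (m:ℂ) - k = ((m - k : ℤ) : ℂ) := by push_cast; ring
      rw [this, Complex.norm_intCast]
      exact_mod_cast Int.one_le_abs (sub_ne_zero.2 hmk)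
    have h2 : ‖(2 * Real.pi * Complex.I : ℂ)‖ = 2 * Real.pi := by
      simp [abs_of_pos Real.pi_pos]
    rw [norm_mul, h2] at hd
    nlinarith [Real.pi_gt_three]
  rw [(h.an i).mem_iff hi, h.a.mem_iff hq, this]

theorem Conv.ev_mem (h : Conv l Gn J1n J2n J3n G J1 J2 J3) {z0 : ℂ} (hz : z0 ∈ G) :
    ∀ᶠ i in (l : Filter ι), z0 ∈ Gn i := by
  filter_upwards [h.ev_mem_iff tendsto_const_nhds (disjoint_left.1 h.a.disj hz)] with i hi
  exact hi.2 hz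

/-- limits of points of the domains lie in the closure -/
theorem Conv.lim_closure (h : Conv l Gn J1n J2n J3n G J1 J2 J3) {p : ι → ℂ} {q : ℂ}
    (hp : Tendsto p l (𝓝 q)) (hG : ∀ᶠ i in (l : Filter ι), p i ∈ Gn i) : q ∈ closure G := by
  by_cases hq : q ∈ KK J1 J2 J3
  · rw [← h.a.fr] at hq; exact frontier_subset_closure hq
  · obtain ⟨i, h1, h2⟩ := ((h.ev_mem_iff hp hq).and hG).exists
    exact subset_closure (h1.1 h2)

/-- the domains are eventually uniformly bounded -/
theorem Conv.ev_bdd {l : Filter ι} (h : Conv l Gn J1n J2n J3n G J1 J2 J3) :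
    ∃ R : ℝ, 0 < R ∧ ∀ᶠ i in l, closure (Gn i) ⊆ ball 0 R := by
  obtain ⟨R, hR, hGR⟩ := h.a.exists_far
  have hKR : KK J1 J2 J3 ⊆ ball 0 R := h.a.fr ▸ frontier_subset_closure.trans hGR
  have hr1 : R < R + 1 := by linarith
  refine ⟨R + 1, by linarith, ?_⟩
  have hu1 := Metric.tendstoUniformly_iff.1 h.u1 1 one_pos
  have hu2 := Metric.tendstoUniformly_iff.1 h.u2 1 one_pos
  have hu3 := Metric.tendstoUniformly_iff.1 h.u3 1 one_pos
  filter_upwards [hu1, hu2, hu3] with i h1 h2 h3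
  have aux : ∀ a b : ℂ, a ∈ ball (0:ℂ) R → dist a b < 1 → b ∈ ball (0:ℂ) (R + 1) := by
    intro a b ha hab
    rw [mem_ball] at ha ⊢
    have := dist_triangle_left b 0 a
    linarith
  have hK : KK (J1n i) (J2n i) (J3n i) ⊆ ball 0 (R + 1) := by
    rintro _ ((⟨x, hx, rfl⟩ | ⟨x, hx, rfl⟩) | ⟨x, hx, rfl⟩)
    · exact aux _ _ (hKR (mem_KK1 hx)) (h1 x)
    · exact aux _ _ (hKR (mem_KK2 hx)) (h2 x)
    · exact aux _ _ (hKR (mem_KK3 hx)) (h3 x)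
  intro z hz
  by_contra hzn
  have hzK : z ∉ KK (J1n i) (J2n i) (J3n i) := fun hh => hzn (hK hh)
  have hzG : z ∈ Gn i := by
    rw [closure_eq_self_union_frontier, (h.an i).fr] at hz
    exact hz.resolve_right hzK
  obtain ⟨k, hk, hk'⟩ := (h.an i).Wd_mem hzG
  rw [Wd_far (h.an i).cyc (by linarith) hK (by simpa using hzn)] at hk'
  rcases mul_eq_zero.1 hk'.symm with h0 | h0
  · rcases hk with rfl | rfl <;> simp at h0
  · exact Complex.two_pi_I_ne_zero h0

end

end HP

end

section
open Set Filter Topology Metric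

namespace HP

theorem conn_far_at {K : Set ℂ} {m : ℂ} {R : ℝ} (hR : 0 < R) (hK : K ⊆ closedBall m R) {x y : ℂ}
    (hx : R < dist x m) (hy : R < dist y m) : Conn K x y := by
  refine ⟨(fun z => z + m) '' {z : ℂ | R < ‖z‖}, (isPreconnected_compl_closedBall hR).image _
    (by fun_prop), ?_, ⟨x - m, by simpa [dist_eq_norm] using hx, by simp⟩,
    ⟨y - m, by simpa [dist_eq_norm] using hy, by simp⟩⟩
  rw [disjoint_left]
  rintro _ ⟨z, hz, rfl⟩ hzK
  have := hK hzK
  rw [mem_closedBall, dist_eq_norm] at this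
  simp at this hz
  linarith

structure Cross (G K : Set ℂ) (z0 : ℂ) (C V : Set ℂ) (x y : ℂ) : Prop where
  cC : IsCompact C
  xC : x ∈ C
  yC : y ∈ C
  xK : x ∈ K
  yK : y ∈ K
  sub : C ∩ K ⊆ {x, y}
  pV : IsPreconnected V
  VG : V ⊆ G
  adj : (closure V ∩ C).Nonempty
  sep : ∀ v ∈ V, ¬ Conn (K ∪ C) v z0

theorem Cross.symm {G K : Set ℂ} {z0 : ℂ} {C V : Set ℂ} {x y : ℂ} (h : Cross G K z0 C V x y) :
    Cross G K z0 C V y x :=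
  ⟨h.cC, h.yC, h.xC, h.yK, h.xK, by rw [pair_comm]; exact h.sub, h.pV, h.VG, h.adj, h.sep⟩

theorem easy_conn {G : Set ℂ} {J1 J2 J3 : ℝ → ℂ} (h : Adm G J1 J2 J3) {C B : Set ℂ} {m : ℂ} {r : ℝ}
    (hr : 0 < r) (hC : IsCompact C) (hB : IsCompact B) (hBp : IsPreconnected B)
    (hBK : B ⊆ KK J1 J2 J3) (hCK : C ∩ KK J1 J2 J3 ⊆ B) (hCm : C ⊆ closedBall m r)
    (hBm : B ⊆ closedBall m r) {v z : ℂ} (hv : v ∈ G) (hz : z ∈ G) (hvm : r < dist v m)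
    (hzm : r < dist z m) : Conn (KK J1 J2 J3 ∪ C) v z := by
  have hi : (C ∪ B) ∩ KK J1 J2 J3 = B := by
    apply Subset.antisymm
    · rintro w ⟨hw | hw, hwK⟩
      · exact hCK ⟨hw, hwK⟩
      · exact hw
    · exact fun w hw => ⟨Or.inr hw, hBK hw⟩
  have := janiszewski (hC.union hB) h.cyc.compact (by rw [hi]; exact hBp)
    (conn_far_at hr (union_subset hCm hBm) hvm hzm) (h.conn hv hz)
  refine this.mono ?_
  rintro w (hw | hw)
  · exact Or.inr hw
  · exact Or.inl (Or.inl hw)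

def Shr {ι : Type*} (l : Filter ι) (S : ι → Set ℂ) (m : ℂ) : Prop :=
  ∀ r > 0, ∀ᶠ i in l, S i ⊆ closedBall m r

theorem Shr.union {ι : Type*} {l : Filter ι} {S T : ι → Set ℂ} {m : ℂ} (hS : Shr l S m)
    (hT : Shr l T m) : Shr l (fun i => S i ∪ T i) m := fun r hr => by
  filter_upwards [hS r hr, hT r hr] with i h1 h2 using union_subset h1 h2

theorem Shr.tendsto {ι : Type*} {l : Filter ι} {S : ι → Set ℂ} {m : ℂ} (hS : Shr l S m) {x : ι → ℂ}
    (hx : ∀ᶠ i in l, x i ∈ S i) : Tendsto x l (𝓝 m) := by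
  rw [Metric.tendsto_nhds]
  intro e he
  filter_upwards [hS (e / 2) (half_pos he), hx] with i h1 h2
  have := h1 h2
  rw [mem_closedBall] at this
  linarith

theorem shr_arc {ι : Type*} {l : Filter ι} {Γ : ι → ℝ → ℂ} {γ : ℝ → ℂ} (hγ : Continuous γ)
    (hu : TendstoUniformly Γ γ l) {s t : ι → ℝ} {s' : ℝ} (hs : Tendsto s l (𝓝 s'))
    (ht : Tendsto t l (𝓝 s')) : Shr l (fun i => Γ i '' Icc (s i) (t i)) (γ s') := by
  intro r hr
  obtain ⟨δ, hδ, hγδ⟩ := Metric.continuous_iff.1 hγ s' (r / 2) (half_pos hr)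
  filter_upwards [Metric.tendstoUniformly_iff.1 hu (r / 2) (half_pos hr),
    Metric.tendsto_nhds.1 hs δ hδ, Metric.tendsto_nhds.1 ht δ hδ] with i h1 h2 h3
  rintro _ ⟨x, hx, rfl⟩
  have h4 : dist x s' < δ := by
    rw [Real.dist_eq, abs_lt] at *
    constructor <;> linarith [hx.1, hx.2]
  have := dist_triangle_left (Γ i x) (γ s') (γ x)
  rw [mem_closedBall]
  linarith [h1 x, hγδ x h4]

section
variable {ι : Type*} {l : Ultrafilter ι} {Gn : ι → Set ℂ} {J1n J2n J3n : ι → ℝ → ℂ}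
  {G : Set ℂ} {J1 J2 J3 : ℝ → ℂ}

theorem Conv.easy (h : Conv l Gn J1n J2n J3n G J1 J2 J3) {z0 : ℂ} (hz0 : z0 ∈ G)
    {C V : ι → Set ℂ} {x y : ι → ℂ}
    (hX : ∀ᶠ i in (l : Filter ι), Cross (Gn i) (KK (J1n i) (J2n i) (J3n i)) z0 (C i) (V i) (x i) (y i))
    {m : ℂ} (hm : m ∈ KK J1 J2 J3) (hC : Shr l C m) {B : ι → Set ℂ} (hB : Shr l B m)
    (hB' : ∀ᶠ i in (l : Filter ι), IsCompact (B i) ∧ IsPreconnected (B i) ∧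
      B i ⊆ KK (J1n i) (J2n i) (J3n i) ∧ x i ∈ B i ∧ y i ∈ B i) : Shr l V m := by
  intro r0 hr0
  have hzm : 0 < dist z0 m := dist_pos.2 fun e => disjoint_left.1 h.a.disj hz0 (e ▸ hm)
  set r := min r0 (dist z0 m / 2) with hr
  have hr1 : 0 < r := lt_min hr0 (half_pos hzm)
  have hr2 : r < dist z0 m := (min_le_right _ _).trans_lt (half_lt_self hzm)
  filter_upwards [hX, hC r hr1, hB r hr1, hB', h.ev_mem hz0] with i hi hCi hBi hB'i hz
  intro v hv
  by_contra hcon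
  have hvm : r < dist v m := (min_le_left _ _).trans_lt (by simpa using hcon)
  refine hi.sep v hv (easy_conn (h.an i) hr1 hi.cC hB'i.1 hB'i.2.1 hB'i.2.2.1 ?_ hCi hBi
    (hi.VG hv) hz hvm hr2)
  intro w hw
  rcases hi.sub hw with rfl | rfl
  exacts [hB'i.2.2.2.1, hB'i.2.2.2.2]

end

/-- the partial windings -/
noncomputable def WA (J1 J2 : ℝ → ℂ) (s u : ℝ) (g : ℂ) : ℂ :=
  inc (fun x => J1 x - g) s 1 + inc (fun x => J2 x - g) 0 u

noncomputable def WB (J1 J2 J3 : ℝ → ℂ) (s u : ℝ) (g : ℂ) : ℂ :=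
  inc (fun x => J2 x - g) u 1 + inc (fun x => J3 x - g) 0 1 + inc (fun x => J1 x - g) 0 s

theorem inc_ratio {A : ℝ → ℂ} (hA : Continuous A) {v g : ℂ} {s t : ℝ} (hst : s ≤ t)
    {R : Set ℂ} {H : ℂ → ℂ} (cH : ContinuousOn H R)
    (eH : ∀ z ∈ R, Complex.exp (H z) = (z - v) / (z - g))
    (h1 : A '' Icc s t ⊆ R) (hv : v ∉ A '' Icc s t) (hg : g ∉ A '' Icc s t) :
    inc (fun x => A x - v) s t - inc (fun x => A x - g) s t = H (A t) - H (A s) := by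
  rw [← inc_div hst (hasLog_sub hA hst hv) (hasLog_sub hA hst hg)]
  exact inc_of_log (F := fun z => (z - v) / (z - g)) hst hA.continuousOn
    (fun x hx => h1 ⟨x, hx, rfl⟩) cH eH

theorem sub_Icc {A : ℝ → ℂ} {s t : ℝ} (hs : 0 ≤ s) (ht : t ≤ 1) : A '' Icc s t ⊆ A '' Icc 0 1 :=
  image_mono (Icc_subset_Icc hs ht)

theorem WA_diff {A B C : ℝ → ℂ} (h : Cyc A B C) {v g : ℂ} (hv : v ∉ KK A B C) (hg : g ∉ KK A B C)
    {s u : ℝ} (hs : s ∈ Icc (0:ℝ) 1) (hu : u ∈ Icc (0:ℝ) 1) {H : ℂ → ℂ}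
    (cH : ContinuousOn H (KK A B C))
    (eH : ∀ z ∈ KK A B C, Complex.exp (H z) = (z - v) / (z - g)) :
    WA A B s u v - WA A B s u g = H (B u) - H (A s) := by
  have s1 : A '' Icc s 1 ⊆ KK A B C := (sub_Icc hs.1 le_rfl).trans sub_KK1
  have s2 : B '' Icc 0 u ⊆ KK A B C := (sub_Icc le_rfl hu.2).trans sub_KK2
  have e1 := inc_ratio h.cA hs.2 cH eH s1 (fun hh => hv (s1 hh)) (fun hh => hg (s1 hh))
  have e2 := inc_ratio h.cB hu.1 cH eH s2 (fun hh => hv (s2 hh)) (fun hh => hg (s2 hh))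
  rw [← h.AB] at e2
  simp only [WA]
  linear_combination e1 + e2

theorem WB_diff {A B C : ℝ → ℂ} (h : Cyc A B C) {v g : ℂ} (hv : v ∉ KK A B C) (hg : g ∉ KK A B C)
    {s u : ℝ} (hs : s ∈ Icc (0:ℝ) 1) (hu : u ∈ Icc (0:ℝ) 1) {H : ℂ → ℂ}
    (cH : ContinuousOn H (KK A B C))
    (eH : ∀ z ∈ KK A B C, Complex.exp (H z) = (z - v) / (z - g)) :
    WB A B C s u v - WB A B C s u g = H (A s) - H (B u) := by
  have s1 : A '' Icc 0 s ⊆ KK A B C := (sub_Icc le_rfl hs.2).trans sub_KK1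
  have s2 : B '' Icc u 1 ⊆ KK A B C := (sub_Icc hu.1 le_rfl).trans sub_KK2
  have e1 := inc_ratio h.cA hs.1 cH eH s1 (fun hh => hv (s1 hh)) (fun hh => hg (s1 hh))
  have e2 := inc_ratio h.cB hu.2 cH eH s2 (fun hh => hv (s2 hh)) (fun hh => hg (s2 hh))
  have e3 := inc_ratio h.cC zero_le_one cH eH sub_KK3 (fun hh => hv (sub_KK3 hh))
    (fun hh => hg (sub_KK3 hh))
  rw [h.BC] at e2
  rw [h.CA] at e3
  simp only [WB]
  linear_combination e1 + e2 + e3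

/-- small logarithm on a small ball -/
theorem small_log {m v : ℂ} {r : ℝ} (hr : 0 < r) (hv : 2 * r ≤ dist v m) :
    ∃ k : ℂ → ℂ, ContinuousOn k (closedBall m r) ∧
      (∀ z ∈ closedBall m r, Complex.exp (k z) = (z - v) / (m - v)) ∧
      ∀ z ∈ closedBall m r, ‖k z‖ ≤ 3 / 4 := by
  have hne : m - v ≠ 0 := by
    intro h0
    rw [dist_comm, dist_eq_norm, h0, norm_zero] at hv
    linarith
  have hb : ∀ z ∈ closedBall m r, ‖(z - v) / (m - v) - 1‖ ≤ 1 / 2 := by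
    intro z hz
    have : (z - v) / (m - v) - 1 = (z - m) / (m - v) := by field_simp; ring
    rw [this, norm_div, div_le_iff₀ (norm_pos_iff.2 hne)]
    rw [mem_closedBall, dist_eq_norm] at hz
    rw [dist_comm, dist_eq_norm] at hv
    linarith
  have hs : ∀ z ∈ closedBall m r, (z - v) / (m - v) ∈ Complex.slitPlane := by
    intro z hz
    have := Complex.mem_slitPlane_of_norm_lt_one ((hb z hz).trans_lt (by norm_num))
    simpa using this
  refine ⟨fun z => Complex.log ((z - v) / (m - v)), ?_, ?_, ?_⟩
  · exact ContinuousOn.clog (by fun_prop) hs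
  · exact fun z hz => Complex.exp_log (Complex.slitPlane_ne_zero (hs z hz))
  · intro z hz
    have := Complex.norm_log_one_add_half_le_self (hb z hz)
    rw [add_sub_cancel] at this
    have := hb z hz
    linarith

theorem hard_conn {G : Set ℂ} {J1 J2 J3 : ℝ → ℂ} (h : Adm G J1 J2 J3) {C : Set ℂ} {m : ℂ} {r : ℝ}
    (hr : 0 < r) (hC : IsCompact C) (hCm : C ⊆ closedBall m r) {s u : ℝ} (hs : s ∈ Icc (0:ℝ) 1)
    (hu : u ∈ Icc (0:ℝ) 1) (hsub : C ∩ KK J1 J2 J3 ⊆ {J1 s, J2 u}) (hsC : J1 s ∈ C) (huC : J2 u ∈ C)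
    {v z : ℂ} (hv : v ∈ G) (hz : z ∈ G) (hvm : 2 * r ≤ dist v m) (hzm : 2 * r ≤ dist z m)
    (hn : ¬ Conn (KK J1 J2 J3 ∪ C) v z) :
    3 ≤ ‖WA J1 J2 s u v - WA J1 J2 s u z‖ ∧ 3 ≤ ‖WB J1 J2 J3 s u v - WB J1 J2 J3 s u z‖ := by
  have hvK := disjoint_left.1 h.disj hv
  have hzK := disjoint_left.1 h.disj hz
  obtain ⟨H, cH, eH⟩ := hasLog_of_conn h.cyc.compact.isClosed (h.conn hv hz)
  rw [WA_diff h.cyc hvK hzK hs hu cH eH, WB_diff h.cyc hvK hzK hs hu cH eH, norm_sub_rev (H (J1 s)),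
    and_self]
  by_contra hlt
  push Not at hlt
  obtain ⟨k1, c1, e1, b1⟩ := small_log hr hvm
  obtain ⟨k2, c2, e2, b2⟩ := small_log hr hzm
  have hne : ∀ {v}, 2 * r ≤ dist v m → m - v ≠ 0 := by
    intro v hv h0
    rw [dist_comm, dist_eq_norm, h0, norm_zero] at hv
    linarith
  have hvm0 := hne hvm
  have hzm0 := hne hzm
  set c0 := Complex.log ((m - v) / (m - z))
  have ec0 : Complex.exp c0 = (m - v) / (m - z) := Complex.exp_log (div_ne_zero hvm0 hzm0)
  have cK : ContinuousOn (fun w => k1 w - k2 w + c0) C := ((c1.sub c2).mono hCm).add continuousOn_const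
  have eK : ∀ w ∈ C, Complex.exp (k1 w - k2 w + c0) = (w - v) / (w - z) := by
    intro w hw
    rw [Complex.exp_add, Complex.exp_sub, e1 _ (hCm hw), e2 _ (hCm hw), ec0]
    have : w - z ≠ 0 := by
      intro h0
      have := hCm hw
      rw [sub_eq_zero.1 h0, mem_closedBall] at this
      linarith
    field_simp
  apply hn
  refine conn_of_hasLog (h.cyc.compact.union hC) ?_ ?_ (hasLog_union_of_eq h.cyc.compact.isClosed
    hC.isClosed cH cK eH eK (H (J1 s) - (k1 (J1 s) - k2 (J1 s) + c0)) ?_)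
  · rintro (hh | hh)
    · exact hvK hh
    · have := hCm hh
      rw [mem_closedBall] at this; linarith
  · rintro (hh | hh)
    · exact hzK hh
    · have := hCm hh
      rw [mem_closedBall] at this; linarith
  · rintro w ⟨hwK, hwC⟩
    rcases hsub ⟨hwC, hwK⟩ with rfl | hw
    · rfl
    rw [mem_singleton_iff] at hw
    subst hw
    have hsK : J1 s ∈ KK J1 J2 J3 := mem_KK1 hs
    have hx : Complex.exp (H (J2 u) - (k1 (J2 u) - k2 (J2 u) + c0)) =
        Complex.exp (H (J1 s) - (k1 (J1 s) - k2 (J1 s) + c0)) := by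
      rw [Complex.exp_sub, Complex.exp_sub, eH _ hwK, eK _ hwC, eH _ hsK, eK _ hsC,
        div_self, div_self]
      · refine div_ne_zero (fun h0 => ?_) (fun h0 => ?_)
        · exact hvK (sub_eq_zero.1 h0 ▸ hsK)
        · exact hzK (sub_eq_zero.1 h0 ▸ hsK)
      · refine div_ne_zero (fun h0 => ?_) (fun h0 => ?_)
        · exact hvK (sub_eq_zero.1 h0 ▸ hwK)
        · exact hzK (sub_eq_zero.1 h0 ▸ hwK)
    obtain ⟨n, hn'⟩ := Complex.exp_eq_exp_iff_exists_int.1 hx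
    have hnn : ‖(n:ℂ) * (2 * Real.pi * Complex.I)‖ < 6 := by
      have : (n:ℂ) * (2 * Real.pi * Complex.I) = (H (J2 u) - H (J1 s)) +
        (k1 (J1 s) - k1 (J2 u) + (k2 (J2 u) - k2 (J1 s))) := by linear_combination -hn'
      rw [this]
      have n1 := norm_add_le (H (J2 u) - H (J1 s)) (k1 (J1 s) - k1 (J2 u) + (k2 (J2 u) - k2 (J1 s)))
      have n2 := norm_add_le (k1 (J1 s) - k1 (J2 u)) (k2 (J2 u) - k2 (J1 s))
      have n3 := norm_sub_le (k1 (J1 s)) (k1 (J2 u))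
      have n4 := norm_sub_le (k2 (J2 u)) (k2 (J1 s))
      have := b1 _ (hCm hsC)
      have := b1 _ (hCm hwC)
      have := b2 _ (hCm hsC)
      have := b2 _ (hCm hwC)
      linarith
    have h2 : ‖(2 * Real.pi * Complex.I : ℂ)‖ = 2 * Real.pi := by
      simp [abs_of_pos Real.pi_pos]
    rw [norm_mul, h2, Complex.norm_intCast] at hnn
    have hn0 : n = 0 := by
      by_contra hn0
      have : (1:ℝ) ≤ |(n:ℝ)| := by exact_mod_cast Int.one_le_abs hn0
      nlinarith [Real.pi_gt_three]
    rw [hn', hn0]; simp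

end HP

end

section
open Set Filter Topology Metric

namespace HP

section
variable {ι : Type*} {l : Ultrafilter ι} {Gn : ι → Set ℂ} {J1n J2n J3n : ι → ℝ → ℂ}
  {G : Set ℂ} {J1 J2 J3 : ℝ → ℂ}

theorem const_closure {G : Set ℂ} {F : ℂ → ℂ} {p : ℂ} (hp : p ∈ closure G) (hF : ContinuousAt F p)
    {c : ℂ} (hc : ∀ g ∈ G, F g = c) : F p = c := by
  have h1 : (𝓝[G] p).NeBot := mem_closure_iff_nhdsWithin_neBot.1 hp
  have h2 : Tendsto F (𝓝[G] p) (𝓝 c) :=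
    tendsto_const_nhds.congr' (eventually_nhdsWithin_of_forall fun g hg => (hc g hg).symm)
  exact tendsto_nhds_unique (hF.mono_left nhdsWithin_le_nhds) h2

/-- limit points of the near sides lie on both partial boundaries -/
theorem Conv.lim_near (h : Conv l Gn J1n J2n J3n G J1 J2 J3) {z0 : ℂ} (hz0 : z0 ∈ G)
    {C V : ι → Set ℂ} {s u : ι → ℝ} (hs : ∀ i, s i ∈ Icc (0:ℝ) 1) (hu : ∀ i, u i ∈ Icc (0:ℝ) 1)
    (hX : ∀ᶠ i in (l : Filter ι), Cross (Gn i) (KK (J1n i) (J2n i) (J3n i)) z0 (C i) (V i)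
      (J1n i (s i)) (J2n i (u i)))
    {s' u' : ℝ} (hs' : Tendsto s l (𝓝 s')) (hu' : Tendsto u l (𝓝 u')) (hs0 : s' ∈ Ioo (0:ℝ) 1)
    (hu0 : u' ∈ Ioo (0:ℝ) 1) (he : J1 s' = J2 u') (hC : Shr l C (J1 s'))
    {v : ι → ℂ} (hv : ∀ᶠ i in (l : Filter ι), v i ∈ V i) {p : ℂ} (hp : Tendsto v l (𝓝 p))
    (hpm : p ≠ J1 s') :
    (∃ t ∈ Icc s' 1, ∃ τ ∈ Icc u' 1, J1 t = p ∧ J2 τ = p) ∨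
    (∃ t ∈ Icc 0 s', ∃ τ ∈ Icc 0 u', J1 t = p ∧ J2 τ = p) := by
  have hsI : s' ∈ Icc (0:ℝ) 1 := ⟨hs0.1.le, hs0.2.le⟩
  have huI : u' ∈ Icc (0:ℝ) 1 := ⟨hu0.1.le, hu0.2.le⟩
  have hzK := disjoint_left.1 h.a.disj hz0
  have hzm : 0 < dist z0 (J1 s') := dist_pos.2 fun e => hzK (e ▸ mem_KK1 hsI)
  have hpm' : 0 < dist p (J1 s') := dist_pos.2 hpm
  set r := min (dist z0 (J1 s') / 2) (dist p (J1 s') / 4) with hr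
  have hr1 : 0 < r := lt_min (by linarith) (by linarith)
  have hr2 : 2 * r ≤ dist z0 (J1 s') := by linarith [min_le_left (dist z0 (J1 s') / 2) (dist p (J1 s') / 4)]
  have hr3 : 2 * r < dist p (J1 s') := by linarith [min_le_right (dist z0 (J1 s') / 2) (dist p (J1 s') / 4)]
  have hd : ∀ᶠ i in (l : Filter ι), 2 * r < dist (v i) (J1 s') :=
    (hp.dist tendsto_const_nhds).eventually (lt_mem_nhds hr3)
  have hvG : ∀ᶠ i in (l : Filter ι), v i ∈ Gn i := by
    filter_upwards [hX, hv] with i h1 h2 using h1.VG h2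
  have hpG : p ∈ closure G := h.lim_closure hp hvG
  have hbig : ∀ᶠ i in (l : Filter ι),
      3 ≤ ‖WA (J1n i) (J2n i) (s i) (u i) (v i) - WA (J1n i) (J2n i) (s i) (u i) z0‖ ∧
      3 ≤ ‖WB (J1n i) (J2n i) (J3n i) (s i) (u i) (v i) - WB (J1n i) (J2n i) (J3n i) (s i) (u i) z0‖ := by
    filter_upwards [hX, hC r hr1, hd, hv, h.ev_mem hz0] with i h1 h2 h3 h4 h5
    exact hard_conn (h.an i) hr1 h1.cC h2 (hs i) (hu i) h1.sub h1.xC h1.yC (h1.VG h4) h5 h3.le hr2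
      (h1.sep _ h4)
  have sA1 : J1 '' Icc s' 1 ⊆ KK J1 J2 J3 := (sub_Icc hsI.1 le_rfl).trans sub_KK1
  have sA2 : J2 '' Icc 0 u' ⊆ KK J1 J2 J3 := (sub_Icc le_rfl huI.2).trans sub_KK2
  have sB1 : J1 '' Icc 0 s' ⊆ KK J1 J2 J3 := (sub_Icc le_rfl hsI.2).trans sub_KK1
  have sB2 : J2 '' Icc u' 1 ⊆ KK J1 J2 J3 := (sub_Icc huI.1 le_rfl).trans sub_KK2
  have constH : ∀ g ∈ G, WA J1 J2 s' u' g = WA J1 J2 s' u' z0 ∧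
      WB J1 J2 J3 s' u' g = WB J1 J2 J3 s' u' z0 := by
    intro g hg
    obtain ⟨H, cH, eH⟩ := hasLog_of_conn h.a.cyc.compact.isClosed (h.a.conn hg hz0)
    have e1 := WA_diff h.a.cyc (disjoint_left.1 h.a.disj hg) hzK hsI huI cH eH
    have e2 := WB_diff h.a.cyc (disjoint_left.1 h.a.disj hg) hzK hsI huI cH eH
    rw [he, sub_self, sub_eq_zero] at e1 e2
    exact ⟨e1, e2⟩
  have tA : ∀ {w : ι → ℂ} {q : ℂ}, Tendsto w l (𝓝 q) → q ∉ J1 '' Icc s' 1 → q ∉ J2 '' Icc 0 u' →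
      Tendsto (fun i => WA (J1n i) (J2n i) (s i) (u i) (w i)) l (𝓝 (WA J1 J2 s' u' q)) := by
    intro w q hw h1 h2
    exact (utend_inc l (fun i => (h.an i).cyc.cA) h.a.cyc.cA h.u1 hw hs' tendsto_const_nhds
      (fun i => (hs i).2) h1).add (utend_inc l (fun i => (h.an i).cyc.cB) h.a.cyc.cB h.u2 hw
      tendsto_const_nhds hu' (fun i => (hu i).1) h2)
  have tB : ∀ {w : ι → ℂ} {q : ℂ}, Tendsto w l (𝓝 q) → q ∉ J2 '' Icc u' 1 → q ∉ J3 '' Icc 0 1 →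
      q ∉ J1 '' Icc 0 s' →
      Tendsto (fun i => WB (J1n i) (J2n i) (J3n i) (s i) (u i) (w i)) l (𝓝 (WB J1 J2 J3 s' u' q)) := by
    intro w q hw h1 h2 h3
    exact ((utend_inc l (fun i => (h.an i).cyc.cB) h.a.cyc.cB h.u2 hw hu' tendsto_const_nhds
      (fun i => (hu i).2) h1).add (utend_inc l (fun i => (h.an i).cyc.cC) h.a.cyc.cC h.u3 hw
      tendsto_const_nhds tendsto_const_nhds (fun i => zero_le_one) h2)).add
      (utend_inc l (fun i => (h.an i).cyc.cA) h.a.cyc.cA h.u1 hw tendsto_const_nhds hs'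
      (fun i => (hs i).1) h3)
  have cA : p ∈ J1 '' Icc s' 1 ∨ p ∈ J2 '' Icc 0 u' := by
    by_contra hcon
    push Not at hcon
    have hc : ContinuousAt (WA J1 J2 s' u') p :=
      (continuousAt_inc h.a.cyc.cA hsI.2 hcon.1).add (continuousAt_inc h.a.cyc.cB huI.1 hcon.2)
    have e := const_closure hpG hc (fun g hg => (constH g hg).1)
    have t1 := ((tA hp hcon.1 hcon.2).sub (tA (w := fun _ => z0) tendsto_const_nhds
      (fun hh => hzK (sA1 hh)) (fun hh => hzK (sA2 hh)))).norm
    rw [e, sub_self, norm_zero] at t1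
    have := ge_of_tendsto t1 (hbig.mono fun i hi => hi.1)
    linarith
  have cB : (p ∈ J2 '' Icc u' 1 ∨ p ∈ J3 '' Icc 0 1) ∨ p ∈ J1 '' Icc 0 s' := by
    by_contra hcon
    push Not at hcon
    have hc : ContinuousAt (WB J1 J2 J3 s' u') p :=
      ((continuousAt_inc h.a.cyc.cB huI.2 hcon.1.1).add
        (continuousAt_inc h.a.cyc.cC zero_le_one hcon.1.2)).add
        (continuousAt_inc h.a.cyc.cA hsI.1 hcon.2)
    have e := const_closure hpG hc (fun g hg => (constH g hg).2)
    have t1 := ((tB hp hcon.1.1 hcon.1.2 hcon.2).sub (tB (w := fun _ => z0) tendsto_const_nhds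
      (fun hh => hzK (sB2 hh)) (fun hh => hzK (sub_KK3 hh)) (fun hh => hzK (sB1 hh)))).norm
    rw [e, sub_self, norm_zero] at t1
    have := ge_of_tendsto t1 (hbig.mono fun i hi => hi.2)
    linarith
  rcases cA with ⟨t, ht, et⟩ | ⟨t, ht, et⟩
  · have htI : t ∈ Icc (0:ℝ) 1 := ⟨hsI.1.trans ht.1, ht.2⟩
    rcases cB with (⟨τ, hτ, eτ⟩ | ⟨τ, hτ, eτ⟩) | ⟨τ, hτ, eτ⟩
    · exact Or.inl ⟨t, ht, τ, hτ, et, eτ⟩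
    · have := (h.a.int13 htI hτ (et.trans eτ.symm)).1
      linarith [ht.1, hs0.1]
    · have : t = τ := h.a.cyc.iA htI ⟨hτ.1, hτ.2.trans hsI.2⟩ (et.trans eτ.symm)
      subst this
      exact absurd (by rw [← et, le_antisymm hτ.2 ht.1]) hpm
  · have htI : t ∈ Icc (0:ℝ) 1 := ⟨ht.1, ht.2.trans huI.2⟩
    rcases cB with (⟨τ, hτ, eτ⟩ | ⟨τ, hτ, eτ⟩) | ⟨τ, hτ, eτ⟩
    · have : t = τ := h.a.cyc.iB htI ⟨huI.1.trans hτ.1, hτ.2⟩ (et.trans eτ.symm)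
      subst this
      exact absurd (by rw [← et, he, le_antisymm ht.2 hτ.1]) hpm
    · have := (h.a.int23 htI hτ (et.trans eτ.symm)).1
      linarith [ht.2, hu0.2]
    · exact Or.inr ⟨τ, hτ, t, ht, eτ, et⟩

/-- the hard case of the crosscut lemma -/
theorem Conv.hard (h : Conv l Gn J1n J2n J3n G J1 J2 J3) {z0 : ℂ} (hz0 : z0 ∈ G)
    {C V : ι → Set ℂ} {s u : ι → ℝ} (hs : ∀ i, s i ∈ Icc (0:ℝ) 1) (hu : ∀ i, u i ∈ Icc (0:ℝ) 1)
    (hX : ∀ᶠ i in (l : Filter ι), Cross (Gn i) (KK (J1n i) (J2n i) (J3n i)) z0 (C i) (V i)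
      (J1n i (s i)) (J2n i (u i)))
    {s' u' : ℝ} (hs' : Tendsto s l (𝓝 s')) (hu' : Tendsto u l (𝓝 u')) (hs0 : s' ∈ Ioo (0:ℝ) 1)
    (hu0 : u' ∈ Ioo (0:ℝ) 1) (he : J1 s' = J2 u') (hC : Shr l C (J1 s')) : Shr l V (J1 s') := by
  intro r hr
  by_contra hcon
  rw [Filter.not_eventually, Ultrafilter.frequently_iff_eventually] at hcon
  have hsI : s' ∈ Icc (0:ℝ) 1 := ⟨hs0.1.le, hs0.2.le⟩
  have huI : u' ∈ Icc (0:ℝ) 1 := ⟨hu0.1.le, hu0.2.le⟩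
  obtain ⟨R, hR, hbd⟩ := h.ev_bdd
  have pick : ∀ {P : ι → ℂ → Prop}, (∀ᶠ i in (l : Filter ι), ∃ w ∈ V i, P i w) →
      ∃ w : ι → ℂ, ∃ p, (∀ᶠ i in (l : Filter ι), w i ∈ V i ∧ P i (w i)) ∧ Tendsto w l (𝓝 p) := by
    intro P hP
    classical
    let w : ι → ℂ := fun i => if h : ∃ w ∈ V i, P i w then h.choose else 0
    have hw : ∀ᶠ i in (l : Filter ι), w i ∈ V i ∧ P i (w i) := by
      filter_upwards [hP] with i hi
      simp only [w, dif_pos hi]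
      exact hi.choose_spec
    obtain ⟨p, -, hp⟩ := ulim l (isCompact_closedBall (0:ℂ) R) (x := w) (by
      filter_upwards [hw, hbd, hX] with i h1 h2 h3
      exact ball_subset_closedBall (h2 (subset_closure (h3.VG h1.1))))
    exact ⟨w, p, hw, hp⟩
  obtain ⟨v, p, hv, hp⟩ := pick (P := fun i w => r < dist w (J1 s')) (by
    filter_upwards [hcon] with i hi
    obtain ⟨w, hw, hw'⟩ := not_subset.1 hi
    exact ⟨w, hw, by simpa using hw'⟩)
  have hpm : p ≠ J1 s' := by
    have := ge_of_tendsto (hp.dist (tendsto_const_nhds (x := J1 s'))) (hv.mono fun i hi => hi.2.le)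
    exact dist_pos.1 (hr.trans_le this)
  -- the lift
  have lift : ∀ {J : ℝ → ℂ}, Continuous J → InjOn J (Icc 0 1) → ∃ q : ℂ → ℝ, Continuous q ∧
      ∀ x ∈ Icc (0:ℝ) 1, q (J x) = x := by
    intro J hJ hi
    obtain ⟨g, cg, eg⟩ := arc_lift (u := fun x => (x:ℂ)) hJ.continuousOn hi (by fun_prop)
    obtain ⟨k, ck, ek⟩ := tietze (isCompact_arc hJ 0 1).isClosed cg
    refine ⟨fun z => (k z).re, Complex.continuous_re.comp ck, fun x hx => ?_⟩
    simp only
    rw [ek _ ⟨x, hx, rfl⟩, eg x hx, Complex.ofReal_re]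
  obtain ⟨q, cq, eq⟩ := lift h.a.cyc.cA h.a.cyc.iA
  obtain ⟨q2, cq2, eq2⟩ := lift h.a.cyc.cB h.a.cyc.iB
  have L := fun {v p} => h.lim_near hz0 hs hu hX hs' hu' hs0 hu0 he hC (v := v) (p := p)
  -- intermediate values
  have mid : ∀ t, t ∈ Ioo s' (q p) ∪ Ioo (q p) s' → ∃ w : ι → ℂ, ∃ p', (∀ᶠ i in (l : Filter ι),
      w i ∈ V i) ∧ Tendsto w l (𝓝 p') ∧ q p' = t := by
    intro t ht
    have hts : t ≠ s' := by rcases ht with ht | ht; exacts [ht.1.ne', ht.2.ne]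
    have near : ∀ᶠ i in (l : Filter ι), ∃ w ∈ V i, |q w - s'| < |t - s'| := by
      obtain ⟨ρ, hρ, hq⟩ := Metric.continuous_iff.1 cq (J1 s') |t - s'| (abs_pos.2 (sub_ne_zero.2 hts))
      filter_upwards [hX, hC (ρ / 2) (half_pos hρ)] with i h1 h2
      obtain ⟨c, hc1, hc2⟩ := h1.adj
      obtain ⟨w, hw, hwd⟩ := Metric.mem_closure_iff.1 hc1 (ρ / 2) (half_pos hρ)
      refine ⟨w, hw, ?_⟩
      have h3 := h2 hc2
      rw [mem_closedBall] at h3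
      have := hq w (by have := dist_triangle_left w (J1 s') c; linarith)
      rwa [eq _ hsI, Real.dist_eq] at this
    have hqv : Tendsto (fun i => q (v i)) l (𝓝 (q p)) := cq.continuousAt.tendsto.comp hp
    have : ∀ᶠ i in (l : Filter ι), ∃ w ∈ V i, q w = t := by
      rcases ht with ht | ht
      · filter_upwards [near, hv, hX, hqv.eventually (lt_mem_nhds ht.2)] with i ⟨w, hw, hwt⟩ h2 h3 h4
        have : q w ≤ t := by
          rw [abs_of_pos (sub_pos.2 ht.1), abs_lt] at hwt; linarith
        exact h3.pV.intermediate_value hw h2.1 cq.continuousOn ⟨this, h4.le⟩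
      · filter_upwards [near, hv, hX, hqv.eventually (gt_mem_nhds ht.1)] with i ⟨w, hw, hwt⟩ h2 h3 h4
        have : t ≤ q w := by
          rw [abs_of_neg (sub_neg.2 ht.2), abs_lt] at hwt; linarith
        exact h3.pV.intermediate_value h2.1 hw cq.continuousOn ⟨h4.le, this⟩
    obtain ⟨w, p', h1, h2⟩ := pick (P := fun i w => q w = t) this
    refine ⟨w, p', h1.mono fun i hi => hi.1, h2, ?_⟩
    have h3 : Tendsto (fun i => q (w i)) l (𝓝 (q p')) := cq.continuousAt.tendsto.comp h2
    exact tendsto_nhds_unique h3 (tendsto_const_nhds.congr' (h1.mono fun i hi => hi.2.symm))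
  have cυ : ∀ a b : ℝ, ContinuousOn (fun t => q2 (J1 t)) (Icc a b) := fun a b =>
    (cq2.comp h.a.cyc.cA).continuousOn
  rcases L (hv.mono fun i hi => hi.1) hp hpm with ⟨t0, ht0, τ0, hτ0, e0, e0'⟩ | ⟨t0, ht0, τ0, hτ0, e0, e0'⟩
  · have ht0I : t0 ∈ Icc (0:ℝ) 1 := ⟨hsI.1.trans ht0.1, ht0.2⟩
    have hqp : q p = t0 := by rw [← e0, eq _ ht0I]
    have hlt : s' < t0 := lt_of_le_of_ne ht0.1 fun e => hpm (by rw [← e0, e])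
    have key : ∀ t ∈ Icc s' t0, q2 (J1 t) ∈ Icc u' 1 ∧ J1 t = J2 (q2 (J1 t)) := by
      intro t ht
      have mk : ∀ τ ∈ Icc u' 1, J2 τ = J1 t → q2 (J1 t) ∈ Icc u' 1 ∧ J1 t = J2 (q2 (J1 t)) := by
        intro τ hτ e
        have : q2 (J1 t) = τ := by rw [← e, eq2 _ ⟨huI.1.trans hτ.1, hτ.2⟩]
        rw [this]; exact ⟨hτ, e.symm⟩
      rcases eq_or_lt_of_le ht.1 with rfl | h1
      · exact mk u' ⟨le_rfl, huI.2⟩ he.symm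
      rcases eq_or_lt_of_le ht.2 with rfl | h2
      · exact mk τ0 hτ0 (e0'.trans e0.symm)
      obtain ⟨w, p', hw, hp', hqp'⟩ := mid t (Or.inl ⟨h1, hqp ▸ h2⟩)
      have hne : p' ≠ J1 s' := fun e => by rw [e, eq _ hsI] at hqp'; exact h1.ne hqp'
      rcases L hw hp' hne with ⟨t1, ht1, τ1, hτ1, e1, e1'⟩ | ⟨t1, ht1, τ1, hτ1, e1, e1'⟩
      · have : t1 = t := by rw [← hqp', ← e1, eq _ ⟨hsI.1.trans ht1.1, ht1.2⟩]
        subst this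
        exact mk τ1 hτ1 (e1'.trans e1.symm)
      · have : t1 = t := by rw [← hqp', ← e1, eq _ ⟨ht1.1, ht1.2.trans hsI.2⟩]
        linarith [ht1.2]
    have hinj : InjOn (fun t => q2 (J1 t)) (Icc s' t0) := by
      intro a ha b hb hab
      apply h.a.cyc.iA ⟨hsI.1.trans ha.1, ha.2.trans ht0.2⟩ ⟨hsI.1.trans hb.1, hb.2.trans ht0.2⟩
      rw [(key a ha).2, (key b hb).2]; simp only at hab; rw [hab]
    rcases ContinuousOn.strictMonoOn_of_injOn_Icc' hlt.le (cυ _ _) hinj with hm | hm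
    · exact h.a.lemmaS hsI.1 hlt ht0.2 (cυ _ _) hm
        (fun t ht => ⟨huI.1.trans (key t ht).1.1, (key t ht).1.2⟩) (fun t ht => (key t ht).2)
    · have h1 := hm (left_mem_Icc.2 hlt.le) (right_mem_Icc.2 hlt.le) hlt
      simp only [he, eq2 _ huI] at h1
      linarith [(key t0 (right_mem_Icc.2 hlt.le)).1.1]
  · have ht0I : t0 ∈ Icc (0:ℝ) 1 := ⟨ht0.1, ht0.2.trans hsI.2⟩
    have hqp : q p = t0 := by rw [← e0, eq _ ht0I]
    have hlt : t0 < s' := lt_of_le_of_ne ht0.2 fun e => hpm (by rw [← e0, e])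
    have key : ∀ t ∈ Icc t0 s', q2 (J1 t) ∈ Icc 0 u' ∧ J1 t = J2 (q2 (J1 t)) := by
      intro t ht
      have mk : ∀ τ ∈ Icc 0 u', J2 τ = J1 t → q2 (J1 t) ∈ Icc 0 u' ∧ J1 t = J2 (q2 (J1 t)) := by
        intro τ hτ e
        have : q2 (J1 t) = τ := by rw [← e, eq2 _ ⟨hτ.1, hτ.2.trans huI.2⟩]
        rw [this]; exact ⟨hτ, e.symm⟩
      rcases eq_or_lt_of_le ht.2 with rfl | h1
      · exact mk u' ⟨huI.1, le_rfl⟩ he.symm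
      rcases eq_or_lt_of_le ht.1 with rfl | h2
      · exact mk τ0 hτ0 (e0'.trans e0.symm)
      obtain ⟨w, p', hw, hp', hqp'⟩ := mid t (Or.inr ⟨hqp ▸ h2, h1⟩)
      have hne : p' ≠ J1 s' := fun e => by rw [e, eq _ hsI] at hqp'; exact h1.ne' hqp'
      rcases L hw hp' hne with ⟨t1, ht1, τ1, hτ1, e1, e1'⟩ | ⟨t1, ht1, τ1, hτ1, e1, e1'⟩
      · have : t1 = t := by rw [← hqp', ← e1, eq _ ⟨hsI.1.trans ht1.1, ht1.2⟩]
        linarith [ht1.1]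
      · have : t1 = t := by rw [← hqp', ← e1, eq _ ⟨ht1.1, ht1.2.trans hsI.2⟩]
        subst this
        exact mk τ1 hτ1 (e1'.trans e1.symm)
    have hinj : InjOn (fun t => q2 (J1 t)) (Icc t0 s') := by
      intro a ha b hb hab
      apply h.a.cyc.iA ⟨ht0.1.trans ha.1, ha.2.trans hsI.2⟩ ⟨ht0.1.trans hb.1, hb.2.trans hsI.2⟩
      rw [(key a ha).2, (key b hb).2]; simp only at hab; rw [hab]
    rcases ContinuousOn.strictMonoOn_of_injOn_Icc' hlt.le (cυ _ _) hinj with hm | hm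
    · exact h.a.lemmaS ht0.1 hlt hsI.2 (cυ _ _) hm
        (fun t ht => ⟨(key t ht).1.1, (key t ht).1.2.trans huI.2⟩) (fun t ht => (key t ht).2)
    · have h1 := hm (left_mem_Icc.2 hlt.le) (right_mem_Icc.2 hlt.le) hlt
      simp only [he, eq2 _ huI] at h1
      linarith [(key t0 (left_mem_Icc.2 hlt.le)).1.2]

end
end HP

end

section
open Set Filter Topology Metric

namespace HP

section
variable {ι : Type*} {l : Ultrafilter ι} {Gn : ι → Set ℂ} {J1n J2n J3n : ι → ℝ → ℂ}
  {G : Set ℂ} {J1 J2 J3 : ℝ → ℂ}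

def Par (l : Ultrafilter ι) (Γ : ι → ℝ → ℂ) (γ : ℝ → ℂ) (x : ι → ℂ) (m : ℂ) : Prop :=
  ∃ (s : ι → ℝ) (s' : ℝ), (∀ i, s i ∈ Icc (0:ℝ) 1) ∧ s' ∈ Icc (0:ℝ) 1 ∧ Tendsto s l (𝓝 s') ∧
    (∀ᶠ i in (l : Filter ι), Γ i (s i) = x i) ∧ γ s' = m

theorem par_mk {Γ : ι → ℝ → ℂ} {γ : ℝ → ℂ} (hγ : Continuous γ)
    (hu : TendstoUniformly Γ γ l) {x : ι → ℂ} {m : ℂ} (hx : Tendsto x l (𝓝 m))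
    (h : ∀ᶠ i in (l : Filter ι), x i ∈ Γ i '' Icc 0 1) : Par l Γ γ x m := by
  classical
  let s : ι → ℝ := fun i => if h : x i ∈ Γ i '' Icc 0 1 then h.choose else 0
  have h1 : ∀ i, s i ∈ Icc (0:ℝ) 1 := by
    intro i
    by_cases hi : x i ∈ Γ i '' Icc 0 1
    · simp only [s, dif_pos hi]; exact hi.choose_spec.1
    · simp only [s, dif_neg hi]; exact zero_mem_I
  have h2 : ∀ᶠ i in (l : Filter ι), Γ i (s i) = x i := by
    filter_upwards [h] with i hi
    simp only [s, dif_pos hi]; exact hi.choose_spec.2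
  obtain ⟨s', hs', ht⟩ := ulim l isCompact_Icc (Eventually.of_forall h1)
  refine ⟨s, s', h1, hs', ht, h2, ?_⟩
  exact tendsto_nhds_unique ((hu.tendsto_comp hγ.continuousAt ht).congr' h2) hx

theorem Conv.same (h : Conv l Gn J1n J2n J3n G J1 J2 J3) {z0 : ℂ} (hz0 : z0 ∈ G)
    {C V : ι → Set ℂ} {x y : ι → ℂ}
    (hX : ∀ᶠ i in (l : Filter ι), Cross (Gn i) (KK (J1n i) (J2n i) (J3n i)) z0 (C i) (V i) (x i) (y i))
    {m : ℂ} (hm : m ∈ KK J1 J2 J3) (hC : Shr l C m) {Γ : ι → ℝ → ℂ} {γ : ℝ → ℂ} (hγ : Continuous γ)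
    (hΓ : ∀ i, Continuous (Γ i)) (hu : TendstoUniformly Γ γ l) (hi : InjOn γ (Icc 0 1))
    (hsub : ∀ i, Γ i '' Icc 0 1 ⊆ KK (J1n i) (J2n i) (J3n i))
    (px : Par l Γ γ x m) (py : Par l Γ γ y m) : Shr l V m := by
  obtain ⟨s, s', h1, h2, h3, h4, h5⟩ := px
  obtain ⟨t, t', k1, k2, k3, k4, k5⟩ := py
  have e : s' = t' := hi h2 k2 (h5.trans k5.symm)
  subst e
  have S := shr_arc hγ hu (s := fun i => min (s i) (t i)) (t := fun i => max (s i) (t i)) (s' := s')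
    (by simpa using h3.min k3) (by simpa using h3.max k3)
  rw [h5] at S
  refine h.easy hz0 hX hm hC S ?_
  filter_upwards [h4, k4] with i e1 e2
  refine ⟨isCompact_arc (hΓ i) _ _, isPreconnected_Icc.image _ (hΓ i).continuousOn,
    (sub_Icc (le_min (h1 i).1 (k1 i).1) (max_le (h1 i).2 (k1 i).2)).trans (hsub i),
    ⟨s i, ⟨min_le_left _ _, le_max_left _ _⟩, e1⟩, ⟨t i, ⟨min_le_right _ _, le_max_right _ _⟩, e2⟩⟩

/-- two consecutive arcs, meeting at `Γ i 1 = Δ i 0` -/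
theorem Conv.consec (h : Conv l Gn J1n J2n J3n G J1 J2 J3) {z0 : ℂ} (hz0 : z0 ∈ G)
    {C V : ι → Set ℂ} {x y : ι → ℂ}
    (hX : ∀ᶠ i in (l : Filter ι), Cross (Gn i) (KK (J1n i) (J2n i) (J3n i)) z0 (C i) (V i) (x i) (y i))
    {m : ℂ} (hm : m ∈ KK J1 J2 J3) (hC : Shr l C m) {Γ Δ : ι → ℝ → ℂ} {γ δ : ℝ → ℂ}
    (hγ : Continuous γ) (hδ : Continuous δ)
    (hΓ : ∀ i, Continuous (Γ i)) (hΔ : ∀ i, Continuous (Δ i)) (hu : TendstoUniformly Γ γ l)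
    (hv : TendstoUniformly Δ δ l) (hΓΔ : ∀ i, Γ i 1 = Δ i 0)
    (hsub : ∀ i, Γ i '' Icc 0 1 ⊆ KK (J1n i) (J2n i) (J3n i))
    (hsub' : ∀ i, Δ i '' Icc 0 1 ⊆ KK (J1n i) (J2n i) (J3n i)) {s t : ι → ℝ}
    (hs : ∀ i, s i ∈ Icc (0:ℝ) 1) (ht : ∀ i, t i ∈ Icc (0:ℝ) 1)
    (hs' : Tendsto s l (𝓝 1)) (ht' : Tendsto t l (𝓝 0)) (es : ∀ᶠ i in (l : Filter ι), Γ i (s i) = x i)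
    (et : ∀ᶠ i in (l : Filter ι), Δ i (t i) = y i) (em : γ 1 = m) (em' : δ 0 = m) : Shr l V m := by
  have S1 := shr_arc hγ hu (s := s) (t := fun _ => 1) hs' tendsto_const_nhds
  have S2 := shr_arc hδ hv (s := fun _ => 0) (t := t) tendsto_const_nhds ht'
  rw [em] at S1
  rw [em'] at S2
  refine h.easy hz0 hX hm hC (S1.union S2) ?_
  filter_upwards [es, et] with i e1 e2
  refine ⟨(isCompact_arc (hΓ i) _ _).union (isCompact_arc (hΔ i) _ _),
    (isPreconnected_Icc.image _ (hΓ i).continuousOn).union (Γ i 1) ⟨1, right_mem_Icc.2 (hs i).2, rfl⟩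
      ⟨0, left_mem_Icc.2 (ht i).1, (hΓΔ i).symm⟩ (isPreconnected_Icc.image _ (hΔ i).continuousOn),
    union_subset ((sub_Icc (hs i).1 le_rfl).trans (hsub i))
      ((sub_Icc le_rfl (ht i).2).trans (hsub' i)),
    Or.inl ⟨s i, left_mem_Icc.2 (hs i).2, e1⟩, Or.inr ⟨t i, right_mem_Icc.2 (ht i).1, e2⟩⟩

theorem Conv.crosscut (h : Conv l Gn J1n J2n J3n G J1 J2 J3) {z0 : ℂ} (hz0 : z0 ∈ G)
    {C V : ι → Set ℂ} {x y : ι → ℂ}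
    (hX : ∀ᶠ i in (l : Filter ι), Cross (Gn i) (KK (J1n i) (J2n i) (J3n i)) z0 (C i) (V i) (x i) (y i))
    {m : ℂ} (hC : Shr l C m) : Shr l V m := by
  have hx : Tendsto x l (𝓝 m) := hC.tendsto (hX.mono fun i hi => hi.xC)
  have hy : Tendsto y l (𝓝 m) := hC.tendsto (hX.mono fun i hi => hi.yC)
  have hm : m ∈ KK J1 J2 J3 := h.lim_KK hx (hX.mono fun i hi => hi.xK)
  have c1 := fun i => (h.an i).cyc.cA
  have c2 := fun i => (h.an i).cyc.cB
  have c3 := fun i => (h.an i).cyc.cC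
  have dist3 : ∀ {x : ι → ℂ}, Tendsto x l (𝓝 m) →
      (∀ᶠ i in (l : Filter ι), x i ∈ KK (J1n i) (J2n i) (J3n i)) →
      (Par l J1n J1 x m ∨ Par l J2n J2 x m) ∨ Par l J3n J3 x m := by
    intro x hx hK
    simp only [KK, mem_union] at hK
    rw [Ultrafilter.eventually_or, Ultrafilter.eventually_or] at hK
    exact hK.imp (Or.imp (par_mk h.a.cyc.cA h.u1 hx) (par_mk h.a.cyc.cB h.u2 hx))
      (par_mk h.a.cyc.cC h.u3 hx)
  have m12 : ∀ {x y : ι → ℂ}, (∀ᶠ i in (l : Filter ι),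
      Cross (Gn i) (KK (J1n i) (J2n i) (J3n i)) z0 (C i) (V i) (x i) (y i)) →
      Par l J1n J1 x m → Par l J2n J2 y m → Shr l V m := by
    rintro x y hX ⟨s, s', h1, h2, h3, h4, h5⟩ ⟨t, t', k1, k2, k3, k4, k5⟩
    have e := h5.trans k5.symm
    by_cases hs1 : s' = 1
    · subst hs1
      have ht0 : t' = 0 := h.a.cyc.iB k2 zero_mem_I (by rw [← e, h.a.cyc.AB])
      subst ht0
      exact h.consec hz0 hX hm hC h.a.cyc.cA h.a.cyc.cB c1 c2 h.u1 h.u2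
        (fun i => (h.an i).cyc.AB) (fun i => sub_KK1) (fun i => sub_KK2) h1 k1 h3 k3 h4 k4 h5 k5
    · have hs0 : s' ≠ 0 := by
        rintro rfl
        exact h.a.d_notMem ⟨t', k2, e.symm⟩
      have ht1 : t' ≠ 1 := by
        rintro rfl
        exact h.a.c_notMem ⟨s', h2, e⟩
      have ht0 : t' ≠ 0 := by
        rintro rfl
        exact hs1 (h.a.cyc.iA h2 one_mem_I (by rw [e, h.a.cyc.AB]))
      rw [← h5] at hC ⊢
      refine h.hard hz0 h1 k1 ?_ h3 k3 ⟨lt_of_le_of_ne h2.1 (Ne.symm hs0), lt_of_le_of_ne h2.2 hs1⟩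
        ⟨lt_of_le_of_ne k2.1 (Ne.symm ht0), lt_of_le_of_ne k2.2 ht1⟩ e hC
      filter_upwards [hX, h4, k4] with i a b c
      rw [b, c]; exact a
  have m31 : ∀ {x y : ι → ℂ}, (∀ᶠ i in (l : Filter ι),
      Cross (Gn i) (KK (J1n i) (J2n i) (J3n i)) z0 (C i) (V i) (x i) (y i)) →
      Par l J3n J3 x m → Par l J1n J1 y m → Shr l V m := by
    rintro x y hX ⟨s, s', h1, h2, h3, h4, h5⟩ ⟨t, t', k1, k2, k3, k4, k5⟩
    obtain ⟨e1, e2⟩ := h.a.int13 k2 h2 (k5.trans h5.symm)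
    subst e1 e2
    exact h.consec hz0 hX hm hC h.a.cyc.cC h.a.cyc.cA c3 c1 h.u3 h.u1
        (fun i => (h.an i).cyc.CA) (fun i => sub_KK3) (fun i => sub_KK1) h1 k1 h3 k3 h4 k4 h5 k5
  have m23 : ∀ {x y : ι → ℂ}, (∀ᶠ i in (l : Filter ι),
      Cross (Gn i) (KK (J1n i) (J2n i) (J3n i)) z0 (C i) (V i) (x i) (y i)) →
      Par l J2n J2 x m → Par l J3n J3 y m → Shr l V m := by
    rintro x y hX ⟨s, s', h1, h2, h3, h4, h5⟩ ⟨t, t', k1, k2, k3, k4, k5⟩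
    obtain ⟨e1, e2⟩ := h.a.int23 h2 k2 (h5.trans k5.symm)
    subst e1 e2
    exact h.consec hz0 hX hm hC h.a.cyc.cB h.a.cyc.cC c2 c3 h.u2 h.u3
        (fun i => (h.an i).cyc.BC) (fun i => sub_KK2) (fun i => sub_KK3) h1 k1 h3 k3 h4 k4 h5 k5
  have hX' := hX.mono fun i hi => hi.symm
  rcases dist3 hx (hX.mono fun i hi => hi.xK) with (px | px) | px <;>
  rcases dist3 hy (hX.mono fun i hi => hi.yK) with (py | py) | py
  · exact h.same hz0 hX hm hC h.a.cyc.cA c1 h.u1 h.a.cyc.iA (fun i => sub_KK1) px py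
  · exact m12 hX px py
  · exact m31 hX' py px
  · exact m12 hX' py px
  · exact h.same hz0 hX hm hC h.a.cyc.cB c2 h.u2 h.a.cyc.iB (fun i => sub_KK2) px py
  · exact m23 hX px py
  · exact m31 hX px py
  · exact m23 hX' py px
  · exact h.same hz0 hX hm hC h.a.cyc.cC c3 h.u3 h.a.cyc.iC (fun i => sub_KK3) px py

end

/-- the epsilon-delta form of the crosscut lemma -/
theorem Conv.crosscut_unif {Gn : ℕ → Set ℂ} {J1n J2n J3n : ℕ → ℝ → ℂ}
    {G : Set ℂ} {J1 J2 J3 : ℝ → ℂ} (h : Conv atTop Gn J1n J2n J3n G J1 J2 J3) {z0 : ℂ} (hz0 : z0 ∈ G)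
    {ε : ℝ} (hε : 0 < ε) : ∃ δ > 0, ∀ᶠ n in atTop, ∀ (C V : Set ℂ) (x y : ℂ),
      Cross (Gn n) (KK (J1n n) (J2n n) (J3n n)) z0 C V x y → C ⊆ closedBall x δ →
      V ⊆ closedBall x ε := by
  by_contra hcon
  push Not at hcon
  have key : ∀ k : ℕ, ∃ n ≥ k, ∃ (C V : Set ℂ) (x y : ℂ),
      Cross (Gn n) (KK (J1n n) (J2n n) (J3n n)) z0 C V x y ∧ C ⊆ closedBall x (1 / ((k:ℝ) + 1)) ∧
      ¬ V ⊆ closedBall x ε := by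
    intro k
    obtain ⟨n, hn, C, V, x, y, h1, h2, h3⟩ :=
      (Filter.frequently_atTop.1 (hcon (1 / ((k:ℝ) + 1)) (by positivity))) k
    exact ⟨n, hn, C, V, x, y, h1, h2, h3⟩
  choose n hn C V x y h1 h2 h3 using key
  have hnt : Tendsto n atTop atTop := tendsto_atTop_mono hn tendsto_id
  have hl : ((hyperfilter ℕ : Ultrafilter ℕ) : Filter ℕ) ≤ atTop := Nat.hyperfilter_le_atTop
  have hc : Conv (hyperfilter ℕ : Filter ℕ) (fun k => Gn (n k)) (fun k => J1n (n k)) (fun k => J2n (n k))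
      (fun k => J3n (n k)) G J1 J2 J3 :=
    ⟨fun k => h.an _, h.a, fun u hu => (hnt.mono_left hl).eventually (h.u1 u hu),
      fun u hu => (hnt.mono_left hl).eventually (h.u2 u hu),
      fun u hu => (hnt.mono_left hl).eventually (h.u3 u hu)⟩
  obtain ⟨R, hR, hbd⟩ := hc.ev_bdd
  obtain ⟨m, -, hm⟩ := ulim (hyperfilter ℕ) (isCompact_closedBall (0:ℂ) R) (x := x) (by
    filter_upwards [hbd] with k hk
    have := (h1 k).xK
    rw [← (h.an _).fr] at this
    exact ball_subset_closedBall (hk (frontier_subset_closure this)))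
  have hS : Shr (hyperfilter ℕ : Filter ℕ) C m := by
    intro r hr
    have h0 : Tendsto (fun k : ℕ => 1 / ((k:ℝ) + 1)) atTop (𝓝 0) := tendsto_one_div_add_atTop_nhds_zero_nat
    filter_upwards [Metric.tendsto_nhds.1 hm (r / 2) (half_pos hr),
      (h0.mono_left hl).eventually (gt_mem_nhds (half_pos hr))] with k a b
    intro w hw
    have := h2 k hw
    rw [mem_closedBall] at *
    linarith [dist_triangle w (x k) m]
  have hV := hc.crosscut hz0 (Eventually.of_forall h1) hS
  obtain ⟨k, a, b⟩ := ((hV (ε / 2) (half_pos hε)).and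
    (Metric.tendsto_nhds.1 hm (ε / 2) (half_pos hε))).exists
  refine h3 k fun w hw => ?_
  have := a hw
  rw [mem_closedBall] at *
  linarith [dist_triangle_right w (x k) m]

end HP

end

section
open Set Filter Topology Metric

namespace HP

open MeasureTheory in
lemma det_smulRight (c : ℂ) :
    ((ContinuousLinearMap.toSpanSingleton ℂ c).restrictScalars ℝ).det = ‖c‖^2 := by
  rw [ContinuousLinearMap.det]
  rw [← LinearMap.det_toMatrix Complex.basisOneI, Matrix.det_fin_two]
  simp [LinearMap.toMatrix_apply, Complex.sq_norm, Complex.normSq_apply]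

def Strip : Set ℂ := {w | 0 < w.im ∧ w.im < Real.pi}

lemma isOpen_Strip : IsOpen Strip :=
  (isOpen_lt continuous_const Complex.continuous_im).inter
    (isOpen_lt Complex.continuous_im continuous_const)

open MeasureTheory in
lemma area_le {g : ℂ → ℂ} (hg : DifferentiableOn ℂ g Strip) (hi : InjOn g Strip) {R : Set ℂ}
    (hR : MeasurableSet R) (hRS : R ⊆ Strip) :
    ∫⁻ w in R, ENNReal.ofReal (‖deriv g w‖^2) = volume (g '' R) := by
  rw [← lintegral_abs_det_fderiv_eq_addHaar_image (volume : Measure ℂ) hR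
    (f' := fun w => (ContinuousLinearMap.toSpanSingleton ℂ (deriv g w)).restrictScalars ℝ)
    (fun w hw => ?_) (hi.mono hRS)]
  · refine lintegral_congr fun w => ?_
    rw [det_smulRight, abs_of_nonneg (by positivity)]
  · have h1 : HasDerivAt g (deriv g w) w :=
      ((hg w (hRS hw)).differentiableAt (isOpen_Strip.mem_nhds (hRS hw))).hasDerivAt
    have h2 := h1.hasFDerivAt.restrictScalars ℝ
    exact h2.hasFDerivWithinAt

open MeasureTheory in
lemma fubini_rect {F : ℂ → ENNReal} {N : ℝ}
    (hF : AEMeasurable F (volume.restrict (Ioo (-N) 0 ×ℂ Ioo 0 Real.pi))) :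
    ∫⁻ w in (Ioo (-N) 0 ×ℂ Ioo 0 Real.pi), F w =
      ∫⁻ u in Ioo (-N) 0, ∫⁻ v in Ioo 0 Real.pi, F (u + v * Complex.I) := by
  have hp := Complex.volume_preserving_equiv_real_prod.symm
  have he := Complex.measurableEquivRealProd.symm.measurableEmbedding
  have hpre : Complex.measurableEquivRealProd.symm ⁻¹' (Ioo (-N) 0 ×ℂ Ioo 0 Real.pi) =
      Ioo (-N) 0 ×ˢ Ioo 0 Real.pi := by
    ext p; simp [Complex.mem_reProdIm, Complex.measurableEquivRealProd]
  rw [← hp.setLIntegral_comp_preimage_emb he F, hpre]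
  have hm : AEMeasurable (fun p => F (Complex.measurableEquivRealProd.symm p))
      ((volume : Measure (ℝ×ℝ)).restrict (Ioo (-N) 0 ×ˢ Ioo 0 Real.pi)) := by
    have := (hp.restrict_preimage_emb he (Ioo (-N) 0 ×ℂ Ioo 0 Real.pi))
    rw [hpre] at this
    exact hF.comp_quasiMeasurePreserving this.quasiMeasurePreserving
  rw [Measure.volume_eq_prod] at hm ⊢
  rw [setLIntegral_prod _ hm]
  refine lintegral_congr fun u => lintegral_congr fun v => ?_
  congr 1
  apply Complex.ext <;> simp [Complex.measurableEquivRealProd]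

open MeasureTheory in
lemma length_area1 {δ A : ℝ} (hδ : 0 < δ) (hA : 0 < A) : ∃ N : ℝ, 0 < N ∧ ∀ g : ℂ → ℂ,
    DifferentiableOn ℂ g Strip → InjOn g Strip → volume (g '' Strip) ≤ ENNReal.ofReal A →
    ∃ u ∈ Ioo (-N) 0,
      ∫⁻ v in Ioo 0 Real.pi, ENNReal.ofReal ‖deriv g (u + v * Complex.I)‖ ≤ ENNReal.ofReal δ := by
  have hpi := Real.pi_pos
  refine ⟨2 * A * Real.pi / δ^2, by positivity, fun g hg hi hv => ?_⟩
  set N := 2 * A * Real.pi / δ^2 with hN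
  have hNp : 0 < N := by positivity
  by_contra! hc
  set R : Set ℂ := Ioo (-N) 0 ×ℂ Ioo 0 Real.pi with hR
  have hRo : IsOpen R := isOpen_Ioo.reProdIm isOpen_Ioo
  have hRS : R ⊆ Strip := fun w hw => (Complex.mem_reProdIm.1 hw).2
  have hcont : ContinuousOn (deriv g) R :=
    ((hg.deriv isOpen_Strip).continuousOn).mono hRS
  have hm : AEMeasurable (fun w => ENNReal.ofReal ‖deriv g w‖) (volume.restrict R) :=
    (hcont.norm.aemeasurable hRo.measurableSet).ennreal_ofReal
  have hvolR : volume R = ENNReal.ofReal N * ENNReal.ofReal Real.pi := by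
    have := fubini_rect (F := fun _ => 1) (N := N) aemeasurable_const
    simpa [mul_comm] using this
  have h1 : ENNReal.ofReal (δ * N) ≤ ∫⁻ w in R, ENNReal.ofReal ‖deriv g w‖ := by
    rw [fubini_rect hm]
    calc ENNReal.ofReal (δ * N) = ∫⁻ u in Ioo (-N) 0, ENNReal.ofReal δ := by
          rw [setLIntegral_const, Real.volume_Ioo, ENNReal.ofReal_mul hδ.le]; simp
      _ ≤ _ := setLIntegral_mono' measurableSet_Ioo fun u hu => (hc u hu).le
  have h2 : ∫⁻ w in R, ENNReal.ofReal ‖deriv g w‖ ≤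
      ENNReal.ofReal (δ / Real.pi / 2 * (N * Real.pi) + Real.pi / (2 * δ) * A) := by
    calc ∫⁻ w in R, ENNReal.ofReal ‖deriv g w‖
        ≤ ∫⁻ w in R, (ENNReal.ofReal (δ / Real.pi / 2) +
          ENNReal.ofReal (Real.pi / (2 * δ)) * ENNReal.ofReal (‖deriv g w‖^2)) := by
          refine lintegral_mono fun w => ?_
          rw [← ENNReal.ofReal_mul (by positivity), ← ENNReal.ofReal_add (by positivity) (by positivity)]
          refine ENNReal.ofReal_le_ofReal ?_
          have : δ / Real.pi / 2 + Real.pi / (2*δ) * ‖deriv g w‖^2 - ‖deriv g w‖ =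
              Real.pi / (2*δ) * (‖deriv g w‖ - δ / Real.pi)^2 := by field_simp; ring
          have h' : 0 ≤ Real.pi / (2*δ) * (‖deriv g w‖ - δ / Real.pi)^2 := by positivity
          linarith
      _ = ENNReal.ofReal (δ / Real.pi / 2) * volume R +
          ENNReal.ofReal (Real.pi / (2 * δ)) * volume (g '' R) := by
          rw [lintegral_add_left measurable_const, setLIntegral_const,
            lintegral_const_mul' _ _ ENNReal.ofReal_ne_top, area_le hg hi hRo.measurableSet hRS]
      _ ≤ ENNReal.ofReal (δ / Real.pi / 2) * (ENNReal.ofReal N * ENNReal.ofReal Real.pi) +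
          ENNReal.ofReal (Real.pi / (2 * δ)) * ENNReal.ofReal A := by
          rw [hvolR]
          gcongr
          exact (measure_mono (image_mono hRS)).trans hv
      _ = _ := by
          rw [← ENNReal.ofReal_mul (by positivity), ← ENNReal.ofReal_mul (by positivity),
            ← ENNReal.ofReal_mul (by positivity), ← ENNReal.ofReal_add (by positivity) (by positivity)]
  have h3 := (ENNReal.ofReal_le_ofReal_iff (by positivity)).1 (h1.trans h2)
  have h4 : δ / Real.pi / 2 * (N * Real.pi) + Real.pi / (2 * δ) * A = δ * N - Real.pi * A / (2*δ) := by
    rw [hN]; field_simp; ring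
  rw [h4] at h3
  have : 0 < Real.pi * A / (2*δ) := by positivity
  linarith

end HP

end

section
open Set Filter Topology Metric

namespace HP

open MeasureTheory in
lemma length_area {δ A : ℝ} (hδ : 0 < δ) (hA : 0 < A) : ∃ N : ℝ, 0 < N ∧ ∀ g : ℂ → ℂ,
    DifferentiableOn ℂ g Strip → InjOn g Strip → volume (g '' Strip) ≤ ENNReal.ofReal A →
    ∃ u ∈ Ioo (-N) 0, ∃ Γ : ℝ → ℂ, ContinuousOn Γ (Icc 0 Real.pi) ∧
      (∀ v ∈ Ioo 0 Real.pi, Γ v = g (u + v * Complex.I)) ∧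
      ∀ v ∈ Icc 0 Real.pi, dist (Γ v) (Γ 0) ≤ δ := by
  have hpi := Real.pi_pos
  obtain ⟨N, hN, H⟩ := length_area1 hδ hA
  refine ⟨N, hN, fun g hg hi hv => ?_⟩
  obtain ⟨u, hu, hle⟩ := H g hg hi hv
  set k : ℝ → ℂ := fun v => deriv g (u + v * Complex.I) * Complex.I with hk
  have hmem : ∀ v ∈ Ioo 0 Real.pi, (u + v * Complex.I : ℂ) ∈ Strip := fun v hv => by
    simpa [Strip] using hv
  have hkc : ContinuousOn k (Ioo 0 Real.pi) := by
    refine ContinuousOn.mul ?_ continuousOn_const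
    exact (hg.deriv isOpen_Strip).continuousOn.comp (by fun_prop) hmem
  have hkn : ∀ v, ‖k v‖ = ‖deriv g (u + v * Complex.I)‖ := fun v => by simp [hk]
  have hkI : IntegrableOn k (Ioo 0 Real.pi) := by
    refine ⟨hkc.aestronglyMeasurable measurableSet_Ioo, ?_⟩
    rw [hasFiniteIntegral_iff_norm]
    simp_rw [hkn]
    exact hle.trans_lt ENNReal.ofReal_lt_top
  have hkI' : IntervalIntegrable k volume 0 Real.pi := by
    rw [intervalIntegrable_iff_integrableOn_Ioo_of_le hpi.le]; exact hkI
  have hder : ∀ v ∈ Ioo 0 Real.pi, HasDerivAt (fun v : ℝ => g (u + v * Complex.I)) (k v) v := by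
    intro v hv
    have h1 : HasDerivAt g (deriv g (u + v * Complex.I)) (u + v * Complex.I) :=
      ((hg _ (hmem v hv)).differentiableAt (isOpen_Strip.mem_nhds (hmem v hv))).hasDerivAt
    have h2 : HasDerivAt (fun v : ℝ => (u + v * Complex.I : ℂ)) Complex.I v := by
      simpa using ((Complex.ofRealCLM.hasDerivAt (x := v)).mul_const Complex.I).const_add (u:ℂ)
    exact h1.comp v h2
  have hII : ∀ {x y : ℝ}, x ∈ Icc 0 Real.pi → y ∈ Icc 0 Real.pi → IntervalIntegrable k volume x y :=
    fun {x y} hx hy => hkI'.mono_set (by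
      rw [uIcc_of_le hpi.le]; exact uIcc_subset_Icc hx hy)
  have hmid : Real.pi / 2 ∈ Icc 0 Real.pi := ⟨by linarith, by linarith⟩
  refine ⟨u, hu, fun v => g (u + (Real.pi/2 : ℝ) * Complex.I) + ∫ t in (Real.pi/2)..v, k t, ?_, ?_, ?_⟩
  · refine continuousOn_const.add ?_
    have := intervalIntegral.continuousOn_primitive_interval' hkI' (a := Real.pi/2)
      (by rw [uIcc_of_le hpi.le]; exact hmid)
    rwa [uIcc_of_le hpi.le] at this
  · intro v hv
    have hsub : uIcc (Real.pi/2) v ⊆ Ioo 0 Real.pi := by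
      refine (ordConnected_Ioo.uIcc_subset (by constructor <;> linarith) hv)
    have := intervalIntegral.integral_eq_sub_of_hasDerivAt (f := fun v : ℝ => g (u + v * Complex.I))
      (f' := k) (a := Real.pi/2) (b := v) (fun x hx => hder x (hsub hx))
      (hII hmid (Ioo_subset_Icc_self hv))
    beta_reduce; rw [this]; simp
  · intro v hv
    have h0 : (0:ℝ) ∈ Icc 0 Real.pi := ⟨le_rfl, hpi.le⟩
    rw [dist_eq_norm]
    have e : (g (u + (Real.pi/2 : ℝ) * Complex.I) + ∫ t in (Real.pi/2)..v, k t) -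
        (g (u + (Real.pi/2 : ℝ) * Complex.I) + ∫ t in (Real.pi/2)..0, k t) = ∫ t in (0:ℝ)..v, k t := by
      rw [add_sub_add_left_eq_sub,
        intervalIntegral.integral_interval_sub_left (hII hmid hv) (hII hmid h0)]
    rw [e]
    refine (intervalIntegral.norm_integral_le_integral_norm hv.1).trans ?_
    rw [intervalIntegral.integral_of_le hv.1, integral_Ioc_eq_integral_Ioo]
    calc ∫ t in Ioo 0 v, ‖k t‖ ≤ ∫ t in Ioo 0 Real.pi, ‖k t‖ :=
          setIntegral_mono_set hkI.norm (Eventually.of_forall fun _ => norm_nonneg _)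
            (Ioo_subset_Ioo_right hv.2).eventuallyLE
      _ ≤ δ := by
          rw [integral_norm_eq_lintegral_enorm hkI.1]
          refine ENNReal.toReal_le_of_le_ofReal hδ.le ?_
          refine le_trans (le_of_eq ?_) hle
          refine lintegral_congr fun v => ?_
          rw [← hkn, ofReal_norm]

end HP

end

section
open Set Filter Topology Metric

namespace HP

/-- the conformal map of the strip onto the disc sending `-∞` to `ζ` -/
noncomputable def EE (ζ w : ℂ) : ℂ := ζ * ((Complex.I - Complex.exp w) / (Complex.I + Complex.exp w))

theorem exp_im_pos {w : ℂ} (hw : w ∈ Strip) : 0 < (Complex.exp w).im := by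
  rw [Complex.exp_im]
  exact mul_pos (Real.exp_pos _) (Real.sin_pos_of_pos_of_lt_pi hw.1 hw.2)

theorem cay_den {τ : ℂ} (h : 0 ≤ τ.im) : Complex.I + τ ≠ 0 := by
  intro h0
  have := congrArg Complex.im h0
  simp at this
  linarith

theorem cay_sq (τ : ℂ) : ‖Complex.I + τ‖^2 - ‖Complex.I - τ‖^2 = 4 * τ.im := by
  simp only [← Complex.normSq_eq_norm_sq, Complex.normSq_apply]
  simp
  ring

theorem EE_mem {ζ w : ℂ} (hζ : ‖ζ‖ = 1) (hw : w ∈ Strip) : EE ζ w ∈ ball (0:ℂ) 1 := by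
  have h1 := exp_im_pos hw
  have h2 := cay_den h1.le
  rw [mem_ball_zero_iff, EE, norm_mul, hζ, one_mul, norm_div, div_lt_one (norm_pos_iff.2 h2)]
  have := cay_sq (Complex.exp w)
  exact lt_of_pow_lt_pow_left₀ 2 (norm_nonneg _) (by linarith)

theorem EE_norm_bdry {ζ w : ℂ} (hζ : ‖ζ‖ = 1) (hw : (Complex.exp w).im = 0) : ‖EE ζ w‖ = 1 := by
  have h2 := cay_den hw.ge
  rw [EE, norm_mul, hζ, one_mul, norm_div, div_eq_one_iff_eq (norm_ne_zero_iff.2 h2)]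
  have := cay_sq (Complex.exp w)
  rw [hw] at this
  exact (pow_left_inj₀ (norm_nonneg _) (norm_nonneg _) two_ne_zero).1 (by linarith)

theorem EE_diff {ζ w : ℂ} (hw : 0 ≤ (Complex.exp w).im) : DifferentiableAt ℂ (EE ζ) w := by
  unfold EE
  refine DifferentiableAt.const_mul (DifferentiableAt.fun_div (c := fun w => Complex.I - Complex.exp w)
    (d := fun w => Complex.I + Complex.exp w) ?_ ?_ (cay_den hw)) _ <;> fun_prop

theorem EE_inj {ζ : ℂ} (hζ : ‖ζ‖ = 1) : InjOn (EE ζ) Strip := by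
  intro w hw w' hw' h
  have hζ0 : ζ ≠ 0 := by rintro rfl; simp at hζ
  have h1 := cay_den (exp_im_pos hw).le
  have h2 := cay_den (exp_im_pos hw').le
  have h3 := mul_left_cancel₀ hζ0 h
  rw [div_eq_div_iff h1 h2] at h3
  have h4 : Complex.I * 2 * (Complex.exp w' - Complex.exp w) = 0 := by linear_combination h3
  have h5 : Complex.exp w = Complex.exp w' := by
    rcases mul_eq_zero.1 h4 with h | h
    · simp at h
    · exact (sub_eq_zero.1 h).symm
  have hp := Real.pi_pos
  exact Complex.exp_inj_of_neg_pi_lt_of_le_pi (by linarith [hw.1]) hw.2.le (by linarith [hw'.1]) hw'.2.le h5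

theorem EE_surj {ζ z : ℂ} (hζ : ‖ζ‖ = 1) (hz : z ∈ ball (0:ℂ) 1) :
    ∃ w ∈ Strip, EE ζ w = z ∧ ∀ ρ : ℝ, ρ < 1 → dist z ζ < ρ → w.re < Real.log ρ := by
  have hζ0 : ζ ≠ 0 := by rintro rfl; simp at hζ
  have hz1 : ‖z‖ < 1 := by simpa using hz
  have hne : z ≠ ζ := by rintro rfl; linarith
  have hne' : ζ + z ≠ 0 := by
    intro h
    have : ζ = -z := by linear_combination h
    rw [this, norm_neg] at hζ; linarith
  set τ := Complex.I * (ζ - z) / (ζ + z) with hτ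
  have hτ0 : τ ≠ 0 := div_ne_zero (mul_ne_zero Complex.I_ne_zero (sub_ne_zero.2 hne.symm)) hne'
  have him : 0 < τ.im := by
    have e : τ * Complex.normSq (ζ + z) = Complex.I * (ζ - z) * (starRingEnd ℂ) (ζ + z) := by
      rw [← Complex.mul_conj, hτ]; field_simp
    have e2 := congrArg Complex.im e
    have hn : Complex.normSq ζ = 1 := by rw [Complex.normSq_eq_norm_sq, hζ]; norm_num
    have hn2 : Complex.normSq z < 1 := by rw [Complex.normSq_eq_norm_sq]; nlinarith [norm_nonneg z]
    have e3 : τ.im * Complex.normSq (ζ + z) = Complex.normSq ζ - Complex.normSq z := by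
      simp [Complex.normSq_apply] at e2 ⊢
      linear_combination e2
    have hp := Complex.normSq_pos.2 hne'
    by_contra! hc
    nlinarith
  have hnorm : ∀ ρ : ℝ, ρ < 1 → dist z ζ < ρ → ‖τ‖ < ρ := by
    intro ρ hρ hd
    have h1 : ‖ζ - z‖ < ρ := by rwa [dist_comm, dist_eq_norm] at hd
    have h2 : 1 < ‖ζ + z‖ := by
      have : ζ + ζ = (ζ + z) + (ζ - z) := by ring
      have h3 := norm_add_le (ζ + z) (ζ - z)
      rw [← this, ← two_mul, norm_mul, hζ] at h3
      simp at h3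
      linarith
    rw [hτ, norm_div, norm_mul, Complex.norm_I, one_mul, div_lt_iff₀ (by linarith)]
    have := norm_nonneg (ζ - z)
    nlinarith
  have hexp : Complex.exp (Complex.log τ) = τ := Complex.exp_log hτ0
  refine ⟨Complex.log τ, ⟨?_, ?_⟩, ?_, ?_⟩
  · rw [Complex.log_im]
    rcases (Complex.arg_nonneg_iff.2 him.le).lt_or_eq with h | h
    · exact h
    · exact absurd (Complex.arg_eq_zero_iff.1 h.symm).2 him.ne'
  · rw [Complex.log_im]
    refine (Complex.arg_le_pi τ).lt_of_ne fun h => ?_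
    exact absurd (Complex.arg_eq_pi_iff.1 h).2 him.ne'
  · rw [EE, hexp, hτ]
    have hI : Complex.I + Complex.I * (ζ - z) / (ζ + z) ≠ 0 := cay_den him.le
    have : Complex.I + Complex.I * (ζ - z) / (ζ + z) = 2 * Complex.I * ζ / (ζ + z) := by field_simp; ring
    rw [this] at hI ⊢
    field_simp
    ring
  · intro ρ hρ hd
    rw [Complex.log_re]
    exact Real.log_lt_log (norm_pos_iff.2 hτ0) (hnorm ρ hρ hd)

end HP

end

section
open Set Filter Topology Metric

namespace HP

theorem EE_bdry_aux {G : Set ℂ} {φ : ℂ → ℂ} (h : IsRM φ G) {ζ : ℂ} (hζ : ‖ζ‖ = 1) {u v0 : ℝ}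
    {Γ : ℝ → ℂ} (hΓ : ContinuousOn Γ (Icc 0 Real.pi))
    (hg : ∀ v ∈ Ioo 0 Real.pi, Γ v = φ (EE ζ (u + v * Complex.I))) (hv0 : v0 ∈ Icc 0 Real.pi)
    (hs : Real.sin v0 = 0) : Γ v0 ∈ frontier G := by
  have hpi := Real.pi_pos
  have hmem : ∀ v ∈ Ioo 0 Real.pi, (u + v * Complex.I : ℂ) ∈ Strip := fun v hv => by
    simpa [Strip] using hv
  have hcl : v0 ∈ closure (Ioo 0 Real.pi) := by rwa [closure_Ioo hpi.ne]
  have : (𝓝[Ioo 0 Real.pi] v0).NeBot := mem_closure_iff_nhdsWithin_neBot.1 hcl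
  have ht : Tendsto Γ (𝓝[Ioo 0 Real.pi] v0) (𝓝 (Γ v0)) :=
    (hΓ v0 hv0).mono_left (nhdsWithin_mono _ Ioo_subset_Icc_self)
  rw [h.isOpen.frontier_eq]
  refine ⟨mem_closure_of_tendsto ht ?_, fun hG => ?_⟩
  · filter_upwards [self_mem_nhdsWithin] with v hv
    rw [hg v hv]
    exact h.mem (EE_mem hζ (hmem v hv))
  · obtain ⟨r, hr, hrG⟩ := Metric.nhds_basis_closedBall.mem_iff.1 (h.isOpen.mem_nhds hG)
    obtain ⟨ρ, h0, h1, hQ⟩ := h.exhaust (isCompact_closedBall (Γ v0) r) hrG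
    have hE : Tendsto (fun v : ℝ => ‖EE ζ (u + v * Complex.I)‖) (𝓝[Ioo 0 Real.pi] v0)
        (𝓝 1) := by
      have him : (Complex.exp (u + v0 * Complex.I)).im = 0 := by
        rw [Complex.exp_im]; simp [hs]
      rw [← EE_norm_bdry hζ him]
      have hc : ContinuousAt (fun v : ℝ => ‖EE ζ (u + v * Complex.I)‖) v0 := by
        refine ContinuousAt.norm (f := fun v : ℝ => EE ζ (u + v * Complex.I)) ?_
        refine ContinuousAt.comp (f := fun v : ℝ => (u + v * Complex.I : ℂ)) (g := EE ζ) ?_ (by fun_prop)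
        have hd := EE_diff (ζ := ζ) (w := u + v0 * Complex.I) (by rw [him])
        exact hd.continuousAt
      exact hc.tendsto.mono_left nhdsWithin_le_nhds
    have hev : ∀ᶠ v : ℝ in 𝓝[Ioo 0 Real.pi] v0, ‖EE ζ (u + v * Complex.I)‖ < ρ := by
      filter_upwards [self_mem_nhdsWithin, ht.eventually (closedBall_mem_nhds _ hr)] with v hv hb
      obtain ⟨z, hz, hze⟩ := hQ hb
      rw [hg v hv] at hze
      have := h.inj (ball_subset_ball h1.le hz) (EE_mem hζ (hmem v hv)) hze
      rw [← this]; simpa using hz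
    have := le_of_tendsto hE (hev.mono fun _ h => h.le)
    linarith

theorem EE_cross {G : Set ℂ} {φ : ℂ → ℂ} (h : IsRM φ G) {ζ : ℂ} (hζ : ‖ζ‖ = 1) {u : ℝ} (hu : u < 0)
    {Γ : ℝ → ℂ} (hΓ : ContinuousOn Γ (Icc 0 Real.pi))
    (hg : ∀ v ∈ Ioo 0 Real.pi, Γ v = φ (EE ζ (u + v * Complex.I))) :
    Cross G (frontier G) (φ 0) (Γ '' Icc 0 Real.pi)
      ((fun w => φ (EE ζ w)) '' (Strip ∩ {w | w.re < u})) (Γ 0) (Γ Real.pi) := by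
  have hpi := Real.pi_pos
  have h0 : (0:ℝ) ∈ Icc 0 Real.pi := ⟨le_rfl, hpi.le⟩
  have h1 : Real.pi ∈ Icc 0 Real.pi := ⟨hpi.le, le_rfl⟩
  have hmem : ∀ v ∈ Ioo 0 Real.pi, (u + v * Complex.I : ℂ) ∈ Strip := fun v hv => by
    simpa [Strip] using hv
  have hmap : MapsTo (EE ζ) Strip (ball 0 1) := fun w hw => EE_mem hζ hw
  have hd : DifferentiableOn ℂ (fun w => φ (EE ζ w)) Strip :=
    h.d.comp (fun w hw => (EE_diff (exp_im_pos hw).le).differentiableWithinAt) hmap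
  have hinj : InjOn (fun w => φ (EE ζ w)) Strip := h.inj.comp (EE_inj hζ) hmap
  have hconv : Convex ℝ Strip :=
    (convex_halfSpace_im_gt 0).inter (convex_halfSpace_im_lt Real.pi)
  have hmid : Real.pi/2 ∈ Ioo 0 Real.pi := ⟨by linarith, by linarith⟩
  refine ⟨isCompact_Icc.image_of_continuousOn hΓ, mem_image_of_mem _ h0, mem_image_of_mem _ h1,
    EE_bdry_aux h hζ hΓ hg h0 (by simp), EE_bdry_aux h hζ hΓ hg h1 (by simp), ?_, ?_, ?_, ?_, ?_⟩
  · rintro _ ⟨⟨v, hv, rfl⟩, hK⟩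
    rcases hv.1.eq_or_lt with e | e
    · left; rw [e]
    rcases hv.2.eq_or_lt with e' | e'
    · right; rw [e']; rfl
    exfalso
    rw [hg v ⟨e, e'⟩, h.isOpen.frontier_eq] at hK
    exact hK.2 (h.mem (hmap (hmem v ⟨e, e'⟩)))
  · refine IsPreconnected.image ?_ _ (hd.continuousOn.mono inter_subset_left)
    exact (hconv.inter (convex_halfSpace_re_lt u)).isPreconnected
  · rintro _ ⟨w, hw, rfl⟩
    exact h.mem (hmap hw.1)
  · refine ⟨Γ (Real.pi/2), ?_, mem_image_of_mem _ (Ioo_subset_Icc_self hmid)⟩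
    rw [hg _ hmid]
    have hcl : (u + (Real.pi/2:ℝ) * Complex.I : ℂ) ∈ closure (Strip ∩ {w | w.re < u}) := by
      have : Tendsto (fun t : ℝ => (t + (Real.pi/2:ℝ) * Complex.I : ℂ)) (𝓝[<] u)
          (𝓝 (u + (Real.pi/2:ℝ) * Complex.I)) := by
        refine Tendsto.mono_left ?_ nhdsWithin_le_nhds
        exact Continuous.tendsto (by fun_prop) u
      refine mem_closure_of_tendsto this ?_
      filter_upwards [self_mem_nhdsWithin] with t ht
      refine ⟨?_, ?_⟩
      · simpa [Strip] using hmid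
      · simpa using ht
    have hc : ContinuousAt (fun w => φ (EE ζ w)) (u + (Real.pi/2:ℝ) * Complex.I) :=
      hd.continuousOn.continuousAt (isOpen_Strip.mem_nhds (hmem _ hmid))
    exact hc.continuousWithinAt.mem_closure_image hcl
  · rintro _ ⟨w, hw, rfl⟩ ⟨T, hT, hdis, hwT, h0T⟩
    rw [disjoint_union_right] at hdis
    have hTG : T ⊆ G := subset_of_disj_frontier h.isOpen hT hdis.1 (h.mem (hmap hw.1)) hwT
    have hopen : ∀ V : Set ℂ, IsOpen V → IsOpen ((fun w => φ (EE ζ w)) '' (Strip ∩ V)) := fun V hV =>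
      isOpen_image_of_inj isOpen_Strip hd hinj (isOpen_Strip.inter hV) inter_subset_left
    have hcov : T ⊆ (fun w => φ (EE ζ w)) '' (Strip ∩ {w | w.re < u}) ∪
        (fun w => φ (EE ζ w)) '' (Strip ∩ {w | u < w.re}) := by
      intro t ht
      obtain ⟨z, hz, rfl⟩ := h.b.surjOn (hTG ht)
      obtain ⟨w', hw', rfl, -⟩ := EE_surj hζ hz
      rcases lt_trichotomy w'.re u with h' | h' | h'
      · exact Or.inl ⟨w', ⟨hw', h'⟩, rfl⟩
      · refine absurd ?_ (disjoint_left.1 hdis.2 ht)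
        refine ⟨w'.im, ⟨hw'.1.le, hw'.2.le⟩, ?_⟩
        rw [hg _ hw', ← h', Complex.re_add_im]
      · exact Or.inr ⟨w', ⟨hw', h'⟩, rfl⟩
    have hz0 : φ 0 ∈ (fun w => φ (EE ζ w)) '' (Strip ∩ {w | u < w.re}) := by
      refine ⟨(Real.pi/2:ℝ) * Complex.I, ⟨?_, ?_⟩, ?_⟩
      · simpa [Strip] using hmid
      · simpa using hu
      · have : Complex.exp ((Real.pi/2:ℝ) * Complex.I) = Complex.I := by
          push_cast; exact Complex.exp_pi_div_two_mul_I
        simp only [EE, this]; simp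
    obtain ⟨t, ht, ⟨w1, hw1, e1⟩, ⟨w2, hw2, e2⟩⟩ := hT _ _
      (hopen _ (isOpen_lt Complex.continuous_re continuous_const))
      (hopen _ (isOpen_lt continuous_const Complex.continuous_re)) hcov ⟨_, hwT, w, hw, rfl⟩ ⟨_, h0T, hz0⟩
    have := hinj hw1.1 hw2.1 (e1.trans e2.symm)
    subst this
    exact lt_asymm (show w1.re < u from hw1.2) hw2.2

/-- uniform boundary estimate -/
theorem Conv.bdry_osc {Gn : ℕ → Set ℂ} {J1n J2n J3n : ℕ → ℝ → ℂ}
    {G : Set ℂ} {J1 J2 J3 : ℝ → ℂ} (h : Conv atTop Gn J1n J2n J3n G J1 J2 J3) {z0 : ℂ} (hz0 : z0 ∈ G)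
    {ε : ℝ} (hε : 0 < ε) : ∃ ρ > 0, ∀ᶠ n in atTop, ∀ φ, IsRM φ (Gn n) → φ 0 = z0 →
      ∀ ζ : ℂ, ‖ζ‖ = 1 → ∃ x, ∀ z ∈ ball (0:ℂ) 1, dist z ζ < ρ → dist (φ z) x ≤ ε := by
  obtain ⟨δ, hδ, H⟩ := h.crosscut_unif hz0 hε
  obtain ⟨R, hR, hbd⟩ := h.ev_bdd
  set A : ℝ := (MeasureTheory.volume (ball (0:ℂ) R)).toReal with hA
  have hAt : MeasureTheory.volume (ball (0:ℂ) R) ≠ ⊤ := MeasureTheory.measure_ball_lt_top.ne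
  have hA0 : 0 < A := ENNReal.toReal_pos (measure_ball_pos _ _ hR).ne' hAt
  obtain ⟨N, hN, L⟩ := length_area hδ hA0
  have hρ1 : Real.exp (-N) < 1 := by rw [Real.exp_lt_one_iff]; linarith
  refine ⟨Real.exp (-N), Real.exp_pos _, ?_⟩
  filter_upwards [H, hbd] with n Hn hbn φ hφ hφ0 ζ hζ
  have hmap : MapsTo (EE ζ) Strip (ball 0 1) := fun w hw => EE_mem hζ hw
  have hd : DifferentiableOn ℂ (fun w => φ (EE ζ w)) Strip :=
    hφ.d.comp (fun w hw => (EE_diff (exp_im_pos hw).le).differentiableWithinAt) hmap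
  have hinj : InjOn (fun w => φ (EE ζ w)) Strip := hφ.inj.comp (EE_inj hζ) hmap
  have hvol : MeasureTheory.volume ((fun w => φ (EE ζ w)) '' Strip) ≤ ENNReal.ofReal A := by
    rw [hA, ENNReal.ofReal_toReal hAt]
    refine MeasureTheory.measure_mono ?_
    rintro _ ⟨w, hw, rfl⟩
    exact hbn (subset_closure (hφ.mem (hmap hw)))
  obtain ⟨u, hu, Γ, hΓ, hg, hδΓ⟩ := L _ hd hinj hvol
  have hcr := EE_cross hφ hζ hu.2 hΓ hg
  rw [hφ0, (h.an n).fr] at hcr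
  have hV := Hn _ _ _ _ hcr (by rintro _ ⟨v, hv, rfl⟩; exact hδΓ v hv)
  refine ⟨Γ 0, fun z hz hdz => ?_⟩
  obtain ⟨w, hw, rfl, hre⟩ := EE_surj hζ hz
  have := hre _ hρ1 hdz
  rw [Real.log_exp] at this
  exact hV ⟨w, ⟨hw, this.trans hu.1⟩, rfl⟩

end HP

end

section
open Set Filter Topology Metric

namespace HP

theorem Conv.equi {Gn : ℕ → Set ℂ} {J1n J2n J3n : ℕ → ℝ → ℂ}
    {G : Set ℂ} {J1 J2 J3 : ℝ → ℂ} (h : Conv atTop Gn J1n J2n J3n G J1 J2 J3) {z0 : ℂ} (hz0 : z0 ∈ G)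
    {ε : ℝ} (hε : 0 < ε) : ∃ δ > 0, ∀ᶠ n in atTop, ∀ φ, IsRM φ (Gn n) → φ 0 = z0 →
      ∀ z ∈ ball (0:ℂ) 1, ∀ z' ∈ ball (0:ℂ) 1, dist z' z < δ → dist (φ z') (φ z) ≤ ε := by
  obtain ⟨ρ0, hρ0, H⟩ := h.bdry_osc hz0 (half_pos hε)
  obtain ⟨R, hR, hbd⟩ := h.ev_bdd
  obtain ⟨ρ, hρ, hρρ, hρ1⟩ : ∃ ρ : ℝ, 0 < ρ ∧ ρ ≤ ρ0 ∧ ρ ≤ 1 :=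
    ⟨min ρ0 1, lt_min hρ0 one_pos, min_le_left _ _, min_le_right _ _⟩
  refine ⟨min (ρ/2) (ε * (ρ/2) / (3*R)), lt_min (by positivity) (by positivity), ?_⟩
  filter_upwards [H, hbd] with n Hn hbn φ hφ hφ0 z hz z' hz' hd
  have hz1 : ‖z‖ < 1 := by simpa using hz
  have hd1 := hd.trans_le (min_le_left _ _)
  have hd2 := hd.trans_le (min_le_right _ _)
  rcases lt_or_ge ‖z‖ (1 - ρ/2) with hlt | hge
  · have hsub : ball z (ρ/2) ⊆ ball (0:ℂ) 1 := by
      intro w hw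
      rw [mem_ball] at hw ⊢
      have := dist_triangle w z 0
      rw [dist_zero_right z] at this
      linarith
    have := lipschitz_of_bound (half_pos hρ) hR (hφ.d.mono hsub)
      (fun w hw => (mem_ball_zero_iff.1 (hbn (subset_closure (hφ.mem (hsub hw))))).le) (w := z') hd1
    refine this.trans ?_
    have h3 : 3 * R / (ρ/2) * dist z' z ≤ 3 * R / (ρ/2) * (ε * (ρ/2) / (3*R)) := by gcongr
    refine h3.trans (le_of_eq ?_)
    field_simp
  · have hz0' : 0 < ‖z‖ := by linarith
    set ζ : ℂ := z / ‖z‖ with hζ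
    have hζ1 : ‖ζ‖ = 1 := by rw [hζ, norm_div]; simp [hz0'.ne']
    have hzζ : dist z ζ ≤ ρ/2 := by
      have e : z - ζ = ((‖z‖ - 1 : ℝ) : ℂ) * ζ := by
        have : (‖z‖ : ℂ) ≠ 0 := by exact_mod_cast hz0'.ne'
        rw [hζ]; push_cast; field_simp
      rw [dist_eq_norm, e, norm_mul, hζ1, mul_one, Complex.norm_real, Real.norm_eq_abs, abs_le]
      constructor <;> linarith
    obtain ⟨x, hx⟩ := Hn φ hφ hφ0 ζ hζ1
    have a1 := hx z hz (by linarith)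
    have a2 := hx z' hz' (by linarith [dist_triangle z' z ζ])
    linarith [dist_triangle_right (φ z') (φ z) x]

theorem Adm.const {G : Set ℂ} {J1 J2 J3 : ℝ → ℂ} (h : Adm G J1 J2 J3) :
    Conv (atTop : Filter ℕ) (fun _ => G) (fun _ => J1) (fun _ => J2) (fun _ => J3) G J1 J2 J3 := by
  refine ⟨fun _ => h, h, ?_, ?_, ?_⟩ <;>
  · rw [Metric.tendstoUniformly_iff]
    intro ε hε
    simp [hε]

theorem Adm.unifCont {G : Set ℂ} {J1 J2 J3 : ℝ → ℂ} (h : Adm G J1 J2 J3) {φ : ℂ → ℂ}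
    (hφ : IsRM φ G) : UniformContinuousOn φ (ball 0 1) := by
  rw [Metric.uniformContinuousOn_iff_le]
  intro ε hε
  obtain ⟨δ, hδ, H⟩ := h.const.equi (hφ.mem (mem_ball_self one_pos)) hε
  obtain ⟨n, hn⟩ := H.exists
  exact ⟨δ/2, half_pos hδ, fun x hx y hy hxy => hn φ hφ rfl y hy x hx (by linarith)⟩

theorem IsRM.congr {φ ψ : ℂ → ℂ} {G : Set ℂ} (h : IsRM φ G) (he : EqOn ψ φ (ball 0 1)) : IsRM ψ G :=
  ⟨h.d.congr he, h.b.congr he.symm⟩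

theorem Adm.exists_ext {G : Set ℂ} {J1 J2 J3 : ℝ → ℂ} (h : Adm G J1 J2 J3) {φ : ℂ → ℂ}
    (hφ : IsRM φ G) : ∃ Φ, IsRM Φ G ∧ ContinuousOn Φ (closedBall 0 1) ∧ EqOn Φ φ (ball 0 1) := by
  have he : EqOn (extendFrom (ball (0:ℂ) 1) φ) φ (ball 0 1) := extendFrom_extends hφ.d.continuousOn
  refine ⟨extendFrom (ball 0 1) φ, hφ.congr he, ?_, he⟩
  have hcl : closedBall (0:ℂ) 1 ⊆ closure (ball 0 1) := by rw [closure_ball _ one_ne_zero]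
  refine continuousOn_extendFrom hcl fun x hx => ?_
  have : (𝓝[ball (0:ℂ) 1] x).NeBot := mem_closure_iff_nhdsWithin_neBot.1 (hcl hx)
  have hc : Cauchy (𝓝[ball (0:ℂ) 1] x) := cauchy_nhds.mono nhdsWithin_le_nhds
  exact CompleteSpace.complete (hc.map_of_le (h.unifCont hφ) inf_le_right)

end HP

end

section
open Set Filter Topology Metric

namespace HP

section
variable {ι : Type*} {l : Ultrafilter ι} {Gn : ι → Set ℂ} {J1n J2n J3n : ι → ℝ → ℂ}
  {G : Set ℂ} {J1 J2 J3 : ℝ → ℂ}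

theorem Conv.ev_subset (h : Conv l Gn J1n J2n J3n G J1 J2 J3) {Q : Set ℂ} (hQ : IsCompact Q)
    (hQG : Q ⊆ G) : ∀ᶠ i in (l : Filter ι), Q ⊆ Gn i := by
  by_contra hc
  rw [← Ultrafilter.eventually_not] at hc
  obtain ⟨p, hp⟩ : ∃ p : ι → ℂ, ∀ᶠ i in (l : Filter ι), p i ∈ Q ∧ p i ∉ Gn i := by
    have hc' : ∀ᶠ i in (l : Filter ι), ∃ x, x ∈ Q ∧ x ∉ Gn i := hc.mono fun i hi => not_subset.1 hi
    exact hc'.choice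
  obtain ⟨q, hq, hpq⟩ := ulim l hQ (hp.mono fun i hi => hi.1)
  obtain ⟨i, h1, h2⟩ := ((h.ev_mem_iff hpq (disjoint_left.1 h.a.disj (hQG hq))).and hp).exists
  exact h2.2 (h1.2 (hQG hq))

/-- points of the limit boundary are limits of boundary points -/
theorem Conv.approx_KK {l : Filter ι} (h : Conv l Gn J1n J2n J3n G J1 J2 J3) {k : ℂ}
    (hk : k ∈ KK J1 J2 J3) :
    ∃ kn : ι → ℂ, (∀ i, kn i ∈ KK (J1n i) (J2n i) (J3n i)) ∧ Tendsto kn l (𝓝 k) := by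
  rcases hk with (⟨x, hx, rfl⟩ | ⟨x, hx, rfl⟩) | ⟨x, hx, rfl⟩
  · exact ⟨fun i => J1n i x, fun i => mem_KK1 hx, h.u1.tendsto_at x⟩
  · exact ⟨fun i => J2n i x, fun i => mem_KK2 hx, h.u2.tendsto_at x⟩
  · exact ⟨fun i => J3n i x, fun i => mem_KK3 hx, h.u3.tendsto_at x⟩

theorem rm_deriv_compare {H G : Set ℂ} {χ φ : ℂ → ℂ} (hχ : IsRM χ H) (hφ : IsRM φ G) {ρ : ℝ}
    (hρ : 0 < ρ) (hρ1 : ρ ≤ 1) (hsub : φ '' ball 0 ρ ⊆ H) (h0 : χ 0 = φ 0) :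
    ∃ k : ℂ → ℂ, DifferentiableOn ℂ k (ball 0 ρ) ∧ MapsTo k (ball 0 ρ) (ball 0 1) ∧ k 0 = 0 ∧
      (∀ z ∈ ball (0:ℂ) ρ, χ (k z) = φ z) ∧ deriv k 0 = deriv φ 0 / deriv χ 0 := by
  obtain ⟨g, hg, hgx⟩ := inv_holo isOpen_ball hχ.d hχ.inj
  rw [hχ.b.image_eq] at hg
  have hs : ball (0:ℂ) ρ ⊆ ball 0 1 := ball_subset_ball hρ1
  have hmem : ∀ z ∈ ball (0:ℂ) ρ, φ z ∈ H := fun z hz => hsub ⟨z, hz, rfl⟩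
  have hg0 : g (φ 0) = 0 := by rw [← h0]; exact hgx 0 (mem_ball_self one_pos)
  refine ⟨fun z => g (φ z), ?_, ?_, hg0, ?_, ?_⟩
  · intro z hz
    exact (hg _ (hmem z hz)).differentiableAt.comp_differentiableWithinAt z
      ((hφ.d z (hs hz)).mono hs)
  · intro z hz
    obtain ⟨x, hx, hxe⟩ := hχ.b.surjOn (hmem z hz)
    simp only [← hxe, hgx x hx]; exact hx
  · intro z hz
    obtain ⟨x, hx, hxe⟩ := hχ.b.surjOn (hmem z hz)
    simp only [← hxe, hgx x hx]
  · have h1 := hg _ (hmem 0 (mem_ball_self hρ))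
    have h2 : HasDerivAt φ (deriv φ 0) 0 :=
      ((hφ.d 0 (mem_ball_self one_pos)).differentiableAt (ball_mem_nhds _ one_pos)).hasDerivAt
    have h3 : HasDerivAt (fun z => g (φ z)) ((deriv χ (g (φ 0)))⁻¹ * deriv φ 0) 0 := h1.comp 0 h2
    rw [h3.deriv, hg0, div_eq_mul_inv, mul_comm]

theorem Conv.rm_lim (h : Conv l Gn J1n J2n J3n G J1 J2 J3) {φn : ι → ℂ → ℂ} {φ : ℂ → ℂ}
    (hn : ∀ᶠ i in (l : Filter ι), IsRM (φn i) (Gn i) ∧ φn i 0 = φ 0 ∧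
      ∃ r : ℝ, 0 < r ∧ deriv (φn i) 0 = r)
    (hφ : IsRM φ G) (hr : ∃ r : ℝ, 0 < r ∧ deriv φ 0 = r) :
    TendstoLocallyUniformlyOn φn φ (l : Filter ι) (ball 0 1) := by
  obtain ⟨r, hr, hdr⟩ := hr
  obtain ⟨R, hR, hbd⟩ := h.ev_bdd
  obtain ⟨ψ, hψ⟩ := montel l (F := φn) (U := ball 0 1) (C := R) isOpen_ball
    (hn.mono fun i hi => hi.1.d) (by
      filter_upwards [hn, hbd] with i hi hb z hz
      exact (mem_ball_zero_iff.1 (hb (subset_closure (hi.1.mem hz)))).le)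
  have hd : ∀ᶠ i in (l : Filter ι), DifferentiableOn ℂ (φn i) (ball 0 1) := hn.mono fun i hi => hi.1.d
  have hψd : DifferentiableOn ℂ ψ (ball 0 1) := hψ.differentiableOn hd isOpen_ball
  have h0m : (0:ℂ) ∈ ball (0:ℂ) 1 := mem_ball_self one_pos
  have hψ0 : ψ 0 = φ 0 := by
    refine tendsto_nhds_unique (hψ.tendsto_at h0m) ?_
    exact tendsto_const_nhds.congr' (hn.mono fun i hi => hi.2.1.symm)
  have hder : Tendsto (fun i => deriv (φn i) 0) (l : Filter ι) (𝓝 (deriv ψ 0)) :=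
    (hψ.deriv hd isOpen_ball).tendsto_at h0m
  have hderre : Tendsto (fun i => (deriv (φn i) 0).re) (l : Filter ι) (𝓝 (deriv ψ 0).re) :=
    (Complex.continuous_re.tendsto _).comp hder
  have him : (deriv ψ 0).im = 0 := by
    refine tendsto_nhds_unique ((Complex.continuous_im.tendsto _).comp hder) ?_
    refine tendsto_const_nhds.congr' (hn.mono fun i hi => ?_)
    obtain ⟨s, -, hs⟩ := hi.2.2
    simp [hs]
  have hcomp : ∀ ρ : ℝ, 0 < ρ → ρ < 1 → r * ρ ≤ (deriv ψ 0).re := by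
    intro ρ hρ hρ1
    refine ge_of_tendsto hderre ?_
    have hQ : IsCompact (φ '' closedBall 0 ρ) := (isCompact_closedBall _ _).image_of_continuousOn
      (hφ.d.continuousOn.mono (closedBall_subset_ball hρ1))
    filter_upwards [hn, h.ev_subset hQ (by
      rintro _ ⟨z, hz, rfl⟩; exact hφ.mem (closedBall_subset_ball hρ1 hz))] with i hi hsub
    obtain ⟨s, hs, hds⟩ := hi.2.2
    obtain ⟨k, hk1, hk2, hk3, -, hk5⟩ := rm_deriv_compare hi.1 hφ hρ hρ1.le
      ((image_mono ball_subset_closedBall).trans hsub) hi.2.1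
    have := Complex.norm_deriv_le_div_of_mapsTo_ball hk1 (R₂ := 1)
      (by rw [hk3]; exact fun z hz => ball_subset_closedBall (hk2 hz)) hρ
    rw [hk5, hdr, hds, norm_div, Complex.norm_real, Complex.norm_real, Real.norm_of_nonneg hr.le,
      Real.norm_of_nonneg hs.le, div_le_div_iff₀ hs hρ] at this
    rw [hds, Complex.ofReal_re]; linarith
  have hge : r ≤ (deriv ψ 0).re := by
    have ht : Tendsto (fun ρ : ℝ => r * ρ) (𝓝[<] 1) (𝓝 (r * 1)) :=
      (Continuous.tendsto (by fun_prop) 1).mono_left nhdsWithin_le_nhds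
    rw [mul_one] at ht
    refine le_of_tendsto ht ?_
    filter_upwards [Ioo_mem_nhdsLT (zero_lt_one (α := ℝ))] with ρ hρ
    exact hcomp ρ hρ.1 hρ.2
  have hne : deriv ψ 0 ≠ 0 := by
    intro h0; rw [h0] at hge; simp at hge; linarith
  have hinj : InjOn ψ (ball 0 1) := hurwitz_inj isOpen_ball (convex_ball _ _).isPreconnected hd hψ
    (hn.mono fun i hi => hi.1.inj) h0m hne
  have hmaps : ∀ z ∈ ball (0:ℂ) 1, ψ z ∈ G := by
    intro z hz
    have hcl : ψ z ∈ closure G := h.lim_closure (hψ.tendsto_at hz) (hn.mono fun i hi => hi.1.mem hz)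
    by_contra hG
    have hk : ψ z ∈ KK J1 J2 J3 := by rw [← h.a.fr, h.a.op.frontier_eq]; exact ⟨hcl, hG⟩
    obtain ⟨kn, hkn, hkt⟩ := h.approx_KK hk
    have hlim : TendstoLocallyUniformlyOn (fun i w => φn i w - kn i) (fun w => ψ w - ψ z)
        (l : Filter ι) (ball 0 1) :=
      hψ.fun_sub ((hkt.tendstoUniformlyOn_const (ball 0 1)).tendstoLocallyUniformlyOn)
    rcases hurwitz isOpen_ball (convex_ball _ _).isPreconnected
      (hd.mono fun i hi => hi.sub_const _) hlim (by
        filter_upwards [hn] with i hi w hw h0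
        have := hi.1.mem hw
        rw [sub_eq_zero.1 h0] at this
        exact disjoint_left.1 (h.an i).disj this (hkn i)) with h1 | h1
    · exact h1 z hz (sub_self _)
    · have hhalf : (1/2 : ℂ) ∈ ball (0:ℂ) 1 := by rw [mem_ball_zero_iff]; norm_num
      have := hinj hhalf h0m ((sub_eq_zero.1 (h1 _ hhalf)).trans (sub_eq_zero.1 (h1 _ h0m)).symm)
      norm_num at this
  have hψRM : IsRM ψ (ψ '' ball 0 1) := ⟨hψd, hinj.bijOn_image⟩
  obtain ⟨k, hk1, hk2, hk3, hk4, hk5⟩ := rm_deriv_compare hφ hψRM one_pos le_rfl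
    (by rintro _ ⟨z, hz, rfl⟩; exact hmaps z hz) hψ0.symm
  have hk2' : MapsTo k (ball 0 1) (closedBall (k 0) 1) := by
    rw [hk3]; exact fun z hz => ball_subset_closedBall (hk2 hz)
  have hψre : deriv ψ 0 = ((deriv ψ 0).re : ℂ) := by
    apply Complex.ext <;> simp [him]
  have hkd : deriv k 0 = (((deriv ψ 0).re / r : ℝ) : ℂ) := by
    rw [hk5, hdr, hψre]; push_cast; simp
  have hle := Complex.norm_deriv_le_one_of_mapsTo_ball hk1 hk2' one_pos
  rw [hkd, Complex.norm_real, Real.norm_of_nonneg (div_nonneg (hr.le.trans hge) hr.le)] at hle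
  have heq : (deriv ψ 0).re / r = 1 := le_antisymm hle ((one_le_div hr).2 hge)
  have hk1' : deriv k 0 = 1 := by rw [hkd, heq]; simp
  have haff := Complex.affine_of_mapsTo_ball_of_norm_dslope_eq_div hk1 hk2' h0m
    (by rw [dslope_same, hk1']; simp)
  refine hψ.congr_right fun z hz => ?_
  have := haff hz
  simp only [dslope_same, hk1', hk3] at this
  rw [← hk4 z hz, this]; simp

end

/-- uniform convergence of the normalized Riemann maps -/
theorem Conv.rm_unif {Gn : ℕ → Set ℂ} {J1n J2n J3n : ℕ → ℝ → ℂ}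
    {G : Set ℂ} {J1 J2 J3 : ℝ → ℂ} (h : Conv atTop Gn J1n J2n J3n G J1 J2 J3)
    {φn : ℕ → ℂ → ℂ} {φ : ℂ → ℂ}
    (hn : ∀ᶠ i in atTop, IsRM (φn i) (Gn i) ∧ φn i 0 = φ 0 ∧
      ∃ r : ℝ, 0 < r ∧ deriv (φn i) 0 = r)
    (hφ : IsRM φ G) (hr : ∃ r : ℝ, 0 < r ∧ deriv φ 0 = r) :
    TendstoUniformlyOn φn φ atTop (ball 0 1) := by
  rw [Metric.tendstoUniformlyOn_iff]
  intro ε hε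
  by_contra hc
  rw [not_eventually] at hc
  have hne : (atTop ⊓ 𝓟 {n | ¬ ∀ x ∈ ball (0:ℂ) 1, dist (φ x) (φn n x) < ε}).NeBot :=
    frequently_mem_iff_neBot.1 hc
  set l : Ultrafilter ℕ := Ultrafilter.of (atTop ⊓ 𝓟 {n | ¬ ∀ x ∈ ball (0:ℂ) 1, dist (φ x) (φn n x) < ε})
    with hl
  have hle : (l : Filter ℕ) ≤ atTop ⊓ 𝓟 {n | ¬ ∀ x ∈ ball (0:ℂ) 1, dist (φ x) (φn n x) < ε} :=
    Ultrafilter.of_le _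
  have hl1 : (l : Filter ℕ) ≤ atTop := hle.trans inf_le_left
  have hbad : ∀ᶠ n in (l : Filter ℕ), ∃ x ∈ ball (0:ℂ) 1, ε ≤ dist (φ x) (φn n x) := by
    have : ∀ᶠ n in (l : Filter ℕ), ¬ ∀ x ∈ ball (0:ℂ) 1, dist (φ x) (φn n x) < ε :=
      hle.trans inf_le_right (mem_principal_self _)
    filter_upwards [this] with n hn
    push Not at hn
    exact hn
  have hcl : Conv (l : Filter ℕ) Gn J1n J2n J3n G J1 J2 J3 :=
    ⟨h.an, h.a, fun u hu => hl1 (h.u1 u hu), fun u hu => hl1 (h.u2 u hu), fun u hu => hl1 (h.u3 u hu)⟩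
  have hlim := hcl.rm_lim (hn.filter_mono hl1) hφ hr
  have h0m : (0:ℂ) ∈ ball (0:ℂ) 1 := mem_ball_self one_pos
  obtain ⟨δ, hδ, H⟩ := h.equi (hφ.mem h0m) (show 0 < ε/4 by positivity)
  obtain ⟨δ', hδ', H'⟩ := Metric.uniformContinuousOn_iff.1 (h.a.unifCont hφ) (ε/4) (by positivity)
  obtain ⟨x, hx⟩ := hbad.choice
  obtain ⟨y, hy, hxy⟩ := ulim l (isCompact_closedBall (0:ℂ) 1)
    (hx.mono fun i hi => ball_subset_closedBall hi.1)
  rw [← closure_ball _ one_ne_zero] at hy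
  obtain ⟨w, hw, hyw⟩ := Metric.mem_closure_iff.1 hy (min δ δ') (lt_min hδ hδ')
  have hev : ∀ᶠ i in (l : Filter ℕ), dist (x i) w < min δ δ' :=
    (hxy.dist tendsto_const_nhds).eventually (gt_mem_nhds hyw)
  have hpt := (Metric.tendsto_nhds.1 (hlim.tendsto_at hw)) (ε/4) (by positivity)
  obtain ⟨i, h1, h2, h3, h4, h5⟩ := (hx.and (hev.and (hpt.and ((H.filter_mono hl1).and
    (hn.filter_mono hl1))))).exists
  have a1 := h4 _ h5.1 h5.2.1 w hw (x i) h1.1 (h2.trans_le (min_le_left _ _))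
  have a2 := H' (x i) h1.1 w hw (h2.trans_le (min_le_right _ _))
  have a3 := h1.2
  have t1 := dist_triangle4 (φ (x i)) (φ w) (φn i w) (φn i (x i))
  rw [dist_comm (φ w)] at t1
  rw [dist_comm (φn i (x i))] at a1
  linarith

end HP

end

section
open Set Filter Topology Metric

namespace HP

theorem ext_bdry {G : Set ℂ} {Φ : ℂ → ℂ} (h : IsRM Φ G) (hc : ContinuousOn Φ (closedBall 0 1)) {ζ : ℂ}
    (hζ : ‖ζ‖ = 1) : Φ ζ ∈ frontier G := by
  have hζc : ζ ∈ closedBall (0:ℂ) 1 := by simp [hζ]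
  have hcl : ζ ∈ closure (ball (0:ℂ) 1) := by rwa [closure_ball _ one_ne_zero]
  have : (𝓝[ball (0:ℂ) 1] ζ).NeBot := mem_closure_iff_nhdsWithin_neBot.1 hcl
  have ht : Tendsto Φ (𝓝[ball (0:ℂ) 1] ζ) (𝓝 (Φ ζ)) :=
    (hc ζ hζc).mono_left (nhdsWithin_mono _ ball_subset_closedBall)
  rw [h.isOpen.frontier_eq]
  refine ⟨mem_closure_of_tendsto ht ?_, fun hG => ?_⟩
  · filter_upwards [self_mem_nhdsWithin] with v hv
    exact h.mem hv
  · obtain ⟨r, hr, hrG⟩ := Metric.nhds_basis_closedBall.mem_iff.1 (h.isOpen.mem_nhds hG)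
    obtain ⟨ρ, h0, h1, hQ⟩ := h.exhaust (isCompact_closedBall (Φ ζ) r) hrG
    have hE : Tendsto (fun v : ℂ => ‖v‖) (𝓝[ball (0:ℂ) 1] ζ) (𝓝 1) := by
      rw [← hζ]
      exact (continuous_norm.tendsto ζ).mono_left nhdsWithin_le_nhds
    have hev : ∀ᶠ v in 𝓝[ball (0:ℂ) 1] ζ, ‖v‖ ≤ ρ := by
      filter_upwards [self_mem_nhdsWithin, ht.eventually (closedBall_mem_nhds _ hr)] with v hv hb
      obtain ⟨z, hz, hze⟩ := hQ hb
      rw [← h.inj (ball_subset_ball h1.le hz) hv hze]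
      exact (mem_ball_zero_iff.1 hz).le
    have := le_of_tendsto hE hev
    linarith

theorem ext_surj {G : Set ℂ} {Φ : ℂ → ℂ} (h : IsRM Φ G) (hc : ContinuousOn Φ (closedBall 0 1)) {k : ℂ}
    (hk : k ∈ frontier G) : ∃ ζ : ℂ, ‖ζ‖ = 1 ∧ Φ ζ = k := by
  have hcomp : IsCompact (Φ '' closedBall 0 1) := (isCompact_closedBall _ _).image_of_continuousOn hc
  have hsub : closure G ⊆ Φ '' closedBall 0 1 := by
    refine closure_minimal ?_ hcomp.isClosed
    rw [← h.b.image_eq]; exact image_mono ball_subset_closedBall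
  obtain ⟨ζ, hζ, rfl⟩ := hsub (frontier_subset_closure hk)
  refine ⟨ζ, ?_, rfl⟩
  rw [h.isOpen.frontier_eq] at hk
  refine le_antisymm (by simpa using hζ) ?_
  by_contra! hlt
  exact hk.2 (h.mem (by simpa using hlt))

theorem arc_nonconst {G : Set ℂ} {Φ : ℂ → ℂ} (h : IsRM Φ G) (hc : ContinuousOn Φ (closedBall 0 1))
    {k : ℂ} (hk : k ∉ G) {O : Set ℂ} (hO : IsOpen O) {p : ℂ} (hp : ‖p‖ = 1) (hpO : p ∈ O) :
    ∃ q ∈ O, ‖q‖ = 1 ∧ Φ q ≠ k := by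
  by_contra! hcon
  obtain ⟨t, ht⟩ := (isCompact_sphere (0:ℂ) 1).elim_finite_subcover
    (fun c : sphere (0:ℂ) 1 => {ζ : ℂ | (c:ℂ) * ζ ∈ O}) (fun c => hO.preimage (by fun_prop)) (by
      intro ζ hζ
      have hζ1 : ‖ζ‖ = 1 := by simpa using hζ
      have hζ0 : ζ ≠ 0 := by rintro rfl; simp at hζ1
      refine mem_iUnion.2 ⟨⟨p / ζ, by simp [hp, hζ1]⟩, ?_⟩
      change p / ζ * ζ ∈ O
      rwa [div_mul_cancel₀ _ hζ0])
  have hcn : ∀ c : sphere (0:ℂ) 1, ‖(c:ℂ)‖ = 1 := fun c => by simp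
  have hm1 : ∀ c : sphere (0:ℂ) 1, MapsTo (fun z => (c:ℂ) * z) (ball 0 1) (ball 0 1) := fun c z hz => by
    simpa [hcn c] using hz
  have hm2 : ∀ c : sphere (0:ℂ) 1, MapsTo (fun z => (c:ℂ) * z) (closedBall 0 1) (closedBall 0 1) :=
    fun c z hz => by simpa [hcn c] using hz
  set f : ℂ → ℂ := fun z => ∏ c ∈ t, (Φ (c * z) - k) with hf
  have hd : DiffContOnCl ℂ f (ball 0 1) := by
    refine ⟨?_, ?_⟩
    · refine DifferentiableOn.fun_finsetProd fun c _ => ?_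
      refine DifferentiableOn.sub_const (f := fun z => Φ (c * z)) ?_ _
      exact h.d.comp (by fun_prop) (hm1 c)
    · rw [closure_ball _ one_ne_zero]
      refine continuousOn_finsetProd _ fun c _ => ?_
      refine ContinuousOn.sub ?_ continuousOn_const
      exact hc.comp (by fun_prop) (hm2 c)
  have hz : EqOn f (fun _ => 0) (closure (ball (0:ℂ) 1)) := by
    refine Complex.eqOn_closure_of_eqOn_frontier isBounded_ball hd diffContOnCl_const ?_
    intro ζ hζ
    rw [frontier_ball _ one_ne_zero] at hζ
    obtain ⟨c, hct, hcO⟩ := mem_iUnion₂.1 (ht hζ)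
    refine Finset.prod_eq_zero hct (sub_eq_zero.2 (hcon _ hcO ?_))
    rw [norm_mul, hcn c]; simpa using hζ
  have h0 := hz (subset_closure (mem_ball_self one_pos))
  obtain ⟨c, hct, hc0⟩ := Finset.prod_eq_zero_iff.1 h0
  refine hk ?_
  rw [← sub_eq_zero.1 hc0]
  exact h.mem (hm1 c (mem_ball_self one_pos))

/-- signed side of the chord -/
noncomputable def side (a b z : ℂ) : ℝ := ((z - a) * (starRingEnd ℂ) (b - a)).im

theorem side_cont (a b : ℂ) : Continuous (side a b) := by
  unfold side; fun_prop

theorem conj_mul_one {w : ℂ} (hw : ‖w‖ = 1) : (starRingEnd ℂ) w * w = 1 := by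
  rw [mul_comm, Complex.mul_conj, Complex.normSq_eq_norm_sq, hw]; simp

theorem side_chord {a b z : ℂ} (ha : ‖a‖ = 1) (hb : ‖b‖ = 1) (hz : ‖z‖ = 1) (hab : a ≠ b)
    (hs : side a b z = 0) : z = a ∨ z = b := by
  have h1 := conj_mul_one ha
  have h2 := conj_mul_one hb
  have h3 := conj_mul_one hz
  have h4 := Complex.conj_eq_iff_im.2 hs
  simp only [map_mul, map_sub, Complex.conj_conj] at h4
  set A := (starRingEnd ℂ) a
  set B := (starRingEnd ℂ) b
  set Z := (starRingEnd ℂ) z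
  have h5 : (z - a) * (a - b) * (z - b) = 0 := by
    linear_combination (-a*b*z) * h4 + (b*z*(z-a)-b*z*(b-a)) * h1 - a*z*(z-a) * h2 + a*b*(b-a)*h3
  rcases mul_eq_zero.1 h5 with h | h
  · rcases mul_eq_zero.1 h with h | h
    · exact Or.inl (sub_eq_zero.1 h)
    · exact absurd (sub_eq_zero.1 h) hab
  · exact Or.inr (sub_eq_zero.1 h)

theorem side_swap (a b z : ℂ) : side b a z = - side a b z := by
  simp [side]; ring

theorem side_exists {a b : ℂ} (ha : ‖a‖ = 1) (hb : ‖b‖ = 1) (hab : a ≠ b) :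
    ∃ p : ℂ, ‖p‖ = 1 ∧ 0 < side a b p := by
  have hL : 0 < ‖b - a‖ := norm_pos_iff.2 (sub_ne_zero.2 hab.symm)
  have hL' : (‖b - a‖ : ℂ) ≠ 0 := by exact_mod_cast hL.ne'
  refine ⟨Complex.I * (b - a) / ‖b - a‖, by simp [hL.ne'], ?_⟩
  have e : (Complex.I * (b - a) / ‖b - a‖ - a) * (starRingEnd ℂ) (b - a) =
      Complex.I * ‖b - a‖ - a * (starRingEnd ℂ) (b - a) := by
    have := Complex.mul_conj (b - a)
    rw [Complex.normSq_eq_norm_sq] at this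
    push_cast at this
    field_simp
    linear_combination Complex.I * this
  have hn : ∀ w : ℂ, ‖w‖ = 1 → w.re * w.re + w.im * w.im = 1 := fun w hw => by
    have := Complex.normSq_eq_norm_sq w
    rw [hw, Complex.normSq_apply] at this; linarith
  have h1 := hn a ha
  have h2 := hn b hb
  rw [side, e]
  have hLsq : ‖b - a‖^2 = (b.re - a.re)^2 + (b.im - a.im)^2 := by
    rw [← Complex.normSq_eq_norm_sq, Complex.normSq_apply]; simp; ring
  set L := ‖b - a‖
  simp
  have hx : a.im * b.re - a.re * b.im < L := by
    refine lt_of_pow_lt_pow_left₀ 2 hL.le ?_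
    nlinarith [sq_nonneg (a.re * b.re + a.im * b.im - 1), sq_pos_of_pos hL]
  nlinarith

end HP

end

section
open Set Filter Topology Metric

namespace HP

theorem ext_unique {G : Set ℂ} {Φ : ℂ → ℂ} (h : IsRM Φ G) (hc : ContinuousOn Φ (closedBall 0 1))
    {k : ℂ} (hK : IsCompact (frontier G)) (hkK : k ∈ frontier G)
    (hpre : IsPreconnected (frontier G \ {k})) {a b : ℂ} (ha : ‖a‖ = 1) (hb : ‖b‖ = 1)
    (hΦa : Φ a = k) (hΦb : Φ b = k) : a = b := by
  by_contra hab
  have hkG : k ∉ G := by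
    rw [h.isOpen.frontier_eq] at hkK; exact hkK.2
  have hdisG : Disjoint G (frontier G) := by
    rw [h.isOpen.frontier_eq]; exact disjoint_sdiff_right
  set S : Set ℂ := closedBall 0 1 ∩ {z | side a b z = 0} with hS
  have hconvlin : ∀ P : Set ℝ, Convex ℝ P → Convex ℝ {z | side a b z ∈ P} := by
    intro P hP x hx y hy s t hs ht hst
    have e : side a b (s • x + t • y) = s • side a b x + t • side a b y := by
      have h1 : t = 1 - s := by linarith
      subst h1
      simp [side]; ring
    change side a b (s • x + t • y) ∈ P
    rw [e]; exact hP hx hy hs ht hst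
  have hSc : IsCompact S := (isCompact_closedBall _ _).inter_right
    (isClosed_eq (side_cont a b) continuous_const)
  set C := Φ '' S with hC
  have hCc : IsCompact C := hSc.image_of_continuousOn (hc.mono inter_subset_left)
  have haS : a ∈ S := ⟨by simp [ha], by simp [side]⟩
  have hbdry : ∀ z : ℂ, z ∈ closedBall (0:ℂ) 1 → z ∈ ball (0:ℂ) 1 ∨ ‖z‖ = 1 := fun z hz => by
    rcases (mem_closedBall_zero_iff.1 hz).lt_or_eq with h' | h'
    · exact Or.inl (by simpa using h')
    · exact Or.inr h'
  have hSk : ∀ z ∈ S, ‖z‖ = 1 → Φ z = k := by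
    intro z hz hz1
    rcases side_chord ha hb hz1 hab hz.2 with rfl | rfl
    · exact hΦa
    · exact hΦb
  have hKC : frontier G ∩ C = {k} := by
    apply Subset.antisymm
    · rintro _ ⟨hK', z, hz, rfl⟩
      rcases hbdry z hz.1 with h' | h'
      · exact absurd hK' (disjoint_left.1 hdisG (h.mem h'))
      · exact hSk z hz h'
    · rintro _ rfl
      exact ⟨hkK, a, haS, hΦa⟩
  -- each side can be connected to the boundary off `C`
  have hside : ∀ P : Set ℝ, IsOpen P → Convex ℝ P → (0:ℝ) ∉ P → (∃ p : ℂ, ‖p‖ = 1 ∧ side a b p ∈ P) →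
      ∃ z ∈ ball (0:ℂ) 1, side a b z ∈ P ∧ ∃ q ∈ frontier G \ {k}, Conn C (Φ z) q := by
    rintro P hPo hPc hP0 ⟨p, hp, hpP⟩
    obtain ⟨q, hqP, hq, hqk⟩ := arc_nonconst h hc hkG (hPo.preimage (side_cont a b)) hp hpP
    have hq0 : side a b q ∈ P := hqP
    obtain ⟨z, hz, hzP⟩ : ∃ z ∈ ball (0:ℂ) 1, side a b z ∈ P := by
      have hcl : q ∈ closure (ball (0:ℂ) 1) := by
        rw [closure_ball _ one_ne_zero]; simp [hq]
      obtain ⟨z, hz1, hz2⟩ := mem_closure_iff.1 hcl _ (hPo.preimage (side_cont a b)) hqP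
      exact ⟨z, hz2, hz1⟩
    refine ⟨z, hz, hzP, Φ q, ⟨ext_bdry h hc hq, hqk⟩, Φ '' segment ℝ z q, ?_, ?_, ?_, ?_⟩
    · refine (convex_segment z q).isPreconnected.image _ (hc.mono ?_)
      exact (convex_closedBall _ _).segment_subset (ball_subset_closedBall hz) (by simp [hq])
    · rw [disjoint_left]
      rintro _ ⟨x, hx, rfl⟩ ⟨y, hy, hyx⟩
      have hxP : side a b x ∈ P := (hconvlin P hPc).segment_subset hzP hq0 hx
      have hxc : x ∈ closedBall (0:ℂ) 1 :=
        (convex_closedBall _ _).segment_subset (ball_subset_closedBall hz) (by simp [hq]) hx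
      rcases hbdry x hxc with h1 | h1
      · rcases hbdry y hy.1 with h2 | h2
        · have := h.inj h2 h1 hyx
          rw [this] at hy
          rw [hy.2] at hxP
          exact hP0 hxP
        · rw [hSk y hy h2] at hyx
          exact hkG (hyx ▸ h.mem h1)
      · have hxq : x = q := by
          by_contra hne
          have hzc : z ∈ interior (closedBall (0:ℂ) 1) := by
            rw [interior_closedBall _ one_ne_zero]; exact hz
          obtain ⟨s, t, hs, ht, hst, rfl⟩ := hx
          have hs0 : s ≠ 0 := by
            rintro rfl
            apply hne
            have : t = 1 := by linarith
            simp [this]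
          have : ‖s • z + t • q‖ < 1 := by
            calc ‖s • z + t • q‖ ≤ ‖s • z‖ + ‖t • q‖ := norm_add_le _ _
              _ = s * ‖z‖ + t * 1 := by
                rw [norm_smul, norm_smul, hq, Real.norm_of_nonneg hs, Real.norm_of_nonneg ht]
              _ < s * 1 + t * 1 := by
                have : ‖z‖ < 1 := by simpa using hz
                have hs' : 0 < s := hs.lt_of_ne hs0.symm
                nlinarith
              _ = 1 := by linarith
          linarith
        subst hxq
        have hm : Φ x ∈ frontier G ∩ C := ⟨ext_bdry h hc h1, y, hy, hyx⟩
        rw [hKC] at hm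
        exact hqk hm
    · exact mem_image_of_mem _ (left_mem_segment ℝ z q)
    · exact mem_image_of_mem _ (right_mem_segment ℝ z q)
  obtain ⟨z1, hz1, hs1, q1, hq1, hc1⟩ := hside (Ioi 0) isOpen_Ioi (convex_Ioi 0) (by simp)
    (side_exists ha hb hab)
  obtain ⟨z2, hz2, hs2, q2, hq2, hc2⟩ := hside (Iio 0) isOpen_Iio (convex_Iio 0) (by simp) (by
    obtain ⟨p, hp, hp'⟩ := side_exists hb ha (Ne.symm hab)
    rw [side_swap] at hp'
    exact ⟨p, hp, by simpa using hp'⟩)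
  have hqq : Conn C q1 q2 := ⟨_, hpre, by
    rw [disjoint_left]
    rintro x ⟨hx, hxk⟩ hxC
    have : x ∈ frontier G ∩ C := ⟨hx, hxC⟩
    rw [hKC] at this
    exact hxk this, hq1, hq2⟩
  have hconn : Conn (frontier G ∪ C) (Φ z1) (Φ z2) := by
    refine janiszewski hK hCc (by rw [hKC]; exact isPreconnected_singleton)
      ⟨G, h.preconn, hdisG, h.mem hz1, h.mem hz2⟩ ((hc1.trans hqq).trans hc2.symm)
  obtain ⟨T, hT, hdis, h1, h2⟩ := hconn
  rw [disjoint_union_right] at hdis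
  have hTG : T ⊆ G := subset_of_disj_frontier h.isOpen hT hdis.1 (h.mem hz1) h1
  have hopen : ∀ P : Set ℝ, IsOpen P → IsOpen (Φ '' (ball 0 1 ∩ side a b ⁻¹' P)) := fun P hP =>
    isOpen_image_of_inj isOpen_ball h.d h.inj (isOpen_ball.inter (hP.preimage (side_cont a b)))
      inter_subset_left
  have hcov : T ⊆ Φ '' (ball 0 1 ∩ side a b ⁻¹' (Ioi 0)) ∪ Φ '' (ball 0 1 ∩ side a b ⁻¹' (Iio 0)) := by
    intro t ht
    obtain ⟨z, hz, rfl⟩ := h.b.surjOn (hTG ht)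
    rcases lt_trichotomy (side a b z) 0 with h' | h' | h'
    · exact Or.inr ⟨z, ⟨hz, h'⟩, rfl⟩
    · exact absurd ⟨z, ⟨ball_subset_closedBall hz, h'⟩, rfl⟩ (disjoint_left.1 hdis.2 ht)
    · exact Or.inl ⟨z, ⟨hz, h'⟩, rfl⟩
  obtain ⟨t, ht, ⟨w1, hw1, e1⟩, ⟨w2, hw2, e2⟩⟩ := hT _ _ (hopen _ isOpen_Ioi) (hopen _ isOpen_Iio) hcov
    ⟨_, h1, z1, ⟨hz1, hs1⟩, rfl⟩ ⟨_, h2, z2, ⟨hz2, hs2⟩, rfl⟩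
  have := h.inj hw1.1 hw2.1 (e1.trans e2.symm)
  subst this
  exact lt_asymm (show 0 < side a b w1 from hw1.2) hw2.2

section
variable {G : Set ℂ} {J1 J2 J3 : ℝ → ℂ}

theorem Adm.preconn_a (h : Adm G J1 J2 J3) : IsPreconnected (KK J1 J2 J3 \ {J1 1}) := by
  have e : KK J1 J2 J3 \ {J1 1} = J1 '' Ico 0 1 ∪ (J3 '' Icc 0 1 ∪ J2 '' Ioc 0 1) := by
    apply Subset.antisymm
    · rintro _ ⟨(⟨x, hx, rfl⟩ | ⟨x, hx, rfl⟩) | ⟨x, hx, rfl⟩, hne⟩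
      · exact Or.inl ⟨x, ⟨hx.1, hx.2.lt_of_ne fun e => hne (by rw [e]; rfl)⟩, rfl⟩
      · exact Or.inr (Or.inr ⟨x, ⟨hx.1.lt_of_ne fun e => hne (by rw [← e, ← h.cyc.AB]; rfl), hx.2⟩, rfl⟩)
      · exact Or.inr (Or.inl ⟨x, hx, rfl⟩)
    · rintro _ (⟨x, hx, rfl⟩ | ⟨x, hx, rfl⟩ | ⟨x, hx, rfl⟩)
      · refine ⟨mem_KK1 (Ico_subset_Icc_self hx), fun e => ?_⟩
        exact hx.2.ne (h.cyc.iA (Ico_subset_Icc_self hx) one_mem_I e)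
      · exact ⟨mem_KK3 hx, fun e => h.a_notMem (e ▸ mem_image_of_mem _ hx)⟩
      · refine ⟨mem_KK2 (Ioc_subset_Icc_self hx), fun e => ?_⟩
        rw [h.cyc.AB] at e
        exact hx.1.ne' (h.cyc.iB (Ioc_subset_Icc_self hx) zero_mem_I e)
  rw [e]
  refine IsPreconnected.union (J1 0) ⟨0, by simp, rfl⟩ (Or.inl ⟨1, one_mem_I, h.cyc.CA⟩)
    (isPreconnected_Ico.image _ h.cyc.cA.continuousOn) ?_
  exact IsPreconnected.union (J3 0) ⟨0, zero_mem_I, rfl⟩ ⟨1, by simp, h.cyc.BC⟩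
    (isPreconnected_Icc.image _ h.cyc.cC.continuousOn) (isPreconnected_Ioc.image _ h.cyc.cB.continuousOn)

theorem Adm.preconn_b (h : Adm G J1 J2 J3) {s : ℝ} (hs : s ∈ Ioo (0:ℝ) 1) :
    IsPreconnected (KK J1 J2 J3 \ {J3 s}) := by
  have hs' := Ioo_subset_Icc_self hs
  have e : KK J1 J2 J3 \ {J3 s} = J3 '' Ico 0 s ∪ (J2 '' Icc 0 1 ∪ (J1 '' Icc 0 1 ∪ J3 '' Ioc s 1)) := by
    apply Subset.antisymm
    · rintro _ ⟨(⟨x, hx, rfl⟩ | ⟨x, hx, rfl⟩) | ⟨x, hx, rfl⟩, hne⟩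
      · exact Or.inr (Or.inr (Or.inl ⟨x, hx, rfl⟩))
      · exact Or.inr (Or.inl ⟨x, hx, rfl⟩)
      · rcases lt_trichotomy x s with h' | h' | h'
        · exact Or.inl ⟨x, ⟨hx.1, h'⟩, rfl⟩
        · exact absurd (by rw [h']; rfl) hne
        · exact Or.inr (Or.inr (Or.inr ⟨x, ⟨h', hx.2⟩, rfl⟩))
    · rintro _ (⟨x, hx, rfl⟩ | ⟨x, hx, rfl⟩ | ⟨x, hx, rfl⟩ | ⟨x, hx, rfl⟩)
      · have hx' : x ∈ Icc (0:ℝ) 1 := ⟨hx.1, hx.2.le.trans hs.2.le⟩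
        exact ⟨mem_KK3 hx', fun e => hx.2.ne (h.cyc.iC hx' hs' e)⟩
      · exact ⟨mem_KK2 hx, fun e => hs.1.ne' (h.int23 hx hs' e).2⟩
      · exact ⟨mem_KK1 hx, fun e => hs.2.ne (h.int13 hx hs' e).2⟩
      · have hx' : x ∈ Icc (0:ℝ) 1 := ⟨hs.1.le.trans hx.1.le, hx.2⟩
        exact ⟨mem_KK3 hx', fun e => hx.1.ne' (h.cyc.iC hx' hs' e)⟩
  rw [e]
  refine IsPreconnected.union (J3 0) ⟨0, ⟨le_rfl, hs.1⟩, rfl⟩ (Or.inl ⟨1, one_mem_I, h.cyc.BC⟩)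
    (isPreconnected_Ico.image _ h.cyc.cC.continuousOn) ?_
  refine IsPreconnected.union (J1 1) ⟨0, zero_mem_I, h.cyc.AB.symm⟩ (Or.inl ⟨1, one_mem_I, rfl⟩)
    (isPreconnected_Icc.image _ h.cyc.cB.continuousOn) ?_
  exact IsPreconnected.union (J1 0) ⟨0, zero_mem_I, rfl⟩ ⟨1, ⟨hs.2, le_rfl⟩, h.cyc.CA⟩
    (isPreconnected_Icc.image _ h.cyc.cA.continuousOn) (isPreconnected_Ioc.image _ h.cyc.cC.continuousOn)

end

end HP

end

section
open Set Filter Topology Metric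

namespace HP

theorem unif_closedBall {Φn : ℕ → ℂ → ℂ} {Φ : ℂ → ℂ} (hc : ContinuousOn Φ (closedBall 0 1))
    (hcn : ∀ n, ContinuousOn (Φn n) (closedBall 0 1))
    (hu : TendstoUniformlyOn Φn Φ atTop (ball 0 1)) :
    TendstoUniformlyOn Φn Φ atTop (closedBall 0 1) := by
  rw [Metric.tendstoUniformlyOn_iff] at hu ⊢
  intro ε hε
  filter_upwards [hu (ε/2) (by positivity)] with n hn x hx
  have hcl : x ∈ closure (ball (0:ℂ) 1) := by rwa [closure_ball _ one_ne_zero]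
  have : (𝓝[ball (0:ℂ) 1] x).NeBot := mem_closure_iff_nhdsWithin_neBot.1 hcl
  have h1 : Tendsto (fun v => dist (Φ v) (Φn n v)) (𝓝[ball (0:ℂ) 1] x) (𝓝 (dist (Φ x) (Φn n x))) :=
    ((hc x hx).mono_left (nhdsWithin_mono _ ball_subset_closedBall)).dist
      ((hcn n x hx).mono_left (nhdsWithin_mono _ ball_subset_closedBall))
  have h2 : dist (Φ x) (Φn n x) ≤ ε/2 := by
    refine le_of_tendsto h1 ?_
    filter_upwards [self_mem_nhdsWithin] with v hv
    exact (hn v hv).le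
  linarith

theorem zeta_conv {Φn : ℕ → ℂ → ℂ} {Φ : ℂ → ℂ} (hc : ContinuousOn Φ (closedBall 0 1))
    (hu : TendstoUniformlyOn Φn Φ atTop (closedBall 0 1)) {ζn kn : ℕ → ℂ} {ζ k : ℂ}
    (hζn : ∀ n, ‖ζn n‖ = 1) (hk : ∀ n, Φn n (ζn n) = kn n) (hkn : Tendsto kn atTop (𝓝 k))
    (huniq : ∀ y : ℂ, ‖y‖ = 1 → Φ y = k → y = ζ) : Tendsto ζn atTop (𝓝 ζ) := by
  rw [tendsto_iff_ultrafilter]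
  intro l hl
  obtain ⟨y, hy, hyl⟩ := ulim l (isCompact_sphere (0:ℂ) 1) (x := ζn)
    (Eventually.of_forall fun n => by simp [hζn n])
  have hy1 : ‖y‖ = 1 := by simpa using hy
  have hmem : ∀ n, ζn n ∈ closedBall (0:ℂ) 1 := fun n => by simp [hζn n]
  have h1 : Tendsto (fun n => Φ (ζn n)) l (𝓝 (Φ y)) :=
    (hc y (by simp [hy1])).tendsto.comp (tendsto_nhdsWithin_iff.2 ⟨hyl, Eventually.of_forall hmem⟩)
  have h2 : Tendsto (fun n => dist (Φ (ζn n)) (kn n)) l (𝓝 0) := by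
    refine Tendsto.mono_left ?_ hl
    rw [Metric.tendsto_atTop]
    intro ε hε
    obtain ⟨N, hN⟩ := eventually_atTop.1 (Metric.tendstoUniformlyOn_iff.1 hu ε hε)
    refine ⟨N, fun n hn => ?_⟩
    have := hN n hn _ (hmem n)
    rw [hk] at this
    simpa [abs_of_nonneg dist_nonneg] using this
  have h3 := tendsto_nhds_unique h2 (h1.dist (hkn.mono_left hl))
  have h4 : y = ζ := huniq y hy1 (dist_eq_zero.1 h3.symm)
  rw [← h4]
  exact hyl

/-- data on the disc for one domain -/
structure DData (Φ : ℂ → ℂ) (G : Set ℂ) (a b α β : ℂ) : Prop where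
  rm : IsRM Φ G
  cont : ContinuousOn Φ (closedBall 0 1)
  nα : ‖α‖ = 1
  nβ : ‖β‖ = 1
  ne : α ≠ β
  Φα : Φ α = a
  Φβ : Φ β = b

theorem Conv.disc_data {Gn : ℕ → Set ℂ} {J1n J2n J3n : ℕ → ℝ → ℂ}
    {G : Set ℂ} {J1 J2 J3 : ℝ → ℂ} (h : Conv atTop Gn J1n J2n J3n G J1 J2 J3)
    {bn : ℕ → ℂ} {s : ℝ} (hs : s ∈ Ioo (0:ℝ) 1) (hbn : ∀ n, bn n ∈ J3n n '' Icc 0 1)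
    (hb : Tendsto bn atTop (𝓝 (J3 s))) :
    ∃ (Φ : ℂ → ℂ) (α β : ℂ) (Φn : ℕ → ℂ → ℂ) (αn βn : ℕ → ℂ),
      DData Φ G (J1 1) (J3 s) α β ∧ (∀ n, DData (Φn n) (Gn n) (J1n n 1) (bn n) (αn n) (βn n)) ∧
      TendstoUniformlyOn Φn Φ atTop (closedBall 0 1) ∧ Tendsto αn atTop (𝓝 α) ∧
      Tendsto βn atTop (𝓝 β) := by
  obtain ⟨z0, hz0⟩ := h.a.nonempty
  obtain ⟨φ, hφ, hφ0, hr⟩ := h.a.exists_rm hz0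
  have hz : ∀ᶠ n in atTop, z0 ∈ Gn n := by
    refine Filter.mem_iff_ultrafilter.2 fun l hl1 => ?_
    have hcl : Conv (l : Filter ℕ) Gn J1n J2n J3n G J1 J2 J3 :=
      ⟨h.an, h.a, fun u hu => hl1 (h.u1 u hu), fun u hu => hl1 (h.u2 u hu), fun u hu => hl1 (h.u3 u hu)⟩
    exact hcl.ev_mem hz0
  have hex : ∀ n, ∃ φn : ℂ → ℂ, IsRM φn (Gn n) ∧ (z0 ∈ Gn n → φn 0 = φ 0 ∧
      ∃ r : ℝ, 0 < r ∧ deriv φn 0 = r) := by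
    intro n
    by_cases hm : z0 ∈ Gn n
    · obtain ⟨φn, h1, h2, h3⟩ := (h.an n).exists_rm hm
      exact ⟨φn, h1, fun _ => ⟨h2.trans hφ0.symm, h3⟩⟩
    · obtain ⟨w, hw⟩ := (h.an n).nonempty
      obtain ⟨φn, h1, -⟩ := (h.an n).exists_rm hw
      exact ⟨φn, h1, fun h' => absurd h' hm⟩
  choose φn hφn1 hφn2 using hex
  have hu := h.rm_unif (φn := φn) (hz.mono fun n hn => ⟨hφn1 n, hφn2 n hn⟩) hφ hr
  obtain ⟨Φ, hΦ, hΦc, hΦe⟩ := h.a.exists_ext hφ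
  have := fun n => (h.an n).exists_ext (hφn1 n)
  choose Φn hΦn hΦnc hΦne using this
  have hU : TendstoUniformlyOn Φn Φ atTop (closedBall 0 1) := by
    refine unif_closedBall hΦc hΦnc ?_
    refine (hu.congr (Eventually.of_forall fun n x hx => (hΦne n hx).symm)).congr_right
      fun x hx => (hΦe hx).symm
  have hfr : ∀ n, J1n n 1 ∈ frontier (Gn n) := fun n => by rw [(h.an n).fr]; exact mem_KK1 one_mem_I
  have hfrb : ∀ n, bn n ∈ frontier (Gn n) := fun n => by
    rw [(h.an n).fr]
    obtain ⟨t, ht, he⟩ := hbn n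
    rw [← he]; exact mem_KK3 ht
  have hfa : J1 1 ∈ frontier G := by rw [h.a.fr]; exact mem_KK1 one_mem_I
  have hfb : J3 s ∈ frontier G := by rw [h.a.fr]; exact mem_KK3 (Ioo_subset_Icc_self hs)
  obtain ⟨α, hα, hΦα⟩ := ext_surj hΦ hΦc hfa
  obtain ⟨β, hβ, hΦβ⟩ := ext_surj hΦ hΦc hfb
  have hA := fun n => ext_surj (hΦn n) (hΦnc n) (hfr n)
  have hB := fun n => ext_surj (hΦn n) (hΦnc n) (hfrb n)
  choose αn hαn hΦαn using hA
  choose βn hβn hΦβn using hB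
  have hK : IsCompact (frontier G) := by rw [h.a.fr]; exact h.a.cyc.compact
  refine ⟨Φ, α, β, Φn, αn, βn, ⟨hΦ, hΦc, hα, hβ, ?_, hΦα, hΦβ⟩,
    fun n => ⟨hΦn n, hΦnc n, hαn n, hβn n, ?_, hΦαn n, hΦβn n⟩, hU, ?_, ?_⟩
  · rintro rfl
    exact h.a.a_notMem ⟨s, Ioo_subset_Icc_self hs, hΦβ.symm.trans hΦα⟩
  · intro e
    have h1 := hΦαn n
    rw [e, hΦβn n] at h1
    exact (h.an n).a_notMem (h1 ▸ hbn n)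
  · refine zeta_conv hΦc hU hαn hΦαn (h.u1.tendsto_at 1) fun y hy hy2 => ?_
    exact ext_unique hΦ hΦc hK hfa (by rw [h.a.fr]; exact h.a.preconn_a) hy hα hy2 hΦα
  · refine zeta_conv hΦc hU hβn hΦβn hb fun y hy hy2 => ?_
    exact ext_unique hΦ hΦc hK hfb (by rw [h.a.fr]; exact h.a.preconn_b hs) hy hβ hy2 hΦβ

end HP

end

section
open Set Filter Topology Metric

namespace HP

noncomputable def mw (α β : ℂ) : ℂ := Complex.I * (1 - α / β)

noncomputable def mt (w z : ℂ) : ℂ := (z - w) / (z - (starRingEnd ℂ) w)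

noncomputable def mM (α β z : ℂ) : ℂ := β * mt (mw α β) z

theorem mw_im {α β : ℂ} (hα : ‖α‖ = 1) (hβ : ‖β‖ = 1) (hne : α ≠ β) : 0 < (mw α β).im := by
  have hβ0 : β ≠ 0 := by rintro rfl; simp at hβ
  have hu : ‖α / β‖ = 1 := by simp [hα, hβ]
  have hu1 : α / β ≠ 1 := fun e => hne ((div_eq_one_iff_eq hβ0).1 e)
  have him : (mw α β).im = 1 - (α / β).re := by simp only [mw, Complex.mul_im]; simp
  rw [him]
  have hle : (α / β).re ≤ 1 := hu ▸ Complex.re_le_norm _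
  refine sub_pos.2 (hle.lt_of_ne fun e => hu1 ?_)
  have h2 : Complex.normSq (α / β) = 1 := by rw [Complex.normSq_eq_norm_sq, hu]; norm_num
  rw [Complex.normSq_apply, e] at h2
  have h3 : (α / β).im = 0 := by nlinarith
  exact Complex.ext e h3

theorem conj_eq_inv {u : ℂ} (hu : ‖u‖ = 1) : (starRingEnd ℂ) u = u⁻¹ := by
  rw [Complex.inv_def, Complex.normSq_eq_norm_sq, hu]; simp

theorem mM_zero {α β : ℂ} (hα : ‖α‖ = 1) (hβ : ‖β‖ = 1) (hne : α ≠ β) : mM α β 0 = α := by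
  have hβ0 : β ≠ 0 := by rintro rfl; simp at hβ
  have hα0 : α ≠ 0 := by rintro rfl; simp at hα
  have hu : ‖α / β‖ = 1 := by simp [hα, hβ]
  have h1 : α - β ≠ 0 := sub_ne_zero.2 hne
  have h2 : (starRingEnd ℂ) (mw α β) = -Complex.I * (1 - (α/β)⁻¹) := by
    rw [mw, map_mul, map_sub, map_one, conj_eq_inv hu, Complex.conj_I]
  have h3 : (1 - (α/β)⁻¹) ≠ 0 := by
    rw [inv_div]
    intro e
    exact hne ((div_eq_one_iff_eq hα0).1 (sub_eq_zero.1 e).symm).symm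
  rw [mM, mt, h2, mw]
  have hI : Complex.I ≠ 0 := Complex.I_ne_zero
  rw [mul_div_assoc', div_eq_iff (by simpa using h3)]
  field_simp
  ring

theorem mt_den {w z : ℂ} (hw : 0 < w.im) (hz : 0 ≤ z.im) : z - (starRingEnd ℂ) w ≠ 0 := by
  intro e
  have := congrArg Complex.im e
  simp at this
  linarith

theorem mt_den_norm {w z : ℂ} (_hw : 0 < w.im) (hz : 0 ≤ z.im) : w.im ≤ ‖z - (starRingEnd ℂ) w‖ := by
  have := Complex.abs_im_le_norm (z - (starRingEnd ℂ) w)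
  simp at this
  have h2 := le_abs_self (z.im + w.im)
  linarith

theorem mt_sq (w z : ℂ) : ‖z - (starRingEnd ℂ) w‖ ^ 2 - ‖z - w‖ ^ 2 = 4 * z.im * w.im := by
  rw [← Complex.normSq_eq_norm_sq, ← Complex.normSq_eq_norm_sq, Complex.normSq_apply,
    Complex.normSq_apply]
  simp
  ring

theorem mt_norm_le {w z : ℂ} (hw : 0 < w.im) (hz : 0 ≤ z.im) : ‖mt w z‖ ≤ 1 := by
  rw [mt, norm_div, div_le_one (norm_pos_iff.2 (mt_den hw hz))]
  have := mt_sq w z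
  have h2 : 0 ≤ 4 * z.im * w.im := by positivity
  exact (sq_le_sq₀ (norm_nonneg _) (norm_nonneg _)).1 (by linarith)

theorem mt_norm_lt {w z : ℂ} (hw : 0 < w.im) (hz : 0 < z.im) : ‖mt w z‖ < 1 := by
  rw [mt, norm_div, div_lt_one (norm_pos_iff.2 (mt_den hw hz.le))]
  have := mt_sq w z
  have h2 : 0 < 4 * z.im * w.im := by positivity
  exact (sq_lt_sq₀ (norm_nonneg _) (norm_nonneg _)).1 (by linarith)

theorem mt_surj {w t : ℂ} (hw : 0 < w.im) (ht : ‖t‖ < 1) : ∃ z : ℂ, 0 < z.im ∧ mt w z = t := by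
  have ht1 : t - 1 ≠ 0 := fun e => by rw [sub_eq_zero.1 e] at ht; simp at ht
  set z : ℂ := (t * (starRingEnd ℂ) w - w) / (t - 1) with hzd
  have hz : t * (z - (starRingEnd ℂ) w) = z - w := by
    have : z * (t - 1) = t * (starRingEnd ℂ) w - w := by rw [hzd]; field_simp
    linear_combination this
  have hd : z - (starRingEnd ℂ) w ≠ 0 := by
    intro e
    rw [e, mul_zero] at hz
    have h1 : w = (starRingEnd ℂ) w := by linear_combination e - hz.symm
    have h2 := congrArg Complex.im h1
    simp at h2
    linarith
  have hpos := norm_pos_iff.2 hd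
  have h1 : ‖z - w‖ < ‖z - (starRingEnd ℂ) w‖ := by
    rw [← hz, norm_mul]
    nlinarith
  have h2 := mt_sq w z
  have h3 := (sq_lt_sq₀ (norm_nonneg _) (norm_nonneg _)).2 h1
  have h4 : 0 < (4 * z.im) * w.im := by linarith
  have h5 := (pos_iff_pos_of_mul_pos h4).2 hw
  refine ⟨z, by linarith, ?_⟩
  rw [mt, div_eq_iff hd, hz]

theorem mt_inj {w z z' : ℂ} (hw : 0 < w.im) (hz : 0 ≤ z.im) (hz' : 0 ≤ z'.im) (h : mt w z = mt w z') :
    z = z' := by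
  rw [mt, mt, div_eq_div_iff (mt_den hw hz) (mt_den hw hz')] at h
  have h1 : (z - z') * (w - (starRingEnd ℂ) w) = 0 := by linear_combination h
  rcases mul_eq_zero.1 h1 with h2 | h2
  · exact sub_eq_zero.1 h2
  · have := congrArg Complex.im h2
    simp at this
    linarith

theorem mt_sub {w w' z : ℂ} (hw : 0 < w.im) (hw' : 0 < w'.im) (hz : 0 ≤ z.im) :
    ‖mt w' z - mt w z‖ ≤ 2 * ‖w' - w‖ / w'.im := by
  have hd := mt_den hw hz
  have hd' := mt_den hw' hz
  have e : mt w' z - mt w z = ((w - w') + mt w z * ((starRingEnd ℂ) (w' - w))) / (z - (starRingEnd ℂ) w') := by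
    rw [mt, mt, map_sub]
    field_simp
    ring
  rw [e, norm_div]
  have h1 : ‖(w - w') + mt w z * ((starRingEnd ℂ) (w' - w))‖ ≤ 2 * ‖w' - w‖ := by
    refine (norm_add_le _ _).trans ?_
    rw [norm_mul, norm_sub_rev w w', RCLike.norm_conj]
    have := mul_le_mul_of_nonneg_right (mt_norm_le hw hz) (norm_nonneg (w' - w))
    linarith
  exact div_le_div₀ (by positivity) h1 hw' (mt_den_norm hw' hz)

theorem mt_inf {w : ℂ} (hw : 0 < w.im) {δ : ℝ} (hδ : 0 < δ) :
    ∃ M : ℝ, ∀ z ∈ UpperHalfCl, M < ‖z‖ → ‖mt w z - 1‖ < δ := by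
  refine ⟨2 * ‖w‖ / δ + ‖w‖, fun z hz hM => ?_⟩
  have hd := mt_den hw hz
  have e : mt w z - 1 = ((starRingEnd ℂ) w - w) / (z - (starRingEnd ℂ) w) := by
    rw [mt]; field_simp; ring
  rw [e, norm_div, div_lt_iff₀ (norm_pos_iff.2 hd)]
  have h1 : ‖(starRingEnd ℂ) w - w‖ ≤ 2 * ‖w‖ := by
    refine (norm_sub_le _ _).trans ?_
    rw [RCLike.norm_conj]; linarith
  have h2 : 2 * ‖w‖ / δ < ‖z - (starRingEnd ℂ) w‖ := by
    have := norm_sub_norm_le z ((starRingEnd ℂ) w)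
    rw [RCLike.norm_conj] at this
    linarith
  rw [div_lt_iff₀ hδ] at h2
  linarith

theorem mt_cont {w : ℂ} (hw : 0 < w.im) : ContinuousOn (mt w) UpperHalfCl := by
  unfold mt
  exact ContinuousOn.div (by fun_prop) (by fun_prop) fun z hz => mt_den hw hz

theorem mt_diff {w : ℂ} (hw : 0 < w.im) : DifferentiableOn ℂ (mt w) UpperHalf := by
  unfold mt
  exact DifferentiableOn.div (by fun_prop) (by fun_prop) fun z hz => mt_den hw (le_of_lt hz)

section
variable {Φ : ℂ → ℂ} {G : Set ℂ} {a b α β : ℂ}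

theorem DData.w_im (h : DData Φ G a b α β) : 0 < (mw α β).im := mw_im h.nα h.nβ h.ne

theorem DData.maps (h : DData Φ G a b α β) : MapsTo (mM α β) UpperHalf (ball 0 1) := fun z hz => by
  simpa [mM, h.nβ] using mt_norm_lt h.w_im hz

theorem DData.mapsCl (h : DData Φ G a b α β) : MapsTo (mM α β) UpperHalfCl (closedBall 0 1) :=
  fun z hz => by
  simpa [mM, h.nβ] using mt_norm_le h.w_im hz

theorem DData.β0 (h : DData Φ G a b α β) : β ≠ 0 := by
  rintro rfl
  simpa using h.nβ

theorem DData.half (h : DData Φ G a b α β) :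
    DifferentiableOn ℂ (Φ ∘ mM α β) UpperHalf ∧ BijOn (Φ ∘ mM α β) UpperHalf G ∧
    ContinuousOn (Φ ∘ mM α β) UpperHalfCl ∧ (Φ ∘ mM α β) 0 = a ∧
    (∀ ε : ℝ, 0 < ε → ∃ M : ℝ, ∀ z ∈ UpperHalfCl, M < ‖z‖ → dist ((Φ ∘ mM α β) z) b < ε) := by
  have hbij : BijOn (mM α β) UpperHalf (ball 0 1) := by
    refine ⟨h.maps, fun z hz z' hz' e => ?_, fun ζ hζ => ?_⟩
    · exact mt_inj h.w_im (le_of_lt hz) (le_of_lt hz') (mul_left_cancel₀ h.β0 e)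
    · obtain ⟨z, hz, hze⟩ := mt_surj h.w_im (t := ζ / β) (by simpa [h.nβ] using hζ)
      exact ⟨z, hz, by rw [mM, hze, mul_div_cancel₀ _ h.β0]⟩
  refine ⟨h.rm.d.comp ((mt_diff h.w_im).const_mul β) h.maps, h.rm.b.comp hbij,
    h.cont.comp (continuousOn_const.mul (mt_cont h.w_im)) h.mapsCl, ?_, fun ε hε => ?_⟩
  · simp only [Function.comp, mM_zero h.nα h.nβ h.ne, h.Φα]
  · obtain ⟨δ, hδ, H⟩ := Metric.continuousOn_iff.1 h.cont β (by simp [h.nβ]) ε hε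
    obtain ⟨M, hM⟩ := mt_inf h.w_im hδ
    refine ⟨M, fun z hz hzM => ?_⟩
    have h1 := hM z hz hzM
    rw [← h.Φβ]
    refine H _ (h.mapsCl hz) ?_
    have : mM α β z - β = β * (mt (mw α β) z - 1) := by rw [mM]; ring
    rw [dist_eq_norm, this, norm_mul, h.nβ, one_mul]
    exact h1

theorem half_unif {Φn : ℕ → ℂ → ℂ} {Gn : ℕ → Set ℂ} {an bn αn βn : ℕ → ℂ} (h : DData Φ G a b α β)
    (hn : ∀ n, DData (Φn n) (Gn n) (an n) (bn n) (αn n) (βn n))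
    (hu : TendstoUniformlyOn Φn Φ atTop (closedBall 0 1)) (hα : Tendsto αn atTop (𝓝 α))
    (hβ : Tendsto βn atTop (𝓝 β)) :
    TendstoUniformlyOn (fun n => Φn n ∘ mM (αn n) (βn n)) (Φ ∘ mM α β) atTop UpperHalfCl := by
  rw [Metric.tendstoUniformlyOn_iff] at hu ⊢
  intro ε hε
  obtain ⟨δ, hδ, H⟩ := Metric.uniformContinuousOn_iff.1
    ((isCompact_closedBall (0:ℂ) 1).uniformContinuousOn_of_continuous h.cont) (ε/2) (by positivity)
  have hw : Tendsto (fun n => mw (αn n) (βn n)) atTop (𝓝 (mw α β)) :=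
    tendsto_const_nhds.mul (tendsto_const_nhds.sub (hα.div hβ h.β0))
  have hwi : Tendsto (fun n => (mw (αn n) (βn n)).im) atTop (𝓝 (mw α β).im) :=
    (Complex.continuous_im.tendsto _).comp hw
  have hlim : Tendsto (fun n => ‖βn n - β‖ + 2 * ‖mw (αn n) (βn n) - mw α β‖ / (mw (αn n) (βn n)).im)
      atTop (𝓝 (‖β - β‖ + 2 * ‖mw α β - mw α β‖ / (mw α β).im)) :=
    (hβ.sub_const β).norm.add (((hw.sub_const _).norm.const_mul 2).div hwi h.w_im.ne')
  simp only [sub_self, norm_zero, mul_zero, zero_div, add_zero] at hlim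
  filter_upwards [hu (ε/2) (by positivity), hlim.eventually (gt_mem_nhds hδ)] with n h1 h2 z hz
  have hm := h.mapsCl hz
  have hmn := (hn n).mapsCl hz
  have h3 : dist (mM α β z) (mM (αn n) (βn n) z) < δ := by
    refine lt_of_le_of_lt ?_ h2
    have e : mM (αn n) (βn n) z - mM α β z = (βn n - β) * mt (mw (αn n) (βn n)) z +
      β * (mt (mw (αn n) (βn n)) z - mt (mw α β) z) := by simp only [mM]; ring
    rw [dist_comm, dist_eq_norm, e]
    refine (norm_add_le _ _).trans (add_le_add ?_ ?_)
    · rw [norm_mul]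
      exact mul_le_of_le_one_right (norm_nonneg _) (mt_norm_le (hn n).w_im hz)
    · rw [norm_mul, h.nβ, one_mul]
      exact mt_sub h.w_im (hn n).w_im hz
  have h4 := H _ hm _ hmn h3
  have h5 := h1 _ hmn
  have := dist_triangle (Φ (mM α β z)) (Φ (mM (αn n) (βn n) z)) (Φn n (mM (αn n) (βn n) z))
  simp only [Function.comp]
  linarith

end

end HP

end

section
open Set Filter Topology Metric

namespace HP

theorem reparam_iso {φ : unitInterval → unitInterval} (h : IsReparam φ) {η : ℝ} (h0 : 0 < η) (h1 : η < 1) :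
    ∃ e : unitInterval ≃o unitInterval, ∀ t, dist (e t) (φ t) ≤ η := by
  let f : unitInterval → unitInterval := fun t => ⟨(1 - η) * φ t + η * t, by
    have a1 := (φ t).2.1; have a2 := t.2.1
    have : 0 ≤ 1 - η := by linarith
    positivity, by
    have a1 := (φ t).2.2; have a2 := t.2.2
    nlinarith⟩
  have hsm : StrictMono f := by
    intro s t hst
    have a1 : (φ s : ℝ) ≤ φ t := h.2.1 hst.le
    have a2 : (s : ℝ) < t := hst
    change (1 - η) * (φ s : ℝ) + η * s < (1 - η) * φ t + η * t
    nlinarith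
  have hc : Continuous f := by
    have := h.1
    refine Continuous.subtype_mk ?_ _
    fun_prop
  have hf0 : f 0 = 0 := by
    apply Subtype.ext
    change (1 - η) * (φ 0 : ℝ) + η * ((0 : unitInterval) : ℝ) = _
    rw [h.2.2.1]; simp
  have hf1 : f 1 = 1 := by
    apply Subtype.ext
    change (1 - η) * (φ 1 : ℝ) + η * ((1 : unitInterval) : ℝ) = _
    rw [h.2.2.2]; simp
  have hs : Function.Surjective f := fun c =>
    mem_range_of_exists_le_of_exists_ge hc ⟨0, by rw [hf0]; exact c.2.1⟩ ⟨1, by rw [hf1]; exact c.2.2⟩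
  refine ⟨hsm.orderIsoOfSurjective f hs, fun t => ?_⟩
  change |(1 - η) * (φ t : ℝ) + η * t - φ t| ≤ η
  have a1 := (φ t).2.1; have a2 := t.2.1; have a3 := (φ t).2.2; have a4 := t.2.2
  rw [abs_le]
  constructor <;> nlinarith

theorem reparam_exists (γ₁ γ₂ : C(unitInterval, ℂ)) {r : ℝ} (hr : curveDist γ₁ γ₂ < r) :
    ∃ e : unitInterval ≃o unitInterval, ∀ t, dist (γ₁ (e t)) (γ₂ t) ≤ r := by
  have hid : IsReparam id := ⟨continuous_id, monotone_id, rfl, rfl⟩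
  have hne : { r : ℝ | 0 ≤ r ∧ ∃ φ ψ : unitInterval → unitInterval,
      IsReparam φ ∧ IsReparam ψ ∧ ∀ t, dist (γ₁ (φ t)) (γ₂ (ψ t)) ≤ r }.Nonempty :=
    ⟨dist γ₁ γ₂, dist_nonneg, id, id, hid, hid, fun t => ContinuousMap.dist_apply_le_dist t⟩
  obtain ⟨r', ⟨h0, φ, ψ, hφ, hψ, hd⟩, hr'⟩ := exists_lt_of_csInf_lt hne hr
  obtain ⟨δ₁, hδ₁, H₁⟩ := Metric.uniformContinuous_iff.1
    (CompactSpace.uniformContinuous_of_continuous γ₁.continuous) ((r - r')/2) (by linarith)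
  obtain ⟨δ₂, hδ₂, H₂⟩ := Metric.uniformContinuous_iff.1
    (CompactSpace.uniformContinuous_of_continuous γ₂.continuous) ((r - r')/2) (by linarith)
  obtain ⟨η, hη0, hη⟩ := exists_between (lt_min (lt_min hδ₁ hδ₂) one_pos)
  have hη1 : η < δ₁ := hη.trans_le ((min_le_left _ _).trans (min_le_left _ _))
  have hη2 : η < δ₂ := hη.trans_le ((min_le_left _ _).trans (min_le_right _ _))
  have hη3 : η < 1 := hη.trans_le (min_le_right _ _)
  obtain ⟨e₁, he₁⟩ := reparam_iso hφ hη0 hη3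
  obtain ⟨e₂, he₂⟩ := reparam_iso hψ hη0 hη3
  refine ⟨e₂.symm.trans e₁, fun t => ?_⟩
  obtain ⟨s, rfl⟩ := e₂.surjective t
  have a1 := H₁ ((he₁ s).trans_lt hη1)
  have a2 := H₂ ((he₂ s).trans_lt hη2)
  have a3 := hd s
  have a4 := dist_triangle4 (γ₁ (e₁ s)) (γ₁ (φ s)) (γ₂ (ψ s)) (γ₂ (e₂ s))
  rw [dist_comm (γ₂ (ψ s))] at a4
  simp only [OrderIso.trans_apply, OrderIso.symm_apply_apply]
  linarith

/-- extension of a reparametrized arc to the real line -/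
noncomputable def ex (J : C(unitInterval, ℂ)) (e : unitInterval ≃o unitInterval) : ℝ → ℂ :=
  fun x => J (e (projIcc 0 1 zero_le_one x))

theorem ex_cont (J : C(unitInterval, ℂ)) (e : unitInterval ≃o unitInterval) : Continuous (ex J e) :=
  J.continuous.comp (e.continuous.comp continuous_projIcc)

theorem ex_of_mem (J : C(unitInterval, ℂ)) (e : unitInterval ≃o unitInterval) {x : ℝ}
    (hx : x ∈ Icc (0:ℝ) 1) : ex J e x = J (e ⟨x, hx⟩) := by
  rw [ex, projIcc_of_mem _ hx]

theorem ex_zero (J : C(unitInterval, ℂ)) (e : unitInterval ≃o unitInterval) : ex J e 0 = J 0 := by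
  rw [ex_of_mem J e zero_mem_I]
  congr 1
  exact e.map_bot

theorem ex_one (J : C(unitInterval, ℂ)) (e : unitInterval ≃o unitInterval) : ex J e 1 = J 1 := by
  rw [ex_of_mem J e one_mem_I]
  congr 1
  exact e.map_top

theorem ex_image (J : C(unitInterval, ℂ)) (e : unitInterval ≃o unitInterval) :
    ex J e '' Icc 0 1 = range J := by
  apply Subset.antisymm
  · rintro _ ⟨x, -, rfl⟩
    exact ⟨_, rfl⟩
  · rintro _ ⟨t, rfl⟩
    refine ⟨(e.symm t : ℝ), (e.symm t).2, ?_⟩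
    rw [ex_of_mem J e (e.symm t).2]
    simp

theorem ex_inj {J : C(unitInterval, ℂ)} (hJ : Function.Injective J) (e : unitInterval ≃o unitInterval) :
    InjOn (ex J e) (Icc 0 1) := by
  intro x hx y hy h
  rw [ex_of_mem J e hx, ex_of_mem J e hy] at h
  exact congrArg Subtype.val (e.injective (hJ h))

theorem adm_of (D : AdmissibleDomain) (e1 e2 e3 : unitInterval ≃o unitInterval) :
    Adm D.G (ex D.J1 e1) (ex D.J2 e2) (ex D.J3 e3) := by
  refine ⟨D.isOpen, D.bounded, ?_, ⟨ex_cont _ _, ex_cont _ _, ex_cont _ _, ex_inj D.inj1 _, ex_inj D.inj2 _,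
    ex_inj D.inj3 _, ?_, ?_, ?_⟩, ?_, ?_, ?_, ?_⟩
  · exact D.simplyConnected
  · rw [ex_one, ex_zero, D.e11, D.e20]
  · rw [ex_one, ex_zero, D.e21, D.e30]
  · rw [ex_one, ex_zero, D.e31, D.e10]
  · rw [KK, ex_image, ex_image, ex_image, D.boundary]
  · intro s hs t ht h
    by_contra! hc
    have hm : ex D.J1 e1 t ∈ range D.J3 ∩ (range D.J1 \ {D.d, D.a}) := by
      refine ⟨h ▸ ex_image D.J3 e3 ▸ mem_image_of_mem _ hs, ex_image D.J1 e1 ▸ mem_image_of_mem _ ht, ?_⟩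
      rintro (h' | h')
      · rw [← D.e10, ← ex_zero D.J1 e1] at h'
        exact hc.1 (ex_inj D.inj1 e1 ht zero_mem_I h')
      · rw [mem_singleton_iff, ← D.e11, ← ex_one D.J1 e1] at h'
        exact hc.2 (ex_inj D.inj1 e1 ht one_mem_I h')
    rw [D.noTouch1] at hm
    exact hm
  · intro s hs t ht h
    by_contra! hc
    have hm : ex D.J2 e2 t ∈ range D.J3 ∩ (range D.J2 \ {D.a, D.c}) := by
      refine ⟨h ▸ ex_image D.J3 e3 ▸ mem_image_of_mem _ hs, ex_image D.J2 e2 ▸ mem_image_of_mem _ ht, ?_⟩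
      rintro (h' | h')
      · rw [← D.e20, ← ex_zero D.J2 e2] at h'
        exact hc.1 (ex_inj D.inj2 e2 ht zero_mem_I h')
      · rw [mem_singleton_iff, ← D.e21, ← ex_one D.J2 e2] at h'
        exact hc.2 (ex_inj D.inj2 e2 ht one_mem_I h')
    rw [D.noTouch2] at hm
    exact hm
  · intro s hs
    exact D.toInfinity _ (ex_image D.J3 e3 ▸ mem_image_of_mem _ hs)

theorem ex_unif {Jn : ℕ → C(unitInterval, ℂ)} {J : C(unitInterval, ℂ)}
    (h : Tendsto (fun n => curveDist (Jn n) J) atTop (𝓝 0)) :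
    ∃ e : ℕ → (unitInterval ≃o unitInterval),
      TendstoUniformly (fun n => ex (Jn n) (e n)) (ex J (OrderIso.refl _)) atTop := by
  have := fun n : ℕ => reparam_exists (Jn n) J (r := curveDist (Jn n) J + 1 / ((n:ℝ) + 1))
    (by have : 0 < 1 / ((n:ℝ) + 1) := by positivity
        linarith)
  choose e he using this
  refine ⟨e, ?_⟩
  rw [Metric.tendstoUniformly_iff]
  intro ε hε
  have hl := h.add tendsto_one_div_add_atTop_nhds_zero_nat
  rw [add_zero] at hl
  filter_upwards [hl.eventually (gt_mem_nhds hε)] with n hn x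
  rw [dist_comm]
  exact (he n _).trans_lt hn

end HP

end

open HP in
theorem half_plane_maps_converge_uniformly
    (Dn : ℕ → AdmissibleDomain) (D : AdmissibleDomain) (h : AdmConverges Dn D)
    (bn : ℕ → ℂ) (b : ℂ)
    (hbn : ∀ n, bn n ∈ Set.range (Dn n).J3 \ {(Dn n).c, (Dn n).d})
    (hb : b ∈ Set.range D.J3 \ {D.c, D.d})
    (hbconv : Filter.Tendsto bn Filter.atTop (nhds b)) :
    ∃ (f : ℂ → ℂ) (fn : ℕ → ℂ → ℂ),
      (DifferentiableOn ℂ f UpperHalf ∧ Set.BijOn f UpperHalf D.G ∧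
        ContinuousOn f UpperHalfCl ∧ f 0 = D.a ∧
        (∀ ε : ℝ, 0 < ε → ∃ M : ℝ, ∀ z ∈ UpperHalfCl, M < ‖z‖ → dist (f z) b < ε)) ∧
      (∀ n, DifferentiableOn ℂ (fn n) UpperHalf ∧
        Set.BijOn (fn n) UpperHalf (Dn n).G ∧
        ContinuousOn (fn n) UpperHalfCl ∧ fn n 0 = (Dn n).a ∧
        (∀ ε : ℝ, 0 < ε → ∃ M : ℝ, ∀ z ∈ UpperHalfCl, M < ‖z‖ →
          dist (fn n z) (bn n) < ε)) ∧
      TendstoUniformlyOn (fun n => fn n) f Filter.atTop UpperHalfCl := by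
  obtain ⟨h1, h2, h3, -⟩ := h
  obtain ⟨e1, he1⟩ := ex_unif h1
  obtain ⟨e2, he2⟩ := ex_unif h2
  obtain ⟨e3, he3⟩ := ex_unif h3
  have hC : Conv Filter.atTop (fun n => (Dn n).G) (fun n => ex (Dn n).J1 (e1 n))
      (fun n => ex (Dn n).J2 (e2 n)) (fun n => ex (Dn n).J3 (e3 n)) D.G
      (ex D.J1 (OrderIso.refl _)) (ex D.J2 (OrderIso.refl _)) (ex D.J3 (OrderIso.refl _)) :=
    ⟨fun n => adm_of (Dn n) _ _ _, adm_of D _ _ _, he1, he2, he3⟩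
  obtain ⟨⟨s, rfl⟩, hbne⟩ := hb
  have hsI : ex D.J3 (OrderIso.refl _) (s : ℝ) = D.J3 s := ex_of_mem _ _ s.2
  have hs : (s : ℝ) ∈ Set.Ioo (0:ℝ) 1 := by
    refine ⟨s.2.1.lt_of_ne fun e => hbne (Or.inl ?_), s.2.2.lt_of_ne fun e => hbne (Or.inr ?_)⟩
    · have : s = 0 := Subtype.ext e.symm
      rw [this, D.e30]
    · have : s = 1 := Subtype.ext e
      rw [this, Set.mem_singleton_iff, D.e31]
  obtain ⟨Φ, α, β, Φn, αn, βn, hd, hdn, hu, hα, hβ⟩ := hC.disc_data hs (bn := bn)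
    (fun n => by rw [ex_image]; exact (hbn n).1) (by rw [hsI]; exact hbconv)
  refine ⟨Φ ∘ mM α β, fun n => Φn n ∘ mM (αn n) (βn n), ?_, fun n => ?_, half_unif hd hdn hu hα hβ⟩
  · have := hd.half
    rwa [ex_one, D.e11, hsI] at this
  · have := (hdn n).half
    rwa [ex_one, (Dn n).e11] at this
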